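/- Let c ∈ [1, 16/15), γ = 1/c, h ∈ F_c, φ the inverse of h, N prime, 1 ≤ m ≤ log N, 0 ≤ b ≤ m − 1 with gcd(b, m) = 1, and A ⊆ {1, ..., ⌊N/2⌋}. Define a(x) = 1_A(x) λ^h_{b,m,N}(x) on ℤ_N. Then for every r > (26 − 24γ)/(16γ − 15) there is a constant C'_{r,γ} > 0, independent of N, m, b, A, such that Σ_{ξ ∈ ℤ_N} |F_{ℤ_N}[a](ξ)|^r ≤ C'_{r,γ}. -/

import Mathlib

open Filter Real Set
open scoped Classical

structure Fc (c : ℝ) where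
  x₀ : ℝ
  one_le_x₀ : 1 ≤ x₀
  toFun : ℝ → ℝ
  vth : ℝ → ℝ
  Ch : ℝ
  Ch_pos : 0 < Ch
  one_le : ∀ x ≥ x₀, 1 ≤ toFun x
  contDiffOn : ContDiffOn ℝ 3 toFun (Set.Ici x₀)
  deriv_pos : ∀ x ≥ x₀, 0 < deriv toFun x
  deriv2_pos : ∀ x ≥ x₀, 0 < iteratedDeriv 2 toFun x
  vth_contDiffOn : ContDiffOn ℝ 2 vth (Set.Ici x₀)
  eqn : ∀ x ≥ x₀, toFun x = Ch * x ^ c * Real.exp (∫ t in x₀..x, vth t / t)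
  cond_gt : 1 < c →
    Filter.Tendsto vth Filter.atTop (nhds 0) ∧
    Filter.Tendsto (fun x => x * deriv vth x) Filter.atTop (nhds 0) ∧
    Filter.Tendsto (fun x => x ^ 2 * deriv (deriv vth) x) Filter.atTop (nhds 0)
  cond_eq : c = 1 →
    (∀ x ≥ x₀, 0 < vth x) ∧
    (∀ x y, x₀ ≤ x → x ≤ y → vth y ≤ vth x) ∧
    (∀ ε : ℝ, 0 < ε → ∃ C > 0, ∀ x ≥ x₀, 1 / vth x ≤ C * x ^ ε) ∧
    Filter.Tendsto (fun x => x / toFun x) Filter.atTop (nhds 0) ∧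
    Filter.Tendsto vth Filter.atTop (nhds 0) ∧
    Filter.Tendsto (fun x => x * deriv vth x / vth x) Filter.atTop (nhds 0) ∧
    Filter.Tendsto (fun x => x ^ 2 * deriv (deriv vth) x / vth x) Filter.atTop (nhds 0)

def Ph {c : ℝ} (F : Fc c) : Set ℕ :=
  {p : ℕ | p.Prime ∧ ∃ n : ℕ, F.x₀ ≤ (n : ℝ) ∧ (p : ℤ) = ⌊F.toFun n⌋}

noncomputable def e (t : ℝ) : ℂ := Complex.exp (2 * Real.pi * Complex.I * t)

/-- The measure `λ^h_{b,m,N}` on `Λ^h_{b,m,N} = {0 ≤ n ≤ N : mn + b ∈ P_h}`: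
`λ^h_{b,m,N}(n) = ϕ(m) log(mn+b) / (m N φ'(mn+b))` there and `0` otherwise. -/
noncomputable def lamh {c : ℝ} (F : Fc c) (φ : ℝ → ℝ) (b m N n : ℕ) : ℝ :=
  if n ≤ N ∧ m * n + b ∈ Ph F then
    (Nat.totient m : ℝ) * Real.log (m * n + b) / (m * N * deriv φ ((m * n + b : ℕ) : ℝ))
  else 0

/-- The Fourier transform on `ℤ_N` of a real-valued function (regarded on `{0, …, N-1}`):
`F_{ℤ_N}[f](ξ) = ∑_{x ∈ ℤ_N} f(x) e^{-2πiξx/N}`. -/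
noncomputable def fourierZN (N : ℕ) (f : ℕ → ℝ) (ξ : ℕ) : ℂ :=
  ∑ n ∈ Finset.range N, (f n : ℂ) * e (-((ξ : ℝ) * n / N))

/-- Convolution on `ℤ_N` (with `{0, …, N-1}` as a set of representatives):
`(f * g)(x) = ∑_{y ∈ ℤ_N} f(x - y) g(y)`. -/
noncomputable def convZN (N : ℕ) (f g : ℕ → ℝ) (x : ℕ) : ℝ :=
  ∑ y ∈ Finset.range N, f ((x + (N - y)) % N) * g y

/-- The distance of `t ∈ ℝ` to the nearest integer. -/
noncomputable def nint (t : ℝ) : ℝ := |t - round t|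

/-- The trilinear form `Λ₃(f, g, h) = ∑_{x, d ∈ ℤ_N} f(x) g(x+d) h(x+2d)` on `ℤ_N`. -/
noncomputable def lam3 (N : ℕ) (f g h : ℕ → ℝ) : ℝ :=
  ∑ x ∈ Finset.range N, ∑ d ∈ Finset.range N,
    f x * g ((x + d) % N) * h ((x + 2 * d) % N)


namespace DMP

section phi
variable {c : ℝ} (F : Fc c)

lemma vth_contAt {u : ℝ} (hu : F.x₀ < u) : ContinuousAt F.vth u :=
  (F.vth_contDiffOn.continuousOn).continuousAt (Ici_mem_nhds hu)

lemma vth_diff {u : ℝ} (hu : F.x₀ < u) : HasDerivAt F.vth (deriv F.vth u) u :=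
  ((F.vth_contDiffOn.contDiffAt (Ici_mem_nhds hu)).differentiableAt (by norm_num)).hasDerivAt

lemma x0_pos : 0 < F.x₀ := lt_of_lt_of_le one_pos F.one_le_x₀

lemma vdiv_contOn : ContinuousOn (fun t => F.vth t / t) (Ici F.x₀) :=
  F.vth_contDiffOn.continuousOn.div continuousOn_id
    (fun _ ht => (lt_of_lt_of_le (x0_pos F) ht).ne')

lemma vdiv_int {a b : ℝ} (ha : F.x₀ ≤ a) (hb : F.x₀ ≤ b) :
    IntervalIntegrable (fun t => F.vth t / t) MeasureTheory.volume a b := by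
  apply ContinuousOn.intervalIntegrable
  apply (vdiv_contOn F).mono
  intro t ht
  rcases le_total a b with h | h
  · rw [uIcc_of_le h] at ht; exact ha.trans ht.1
  · rw [uIcc_of_ge h] at ht; exact hb.trans ht.1

lemma h_hasDeriv {u : ℝ} (hu : F.x₀ < u) :
    HasDerivAt F.toFun (F.toFun u * (c + F.vth u) / u) u := by
  have hu0 : 0 < u := (x0_pos F).trans hu
  have h1 : HasDerivAt (fun x => ∫ t in F.x₀..x, F.vth t / t) (F.vth u / u) u := by
    apply intervalIntegral.integral_hasDerivAt_right (vdiv_int F le_rfl hu.le)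
    · exact ContinuousOn.stronglyMeasurableAtFilter isOpen_Ioi
        ((vdiv_contOn F).mono Ioi_subset_Ici_self) u hu
    · exact (vth_contAt F hu).div continuousAt_id hu0.ne'
  have h2 := ((Real.hasDerivAt_rpow_const (p := c) (Or.inl hu0.ne')).const_mul F.Ch).mul h1.exp
  have h3 : HasDerivAt F.toFun _ u := h2.congr_of_eventuallyEq (by
    filter_upwards [Ici_mem_nhds hu] with x hx
    exact F.eqn x hx)
  convert h3 using 1
  rw [F.eqn u hu.le, Real.rpow_sub_one hu0.ne']
  field_simp

lemma vth_tendsto (hc : 1 ≤ c) : Tendsto F.vth atTop (nhds 0) := by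
  rcases hc.eq_or_lt with h | h
  · exact (F.cond_eq h.symm).2.2.2.2.1
  · exact (F.cond_gt h).1

lemma vth'_tendsto (hc : 1 ≤ c) : Tendsto (fun x => x * deriv F.vth x) atTop (nhds 0) := by
  rcases hc.eq_or_lt with h | h
  · obtain ⟨h1, -, -, -, h2, h3, -⟩ := F.cond_eq h.symm
    have := h3.mul h2
    rw [mul_zero] at this
    refine this.congr' ?_
    filter_upwards [eventually_ge_atTop F.x₀] with x hx
    have := (h1 x hx).ne'
    field_simp
  · exact (F.cond_gt h).2.1

/-- the function with `φ'' = - φ'/x * ρ(φ x)` -/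
noncomputable def rho (u : ℝ) : ℝ :=
  (c + F.vth u - 1) / (c + F.vth u) + u * deriv F.vth u / (c + F.vth u) ^ 2

lemma rho_bounds (hc : 1 ≤ c) : ∃ U : ℝ, F.x₀ < U ∧
    (∀ u ≥ U, 1 / 2 ≤ c + F.vth u ∧ c + F.vth u ≤ c + 1 ∧ 0 < rho F u ∧ rho F u ≤ 7) ∧
    ∀ ε : ℝ, 0 < ε → ∃ c' > 0, ∀ u ≥ U, c' * u ^ (-ε) ≤ rho F u := by
  have e1 : ∀ᶠ u in atTop, |F.vth u| < 1/2 := by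
    have := (vth_tendsto F hc).abs
    rw [abs_zero] at this
    exact this.eventually_lt_const (by norm_num)
  have e2 : ∀ᶠ u in atTop, |u * deriv F.vth u| < 1/2 := by
    have := (vth'_tendsto F hc).abs
    rw [abs_zero] at this
    exact this.eventually_lt_const (by norm_num)
  have up : ∀ u, |F.vth u| < 1/2 → |u * deriv F.vth u| < 1/2 → rho F u ≤ 7 := by
    intro u h1 h2
    rw [abs_lt] at h1 h2
    have hp : 1/2 ≤ c + F.vth u := by linarith
    unfold rho
    have a1 : (c + F.vth u - 1) / (c + F.vth u) ≤ 1 := by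
      rw [div_le_one (by linarith)]; linarith
    have a2 : u * deriv F.vth u / (c + F.vth u) ^ 2 ≤ 2 := by
      rw [div_le_iff₀ (by positivity)]; nlinarith
    linarith
  rcases hc.eq_or_lt with h | h
  · obtain ⟨h1, -, h4, -, h2, h3, -⟩ := F.cond_eq h.symm
    have e3 : ∀ᶠ u in atTop, |u * deriv F.vth u / F.vth u| < 1/2 := by
      have := h3.abs
      rw [abs_zero] at this
      exact this.eventually_lt_const (by norm_num)
    obtain ⟨U, hU⟩ := (e1.and (e2.and e3)).exists_forall_of_atTop
    have low : ∀ u ≥ max U (F.x₀+1), F.vth u / 8 ≤ rho F u := by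
      intro u hu
      obtain ⟨k1, k2, k3⟩ := hU u (le_of_max_le_left hu)
      have hx : F.x₀ ≤ u := by linarith [le_of_max_le_right hu]
      have hv := h1 u hx
      rw [abs_lt] at k1 k2 k3
      unfold rho
      have hcv : c + F.vth u = 1 + F.vth u := by linarith
      rw [hcv]
      have hw : u * deriv F.vth u = F.vth u * (u * deriv F.vth u / F.vth u) := by field_simp
      rw [hw]
      set s := u * deriv F.vth u / F.vth u
      set v := F.vth u
      have : (1 + v - 1) / (1 + v) + v * s / (1 + v)^2 = v * ((1 + v + s) / (1+v)^2) := by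
        field_simp; ring
      rw [this]
      have : (1:ℝ) / 8 ≤ (1 + v + s) / (1+v)^2 := by
        rw [div_le_div_iff₀ (by norm_num) (by positivity)]; nlinarith
      calc v / 8 = v * (1/8) := by ring
        _ ≤ _ := by gcongr
    refine ⟨max U (F.x₀ + 1), by simp, ?_, ?_⟩
    · intro u hu
      obtain ⟨k1, k2, k3⟩ := hU u (le_of_max_le_left hu)
      have hx : F.x₀ ≤ u := by linarith [le_of_max_le_right hu]
      have := low u hu
      have hv := h1 u hx
      refine ⟨?_, ?_, by linarith, up u k1 k2⟩ <;> rw [abs_lt] at k1 <;> linarith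
    · intro ε hε
      obtain ⟨C, hC, hh⟩ := h4 ε hε
      refine ⟨1 / (8 * C), by positivity, ?_⟩
      intro u hu
      have hx : F.x₀ ≤ u := by linarith [le_of_max_le_right hu]
      have hu0 : 0 < u := lt_of_lt_of_le (x0_pos F) hx
      refine le_trans ?_ (low u hu)
      have h5 := hh u hx
      have hv := h1 u hx
      rw [Real.rpow_neg hu0.le]
      have hp : 0 < u ^ ε := by positivity
      rw [div_le_iff₀ hv] at h5
      rw [← div_eq_mul_inv, div_div, div_le_div_iff₀ (by positivity) (by norm_num)]
      nlinarith
  · have hpos : 0 < (c-1)/(4 * (c + 1)) := by apply div_pos <;> linarith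
    have t1 : Tendsto (fun u => rho F u) atTop (nhds ((c + 0 - 1)/(c+0) + 0/(c+0)^2)) := by
      unfold rho
      apply Tendsto.add
      · exact ((vth_tendsto F hc).const_add c |>.sub_const 1).div ((vth_tendsto F hc).const_add c)
          (by linarith)
      · exact (vth'_tendsto F hc).div (((vth_tendsto F hc).const_add c).pow 2) (by positivity)
    have e3 : ∀ᶠ u in atTop, (c-1)/(4*(c+1)) < rho F u := by
      apply t1.eventually_const_lt
      simp only [add_zero, zero_div]
      rw [div_lt_div_iff₀ (by linarith) (by linarith)]
      nlinarith
    obtain ⟨U, hU⟩ := (e1.and (e2.and e3)).exists_forall_of_atTop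
    refine ⟨max U (F.x₀ + 1), by simp, ?_, ?_⟩
    · intro u hu
      obtain ⟨k1, k2, k3⟩ := hU u (le_of_max_le_left hu)
      refine ⟨?_, ?_, by linarith, up u k1 k2⟩ <;> rw [abs_lt] at k1 <;> linarith
    · intro ε hε
      refine ⟨(c-1)/(4*(c+1)), hpos, fun u hu => ?_⟩
      obtain ⟨k1, k2, k3⟩ := hU u (le_of_max_le_left hu)
      have hx : F.x₀ ≤ u := by linarith [le_of_max_le_right hu]
      have := Real.rpow_le_one_of_one_le_of_nonpos (F.one_le_x₀.trans hx) (by linarith : -ε ≤ 0)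
      nlinarith

lemma int_bound (hc : 1 ≤ c) {ε : ℝ} (hε : 0 < ε) : ∃ M : ℝ, ∀ u ≥ F.x₀,
    |∫ t in F.x₀..u, F.vth t / t| ≤ M + ε * log u := by
  have e1 : ∀ᶠ u in atTop, |F.vth u| < ε := by
    have := (vth_tendsto F hc).abs
    rw [abs_zero] at this
    exact this.eventually_lt_const hε
  obtain ⟨t1, ht1⟩ := e1.exists_forall_of_atTop
  set t0 := max t1 F.x₀ with ht0
  have hx0 : F.x₀ ≤ t0 := le_max_right _ _
  have hcomp : ∃ B, ∀ t ∈ Icc F.x₀ t0, ‖F.vth t / t‖ ≤ B :=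
    isCompact_Icc.exists_bound_of_continuousOn ((vdiv_contOn F).mono Icc_subset_Ici_self)
  obtain ⟨B, hB⟩ := hcomp
  have hB0 : 0 ≤ B := (norm_nonneg _).trans (hB F.x₀ ⟨le_rfl, hx0⟩)
  have first : ∀ u, F.x₀ ≤ u → u ≤ t0 → |∫ t in F.x₀..u, F.vth t / t| ≤ B * (t0 - F.x₀) := by
    intro u hu hu'
    have := intervalIntegral.norm_integral_le_of_norm_le_const (a := F.x₀) (b := u)
      (f := fun t => F.vth t / t) (C := B) (by
        intro t ht
        rw [uIoc_of_le hu] at ht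
        exact hB t ⟨ht.1.le, ht.2.trans hu'⟩)
    rw [Real.norm_eq_abs, abs_of_nonneg (by linarith : 0 ≤ u - F.x₀)] at this
    refine this.trans ?_
    gcongr
  refine ⟨B * (t0 - F.x₀), fun u hu => ?_⟩
  have hu1 : 1 ≤ u := F.one_le_x₀.trans hu
  have hlog : 0 ≤ log u := Real.log_nonneg hu1
  rcases le_total u t0 with h | h
  · have := first u hu h
    nlinarith
  · have hsplit := intervalIntegral.integral_add_adjacent_intervals
      (vdiv_int F le_rfl hx0) (vdiv_int F hx0 hu)
    rw [← hsplit]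
    refine (abs_add_le _ _).trans (add_le_add (first t0 hx0 le_rfl) ?_)
    have ht00 : 0 < t0 := lt_of_lt_of_le (x0_pos F) hx0
    have h2 : ‖∫ t in t0..u, F.vth t / t‖ ≤ ∫ t in t0..u, ε * (1 / t) := by
      apply intervalIntegral.norm_integral_le_of_norm_le h
      · refine Eventually.of_forall fun t ht => ?_
        have htt : 0 < t := ht00.trans ht.1
        have := ht1 t ((le_max_left _ _).trans ht.1.le)
        rw [Real.norm_eq_abs, abs_div, abs_of_pos htt, div_eq_mul_one_div]
        gcongr
      · apply ContinuousOn.intervalIntegrable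
        apply ContinuousOn.mul continuousOn_const
        apply ContinuousOn.div continuousOn_const continuousOn_id
        intro t ht
        rw [uIcc_of_le h] at ht
        exact (lt_of_lt_of_le ht00 ht.1).ne'
    rw [intervalIntegral.integral_const_mul, integral_one_div_of_pos ht00 (by linarith)] at h2
    rw [Real.norm_eq_abs] at h2
    refine h2.trans ?_
    gcongr
    apply div_le_self (by linarith)
    exact F.one_le_x₀.trans hx0

lemma growth (hc : 1 ≤ c) {ε : ℝ} (hε : 0 < ε) : ∃ C > 0, ∀ u ≥ F.x₀,
    F.toFun u ≤ C * u ^ (c + ε) ∧ u ^ (c - ε) ≤ C * F.toFun u := by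
  obtain ⟨M, hM⟩ := int_bound F hc hε
  have hCh := F.Ch_pos
  refine ⟨F.Ch * exp M + exp M / F.Ch, by positivity, fun u hu => ?_⟩
  have hu0 : 0 < u := lt_of_lt_of_le (x0_pos F) hu
  have h1 := abs_le.1 (hM u hu)
  have hE : ∀ s, exp (s * log u) = u ^ s := fun s => by rw [Real.rpow_def_of_pos hu0, mul_comm]
  rw [F.eqn u hu]
  set I := ∫ t in F.x₀..u, F.vth t / t
  constructor
  · have : exp I ≤ exp M * u ^ ε := by
      rw [← hE, ← Real.exp_add]; exact Real.exp_le_exp.2 h1.2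
    rw [Real.rpow_add hu0]
    calc F.Ch * u ^ c * exp I ≤ F.Ch * u ^ c * (exp M * u ^ ε) := by gcongr
      _ = (F.Ch * exp M) * (u ^ c * u ^ ε) := by ring
      _ ≤ _ := by gcongr; linarith [div_pos (exp_pos M) hCh]
  · have : u ^ (-ε) ≤ exp M * exp I := by
      rw [← hE, ← Real.exp_add]; exact Real.exp_le_exp.2 (by linarith)
    rw [sub_eq_add_neg, Real.rpow_add hu0]
    calc u ^ c * u ^ (-ε) ≤ u ^ c * (exp M * exp I) := by gcongr
      _ = (exp M / F.Ch) * (F.Ch * u ^ c * exp I) := by field_simp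
      _ ≤ _ := by gcongr; linarith [mul_pos hCh (exp_pos M)]


end phi

structure PhiOK (φ φ1 φ2 : ℝ → ℝ) (γ X0 : ℝ) : Prop where
  X0_ge : 1 ≤ X0
  d1 : ∀ x ≥ X0, HasDerivAt φ (φ1 x) x
  d2 : ∀ x ≥ X0, HasDerivAt φ1 (φ2 x) x
  pos : ∀ x ≥ X0, 0 < φ1 x
  up : ∀ x ≥ X0, -φ2 x ≤ 7 * φ1 x / x
  low : ∀ ε : ℝ, 0 < ε → ∃ c' > 0, ∀ x ≥ X0, c' * x ^ (γ - 1 - ε) ≤ φ1 x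
  low2 : ∀ ε : ℝ, 0 < ε → ∃ c' > 0, ∀ x ≥ X0, c' * x ^ (-ε) * φ1 x / x ≤ -φ2 x

section phi2
variable {c : ℝ} (F : Fc c) (φ : ℝ → ℝ)

lemma h_cont : ContinuousOn F.toFun (Ici F.x₀) := F.contDiffOn.continuousOn

lemma h_strictMono : StrictMonoOn F.toFun (Ici F.x₀) := by
  apply strictMonoOn_of_deriv_pos (convex_Ici _) (h_cont F)
  intro x hx
  rw [interior_Ici] at hx
  exact F.deriv_pos x (le_of_lt hx)

lemma phi_strictMono (hφ₂ : ∀ y ≥ F.toFun F.x₀, F.toFun (φ y) = y)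
    (hφ₃ : ∀ y ≥ F.toFun F.x₀, F.x₀ ≤ φ y) : StrictMonoOn φ (Ici (F.toFun F.x₀)) := by
  intro a ha b hb hab
  by_contra hcon
  push Not at hcon
  have := (h_strictMono F).monotoneOn (hφ₃ b hb) (hφ₃ a ha) hcon
  rw [hφ₂ b hb, hφ₂ a ha] at this
  linarith

lemma phi_contAt (hφ₁ : ∀ x ≥ F.x₀, φ (F.toFun x) = x)
    (hφ₂ : ∀ y ≥ F.toFun F.x₀, F.toFun (φ y) = y)
    (hφ₃ : ∀ y ≥ F.toFun F.x₀, F.x₀ ≤ φ y) {y : ℝ} (hy : F.toFun F.x₀ < y) :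
    F.x₀ < φ y ∧ ContinuousAt φ y := by
  have hm := phi_strictMono F φ hφ₂ hφ₃
  have h1 : F.x₀ < φ y := by
    have := hm (self_mem_Ici) hy.le hy
    rwa [hφ₁ _ le_rfl] at this
  refine ⟨h1, hm.continuousAt_of_image_mem_nhds (Ici_mem_nhds hy) ?_⟩
  filter_upwards [Ici_mem_nhds h1] with x hx
  exact ⟨F.toFun x, (h_strictMono F).monotoneOn self_mem_Ici hx hx, hφ₁ x hx⟩

lemma phi_ok (hc : 1 ≤ c) (hφ₁ : ∀ x ≥ F.x₀, φ (F.toFun x) = x)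
    (hφ₂ : ∀ y ≥ F.toFun F.x₀, F.toFun (φ y) = y)
    (hφ₃ : ∀ y ≥ F.toFun F.x₀, F.x₀ ≤ φ y) :
    ∃ φ1 φ2 : ℝ → ℝ, ∃ X0 : ℝ, F.toFun F.x₀ ≤ X0 ∧ PhiOK φ φ1 φ2 (1 / c) X0 := by
  obtain ⟨U, hU, hb, hlow⟩ := rho_bounds F hc
  have hc0 : 0 < c := by linarith
  have hUx : F.toFun F.x₀ < F.toFun U := h_strictMono F self_mem_Ici hU.le hU
  have key : ∀ x ≥ F.toFun U, F.x₀ < φ x ∧ U ≤ φ x ∧ ContinuousAt φ x ∧ F.toFun (φ x) = x := by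
    intro x hx
    obtain ⟨a, b⟩ := phi_contAt F φ hφ₁ hφ₂ hφ₃ (hUx.trans_le hx)
    refine ⟨a, ?_, b, hφ₂ x (hUx.le.trans hx)⟩
    have := (phi_strictMono F φ hφ₂ hφ₃).monotoneOn hUx.le (hUx.le.trans hx) hx
    rwa [hφ₁ _ hU.le] at this
  have hX1 : 1 ≤ F.toFun U := F.one_le U hU.le
  set φ1 : ℝ → ℝ := fun x => φ x / (x * (c + F.vth (φ x))) with hφ1
  have hd1 : ∀ x ≥ F.toFun U, HasDerivAt φ (φ1 x) x := by
    intro x hx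
    obtain ⟨a, b, cc, d⟩ := key x hx
    have hh := h_hasDeriv F a
    have hp := (hb _ b).1
    have hx0 : 0 < x := by linarith
    have hu0 : 0 < φ x := (x0_pos F).trans a
    rw [d] at hh
    have := HasDerivAt.of_local_left_inverse cc hh (by positivity) (by
      filter_upwards [Ici_mem_nhds (hUx.trans_le hx)] with y hy
      exact hφ₂ y hy)
    have e1 : φ1 x = (x * (c + F.vth (φ x)) / φ x)⁻¹ := by simp [hφ1]
    rw [e1]; exact this
  have hpos : ∀ x ≥ F.toFun U, 0 < φ1 x := by
    intro x hx
    obtain ⟨a, b, cc, d⟩ := key x hx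
    have hp := (hb _ b).1
    have hx0 : 0 < x := by linarith
    have hu0 : 0 < φ x := (x0_pos F).trans a
    simp only [hφ1]; positivity
  refine ⟨φ1, fun x => - (φ1 x / x * rho F (φ x)), F.toFun U, hUx.le, hX1, hd1, ?_, hpos, ?_, ?_, ?_⟩
  · intro x hx
    obtain ⟨a, b, cc, d⟩ := key x hx
    have hp := (hb _ b).1
    have hx0 : 0 < x := by linarith
    have hu0 : 0 < φ x := (x0_pos F).trans a
    have hv := (vth_diff F a).comp x (hd1 x hx)
    have h2 := (hasDerivAt_id x).mul (hv.const_add c)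
    have h3 := (hd1 x hx).div h2 (by simp; constructor <;> linarith)
    refine HasDerivAt.congr_deriv h3 ?_
    simp only [hφ1, rho, id, Function.comp, Pi.mul_apply]
    field_simp
    ring
  · intro x hx
    obtain ⟨a, b, cc, d⟩ := key x hx
    have hx0 : 0 < x := by linarith
    have := (hb _ b).2.2.2
    have := hpos x hx
    rw [neg_neg, mul_div_assoc, mul_comm (7:ℝ)]
    gcongr
  · intro ε hε
    -- u ≥ c' x^(γ - ε)
    -- x ≤ C u^(c+ε')
    have hε' : 0 < ε * c := by positivity
    obtain ⟨C, hC, hg⟩ := growth F hc hε'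
    set s := 1 / (c + ε * c)
    have hs : 0 < s := by positivity
    have hs2 : 1 / c - ε ≤ s := by
      have h1e : s = 1 / c * (1 / (1 + ε)) := by simp only [s]; field_simp
      have h2e : 1 - ε ≤ 1 / (1 + ε) := by
        rw [le_div_iff₀ (by linarith)]; nlinarith
      have h3e : 1 / c ≤ 1 := by rw [div_le_one hc0]; exact hc
      have h4e : 0 < 1 / c := by positivity
      rw [h1e]; nlinarith
    refine ⟨(C ^ s)⁻¹ / (c + 1), by positivity, fun x hx => ?_⟩
    obtain ⟨a, b, cc, d⟩ := key x hx
    have hx0 : 0 < x := by linarith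
    have hu0 : 0 < φ x := (x0_pos F).trans a
    have h1 := (hg (φ x) a.le).1
    rw [d] at h1
    have h2 : x ^ s ≤ C ^ s * φ x := by
      calc x ^ s ≤ (C * φ x ^ (c + ε * c)) ^ s := by gcongr
        _ = C ^ s * φ x := by
          rw [Real.mul_rpow hC.le (by positivity), ← Real.rpow_mul hu0.le]
          simp only [s]
          rw [mul_one_div_cancel (by positivity), Real.rpow_one]
    have h3 : x ^ (1 / c - 1 - ε) ≤ x ^ s / x := by
      rw [← Real.rpow_sub_one hx0.ne']
      apply Real.rpow_le_rpow_of_exponent_le (by linarith); linarith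
    have hp := hb _ b
    have hC' : 0 < C ^ s := by positivity
    calc (C ^ s)⁻¹ / (c + 1) * x ^ (1 / c - 1 - ε)
        ≤ (C ^ s)⁻¹ / (c + 1) * ((C ^ s * φ x) / x) := by gcongr; exact h3.trans (by gcongr)
      _ = φ x / (x * (c + 1)) := by field_simp
      _ ≤ φ1 x := by
        simp only [hφ1]
        have : 0 < c + F.vth (φ x) := by linarith [hp.1]
        have := hp.2.1
        gcongr
  · intro ε hε
    obtain ⟨c', hc', hl⟩ := hlow (ε/2) (by positivity)
    obtain ⟨C, hC, hg⟩ := growth F hc (by norm_num : (0:ℝ) < 1/2)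
    refine ⟨c' * C ^ (-ε), by positivity, fun x hx => ?_⟩
    obtain ⟨a, b, cc, d⟩ := key x hx
    have hx0 : 0 < x := by linarith
    have hu0 : 0 < φ x := (x0_pos F).trans a
    have hu1 : 1 ≤ φ x := F.one_le_x₀.trans a.le
    have h1 := (hg (φ x) a.le).2
    rw [d] at h1
    have h2 : φ x ^ (1/2 : ℝ) ≤ C * x :=
      (Real.rpow_le_rpow_of_exponent_le hu1 (by linarith)).trans h1
    have h3 : (C * x) ^ (-ε) ≤ φ x ^ (-(ε/2)) := by
      have : φ x ^ (-(ε/2)) = (φ x ^ (1/2 : ℝ)) ^ (-ε) := by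
        rw [← Real.rpow_mul hu0.le]; congr 1; ring
      rw [this]
      apply Real.rpow_le_rpow_of_nonpos (by positivity) h2 (by linarith)
    have h4 := hl _ b
    have hpp := hpos x hx
    rw [neg_neg]
    rw [Real.mul_rpow hC.le hx0.le] at h3
    calc c' * C ^ (-ε) * x ^ (-ε) * φ1 x / x = φ1 x / x * (c' * (C ^ (-ε) * x ^ (-ε))) := by ring
      _ ≤ φ1 x / x * (c' * φ x ^ (-(ε/2))) := by gcongr
      _ ≤ _ := by gcongr

lemma phi1_anti {φ φ1 φ2 : ℝ → ℝ} {γ X0 : ℝ} (h : PhiOK φ φ1 φ2 γ X0) :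
    AntitoneOn φ1 (Ici X0) := by
  apply antitoneOn_of_deriv_nonpos (convex_Ici _)
  · intro x hx; exact (h.d2 x hx).continuousAt.continuousWithinAt
  · intro x hx
    rw [interior_Ici] at hx
    exact (h.d2 x (le_of_lt hx)).differentiableAt.differentiableWithinAt
  · intro x hx
    rw [interior_Ici] at hx
    have hx' : X0 ≤ x := le_of_lt hx
    rw [(h.d2 x hx').deriv]
    obtain ⟨c', h1, h2⟩ := h.low2 1 one_pos
    have h3 := h2 x hx'
    have h4 := h.pos x hx'
    have hx0 : 0 < x := by linarith [h.X0_ge]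
    have : 0 ≤ c' * x ^ (-1 : ℝ) * φ1 x / x := by positivity
    linarith

lemma Ph_near {φ1 φ2 : ℝ → ℝ} {γ X0 : ℝ} (h : PhiOK φ φ1 φ2 γ X0) (hX : F.toFun F.x₀ ≤ X0)
    (hφ₁ : ∀ x ≥ F.x₀, φ (F.toFun x) = x)
    (hφ₂ : ∀ y ≥ F.toFun F.x₀, F.toFun (φ y) = y)
    (hφ₃ : ∀ y ≥ F.toFun F.x₀, F.x₀ ≤ φ y) {p : ℕ} (hp : p ∈ Ph F) (hpX : X0 ≤ p) :
    ∃ k : ℕ, 0 ≤ k - φ p ∧ k - φ p ≤ φ1 p := by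
  obtain ⟨-, n, hn, hpn⟩ := hp
  have h1 : (p : ℝ) ≤ F.toFun n := by
    have := Int.floor_le (F.toFun n)
    rw [← hpn] at this; exact_mod_cast this
  have h2 : F.toFun n < p + 1 := by
    have := Int.lt_floor_add_one (F.toFun n)
    rw [← hpn] at this; exact_mod_cast this
  have hm := (phi_strictMono F φ hφ₂ hφ₃).monotoneOn
  have hp0 : F.toFun F.x₀ ≤ p := hX.trans hpX
  have h3 := hm hp0 (hp0.trans h1) h1
  have h4 := hm (hp0.trans h1) (by linarith : F.toFun F.x₀ ≤ (p:ℝ)+1) h2.le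
  rw [hφ₁ _ hn] at h3 h4
  refine ⟨n, by linarith, ?_⟩
  obtain ⟨ξ, hξ, hξ'⟩ := exists_hasDerivAt_eq_slope φ φ1 (by linarith : (p:ℝ) < p + 1)
    (fun x hx => (h.d1 x (hpX.trans hx.1)).continuousAt.continuousWithinAt)
    (fun x hx => h.d1 x (hpX.trans hx.1.le))
  have h5 := phi1_anti h hpX (hpX.trans hξ.1.le : X0 ≤ ξ) hξ.1.le
  rw [hξ'] at h5
  simp at h5
  linarith

end phi2
end DMP


namespace DMP

section ebasic

lemma e_add (s t : ℝ) : e (s + t) = e s * e t := by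
  unfold e; rw [← Complex.exp_add]; congr 1; push_cast; ring

lemma e_zero : e 0 = 1 := by simp [e]

lemma e_eq (t : ℝ) : e t = Complex.exp (Complex.I * ((2 * π * t : ℝ) : ℂ)) := by
  unfold e; congr 1; push_cast; ring

lemma norm_e (t : ℝ) : ‖e t‖ = 1 := by
  rw [e_eq, mul_comm]; exact Complex.norm_exp_ofReal_mul_I _

lemma e_int (k : ℤ) : e k = 1 := by
  unfold e
  rw [Complex.exp_eq_one_iff]
  exact ⟨k, by push_cast; ring⟩

lemma e_nat (k : ℕ) : e k = 1 := by exact_mod_cast e_int k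

lemma e_add_int (t : ℝ) (k : ℤ) : e (t + k) = e t := by rw [e_add, e_int, mul_one]

lemma e_sub_int (t : ℝ) (k : ℤ) : e (t - k) = e t := by
  have := e_add_int (t - k) k
  rw [sub_add_cancel] at this; exact this.symm

lemma e_ne_zero (t : ℝ) : e t ≠ 0 := by
  intro h; have := norm_e t; rw [h] at this; simp at this

lemma e_neg (t : ℝ) : e (-t) = (e t)⁻¹ := by
  apply eq_inv_of_mul_eq_one_left
  rw [← e_add]; simp [e_zero]

lemma e_conj (t : ℝ) : (starRingEnd ℂ) (e t) = e (-t) := by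
  rw [e_neg, Complex.inv_def, Complex.normSq_eq_norm_sq, norm_e]; simp

lemma e_nsmul (n : ℕ) (t : ℝ) : e (n * t) = e t ^ n := by
  unfold e; rw [← Complex.exp_nat_mul]; congr 1; push_cast; ring

lemma e_lip (s t : ℝ) : ‖e s - e t‖ ≤ 2 * π * |s - t| := by
  have h1 : e s - e t = e t * (e (s - t) - 1) := by
    rw [mul_sub, ← e_add]; simp
  rw [h1, norm_mul, norm_e, one_mul, e_eq]
  refine (Real.norm_exp_I_mul_ofReal_sub_one_le).trans ?_
  rw [Real.norm_eq_abs, abs_mul, abs_of_pos (by positivity : (0:ℝ) < 2 * π)]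

lemma e_sub_one_lower (t : ℝ) : 4 * |t - round t| ≤ ‖e t - 1‖ := by
  rw [← e_sub_int t (round t)]
  set s := t - round t
  have hs : |s| ≤ 1 / 2 := abs_sub_round t
  rw [e_eq, Complex.norm_exp_I_mul_ofReal_sub_one]
  rw [show 2 * π * s / 2 = π * s by ring]
  have : 2 * |s| ≤ |Real.sin (π * s)| := by
    have h1 : |Real.sin (π * s)| = |Real.sin (π * |s|)| := by
      rcases abs_choice s with h | h <;> rw [h]
      rw [mul_neg, Real.sin_neg, abs_neg]
    rw [h1]
    refine le_trans ?_ (le_abs_self _)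
    have := Real.mul_le_sin (x := π * |s|) (by positivity) (by nlinarith [pi_pos])
    refine le_trans (le_of_eq ?_) this
    field_simp
  rw [norm_mul, Real.norm_eq_abs, Real.norm_eq_abs]
  simp only [Nat.abs_ofNat]
  linarith

lemma e_ne_one {t : ℝ} (h : t ≠ round t) : e t ≠ 1 := by
  intro h1
  have := e_sub_one_lower t
  rw [h1, sub_self, norm_zero] at this
  have h2 : |t - round t| > 0 := abs_pos.2 (sub_ne_zero.2 h)
  linarith

lemma geom_bound (N : ℕ) {t κ : ℝ} (hκ : 0 < κ) (h : κ ≤ |t - round t|) :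
    ‖∑ n ∈ Finset.range N, e (n * t)‖ ≤ 1 / (2 * κ) := by
  have h0 : 0 < |t - round t| := hκ.trans_le h
  have h1 : e t ≠ 1 := e_ne_one (fun hh => by rw [← hh] at h0; simp at h0)
  simp_rw [e_nsmul]
  rw [geom_sum_eq h1, norm_div]
  have h2 : ‖e t ^ N - 1‖ ≤ 2 := by
    refine (norm_sub_le _ _).trans ?_
    rw [norm_pow, norm_e]; norm_num
  have h3 := e_sub_one_lower t
  calc ‖e t ^ N - 1‖ / ‖e t - 1‖ ≤ 2 / (4 * κ) := by
        apply div_le_div₀ (by norm_num) h2 (by positivity); linarith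
    _ = _ := by field_simp; norm_num

lemma geom_trivial (N : ℕ) (f : ℕ → ℝ) : ‖∑ n ∈ Finset.range N, e (f n)‖ ≤ N := by
  refine (norm_sum_le _ _).trans ?_
  simp [norm_e]

lemma geom_zero {N : ℕ} (hN : 0 < N) (k : ℤ) (h : ¬ (N : ℤ) ∣ k) :
    ∑ n ∈ Finset.range N, e (n * (k / N : ℝ)) = 0 := by
  have hN' : (N : ℝ) ≠ 0 := by positivity
  have h1 : e (k / N : ℝ) ≠ 1 := by
    apply e_ne_one
    intro hh
    apply h
    refine ⟨round (k / N : ℝ), ?_⟩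
    have : (k : ℝ) = N * (round (k / N : ℝ) : ℝ) := by
      rw [← hh]; field_simp
    exact_mod_cast this
  simp_rw [e_nsmul]
  rw [geom_sum_eq h1, ← e_nsmul, mul_div_cancel₀ _ hN', e_int]
  simp

end ebasic

section count

lemma round_mono_aux {x y : ℝ} (h : x ≤ y) : round x ≤ round y := by
  rw [round_eq, round_eq]
  exact Int.floor_le_floor (by linarith)

lemma count_near (S : Finset ℕ) (α : ℕ → ℝ) (A M κ d : ℝ) (hκ : 0 ≤ κ) (hd : 0 < d) (hM : 0 ≤ M)
    (hr : ∀ i ∈ S, A ≤ α i ∧ α i ≤ A + M)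
    (hs : ∀ i ∈ S, ∀ j ∈ S, i < j → d * ((j : ℝ) - i) ≤ |α i - α j|)
    (hn : ∀ i ∈ S, |α i - round (α i)| ≤ κ) :
    (S.card : ℝ) ≤ (2 * κ / d + 1) * (M + 2) := by
  set K := ⌊2 * κ / d⌋₊ with hK
  have hKle : (K : ℝ) ≤ 2 * κ / d := Nat.floor_le (by positivity)
  have h1 : S.card ≤ (K + 1) * (S.image (fun i => round (α i))).card := by
    apply Finset.card_le_mul_card_image
    intro a _
    rcases (S.filter (fun i => round (α i) = a)).eq_empty_or_nonempty with h | h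
    · rw [h]; simp
    · set T := S.filter (fun i => round (α i) = a)
      have hsub : T ⊆ Finset.Icc (T.min' h) (T.min' h + K) := by
        intro i hi
        have hmin := Finset.min'_mem T h
        have hle := Finset.min'_le T i hi
        rw [Finset.mem_Icc]
        refine ⟨hle, ?_⟩
        rcases hle.eq_or_lt with he | hlt
        · omega
        · rw [Finset.mem_filter] at hi hmin
          have k1 := hs _ hmin.1 i hi.1 hlt
          have k2 := hn _ hmin.1
          have k3 := hn _ hi.1
          rw [hi.2] at k3; rw [hmin.2] at k2
          have k4 : |α (T.min' h) - α i| ≤ 2 * κ := by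
            have : α (T.min' h) - α i = (α (T.min' h) - a) - (α i - a) := by ring
            rw [this]
            refine (abs_sub _ _).trans ?_
            linarith
          have k5 : ((i - T.min' h : ℕ) : ℝ) ≤ 2 * κ / d := by
            rw [Nat.cast_sub hle, le_div_iff₀ hd]; linarith
          have k6 := Nat.le_floor k5
          omega
      refine (Finset.card_le_card hsub).trans ?_
      rw [Nat.card_Icc]; omega
  have h2 : ((S.image (fun i => round (α i))).card : ℝ) ≤ M + 2 := by
    have hsub : S.image (fun i => round (α i)) ⊆ Finset.Icc (round A) (round (A + M)) := by
      intro k hk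
      rw [Finset.mem_image] at hk
      obtain ⟨i, hi, rfl⟩ := hk
      rw [Finset.mem_Icc]
      exact ⟨round_mono_aux (hr i hi).1, round_mono_aux (hr i hi).2⟩
    have h3 := Finset.card_le_card hsub
    rw [Int.card_Icc] at h3
    have h4 : round A ≤ round (A + M) := round_mono_aux (by linarith)
    have h5 : (((round (A + M) + 1 - round A).toNat : ℤ) : ℝ) = round (A + M) + 1 - round A := by
      rw [Int.toNat_of_nonneg (by omega)]; push_cast; ring
    have h6 := abs_le.1 (abs_sub_round A)
    have h7 := abs_le.1 (abs_sub_round (A + M))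
    have h8 : ((S.image (fun i => round (α i))).card : ℝ) ≤
        ((round (A + M) + 1 - round A).toNat : ℝ) := by exact_mod_cast h3
    have h9 : (((round (A + M) + 1 - round A).toNat : ℤ) : ℝ) =
      ((round (A + M) + 1 - round A).toNat : ℝ) := by norm_cast
    linarith
  calc (S.card : ℝ) ≤ (K + 1) * ((S.image (fun i => round (α i))).card : ℝ) := by exact_mod_cast h1
    _ ≤ _ := by gcongr

end count

section blocks
variable {φ φ1 φ2 : ℝ → ℝ} {γ X0 : ℝ}

lemma phi2_nonpos (h : PhiOK φ φ1 φ2 γ X0) {x : ℝ} (hx : X0 ≤ x) : φ2 x ≤ 0 := by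
  obtain ⟨c', h1, h2⟩ := h.low2 1 one_pos
  have h3 := h2 x hx
  have h4 := h.pos x hx
  have hx0 : 0 < x := by linarith [h.X0_ge]
  have : 0 ≤ c' * x ^ (-1 : ℝ) * φ1 x / x := by positivity
  linarith

lemma phi1_diff (h : PhiOK φ φ1 φ2 γ X0) {x y : ℝ} (hx : X0 ≤ x) (hxy : x < y) :
    ∃ z, x < z ∧ z < y ∧ φ1 x - φ1 y = (y - x) * (- φ2 z) := by
  obtain ⟨z, hz, hz'⟩ := exists_hasDerivAt_eq_slope φ1 φ2 hxy
    (fun u hu => (h.d2 u (hx.trans hu.1)).continuousAt.continuousWithinAt)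
    (fun u hu => h.d2 u (hx.trans hu.1.le))
  refine ⟨z, hz.1, hz.2, ?_⟩
  rw [hz']
  have : y - x ≠ 0 := by linarith
  field_simp; ring

lemma phi2_up (h : PhiOK φ φ1 φ2 γ X0) {x z : ℝ} (hx : X0 ≤ x) (hxz : x ≤ z) :
    - φ2 z ≤ 7 * φ1 x / x := by
  have h1 := h.up z (hx.trans hxz)
  have h2 := phi1_anti h hx (hx.trans hxz : X0 ≤ z) hxz
  have hx0 : 0 < x := by linarith [h.X0_ge]
  have := h.pos z (hx.trans hxz)
  have h4 : 0 ≤ 7 * φ1 x := by linarith [h.pos x hx]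
  refine h1.trans ?_
  gcongr

lemma lin_approx (h : PhiOK φ φ1 φ2 γ X0) {x v : ℝ} (hx : X0 ≤ x) (hv : 0 ≤ v) :
    |φ (x + v) - φ x - v * φ1 x| ≤ v ^ 2 * (7 * φ1 x / x) := by
  rcases hv.eq_or_lt with h0 | h0
  · rw [← h0]; simp
  obtain ⟨ξ, hξ, hξ'⟩ := exists_hasDerivAt_eq_slope φ φ1 (by linarith : x < x + v)
    (fun u hu => (h.d1 u (hx.trans hu.1)).continuousAt.continuousWithinAt)
    (fun u hu => h.d1 u (hx.trans hu.1.le))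
  obtain ⟨z, hz1, hz2, hz3⟩ := phi1_diff h hx hξ.1
  have h1 := phi2_up h hx hz1.le
  have h2 := phi2_nonpos h (hx.trans hz1.le)
  have h3 : φ (x + v) - φ x = v * φ1 ξ := by
    rw [hξ', add_sub_cancel_left]; field_simp
  rw [h3]
  have h4 : v * φ1 ξ - v * φ1 x = - (v * ((ξ - x) * (- φ2 z))) := by rw [← hz3]; ring
  rw [h4, abs_neg, abs_of_nonneg (mul_nonneg hv (mul_nonneg (by linarith [hξ.1]) (by linarith)))]
  have h5 : ξ - x ≤ v := by linarith [hξ.2]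
  calc v * ((ξ - x) * (- φ2 z)) ≤ v * (v * (7 * φ1 x / x)) := by
        gcongr
        linarith
    _ = _ := by ring

/-- exponential sum over a block of length `H` starting at `n0` -/
noncomputable def blockSum (φ : ℝ → ℝ) (m b H n0 : ℕ) (l : ℤ) (t : ℝ) : ℂ :=
  ∑ u ∈ Finset.range H, e (l * φ ((m * (n0 + u) + b : ℕ) : ℝ) + ((n0 + u : ℕ) : ℝ) * t)

lemma block_bound (h : PhiOK φ φ1 φ2 γ X0) (m b H n0 : ℕ) (l : ℤ) (t κ : ℝ) (hκ : 0 < κ)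
    (hx : X0 ≤ ((m * n0 + b : ℕ) : ℝ)) :
    ‖blockSum φ m b H n0 l t‖ ≤
      44 * (H : ℝ) ^ 3 * m ^ 2 * (|(l : ℝ)| * φ1 ((m * n0 + b : ℕ) : ℝ)) / ((m * n0 + b : ℕ) : ℝ) +
      (if |(l * m * φ1 ((m * n0 + b : ℕ) : ℝ) + t) -
        round (l * m * φ1 ((m * n0 + b : ℕ) : ℝ) + t)| ≤ κ then (H : ℝ) else 1 / (2 * κ)) := by
  set x := ((m * n0 + b : ℕ) : ℝ) with hxdef
  have hx0 : 0 < x := by linarith [h.X0_ge]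
  have hp := h.pos x hx
  set α := l * m * φ1 x + t with hα
  set g : ℕ → ℝ := fun u => (l * φ x + n0 * t) + u * α with hg
  have hlin : ‖∑ u ∈ Finset.range H, e (g u)‖ ≤
      (if |α - round α| ≤ κ then (H : ℝ) else 1 / (2 * κ)) := by
    split_ifs with hc
    · exact geom_trivial H g
    · push Not at hc
      simp only [hg, e_add]
      rw [← Finset.mul_sum, norm_mul, ← e_add, norm_e, one_mul]
      exact geom_bound H hκ hc.le
  have hdiff : ‖blockSum φ m b H n0 l t - ∑ u ∈ Finset.range H, e (g u)‖ ≤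
      44 * (H : ℝ) ^ 3 * m ^ 2 * (|(l : ℝ)| * φ1 x) / x := by
    unfold blockSum
    rw [← Finset.sum_sub_distrib]
    refine (norm_sum_le _ _).trans ?_
    have : ∀ u ∈ Finset.range H, ‖e (l * φ ((m * (n0 + u) + b : ℕ) : ℝ) + ((n0 + u : ℕ) : ℝ) * t)
        - e (g u)‖ ≤ 44 * (H : ℝ) ^ 2 * m ^ 2 * (|(l : ℝ)| * φ1 x) / x := by
      intro u hu
      rw [Finset.mem_range] at hu
      have huH : (u : ℝ) ≤ H := by exact_mod_cast hu.le
      refine (e_lip _ _).trans ?_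
      have hxu : ((m * (n0 + u) + b : ℕ) : ℝ) = x + m * u := by
        rw [hxdef]; push_cast; ring
      have hL := lin_approx h hx (by positivity : (0:ℝ) ≤ m * u)
      rw [hxu]
      have heq : l * φ (x + m * u) + ((n0 + u : ℕ) : ℝ) * t - g u =
          l * (φ (x + m * u) - φ x - m * u * φ1 x) := by
        simp only [hg, hα]; push_cast; ring
      rw [heq, abs_mul]
      have hpi : 2 * π * 7 ≤ 44 := by linarith [Real.pi_lt_d4]
      calc 2 * π * (|(l:ℝ)| * |φ (x + m * u) - φ x - m * u * φ1 x|)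
          ≤ 2 * π * (|(l:ℝ)| * ((m * u) ^ 2 * (7 * φ1 x / x))) := by gcongr
        _ = (2 * π * 7) * (u:ℝ) ^ 2 * m ^ 2 * (|(l:ℝ)| * φ1 x) / x := by ring
        _ ≤ 44 * (H:ℝ) ^ 2 * m ^ 2 * (|(l:ℝ)| * φ1 x) / x := by gcongr
    refine (Finset.sum_le_sum this).trans (le_of_eq ?_)
    rw [Finset.sum_const, Finset.card_range, nsmul_eq_mul]; ring
  have := norm_sub_norm_le (blockSum φ m b H n0 l t) (∑ u ∈ Finset.range H, e (g u))
  linarith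

/-- sum over blocks for a fixed frequency `l` -/
lemma blocks_l (h : PhiOK φ φ1 φ2 γ X0) (m b H N : ℕ) (hm : 1 ≤ m) (hH : 1 ≤ H) (I : Finset ℕ) (l : ℤ)
    (hl : l ≠ 0) (t κ s Z : ℝ) (hκ : 0 < κ) (hs : 0 < s) (hZ : 0 < Z)
    (hI : ∀ i ∈ I, X0 ≤ ((m * (i * H) + b : ℕ) : ℝ) ∧ Z ≤ ((m * (i * H) + b : ℕ) : ℝ) ∧
      (i + 1) * H ≤ N ∧ |(l : ℝ)| * φ1 ((m * (i * H) + b : ℕ) : ℝ) ≤ 1 / 8)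
    (hlow : ∀ x : ℝ, X0 ≤ x → x ≤ m * N + b → s ≤ - φ2 x) :
    ∑ i ∈ I, ‖blockSum φ m b H (i * H) l t‖ ≤
      ((N : ℝ) / H) * (6 * (H : ℝ) ^ 3 * m ^ 2 / Z + 1 / (2 * κ)) +
      H * ((2 * κ / (H * s) + 1) * (m + 2)) := by
  have hHp : (0:ℝ) < H := by exact_mod_cast hH
  have hmp : (1:ℝ) ≤ m := by exact_mod_cast hm
  set x : ℕ → ℝ := fun i => ((m * (i * H) + b : ℕ) : ℝ) with hx
  set α : ℕ → ℝ := fun i => l * m * φ1 (x i) + t with hα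
  set B := I.filter (fun i => |α i - round (α i)| ≤ κ) with hB
  have hl1 : 1 ≤ |(l:ℝ)| := by exact_mod_cast Int.one_le_abs hl
  have hxlt : ∀ i j : ℕ, i < j → x j - x i = m * H * ((j:ℝ) - i) := by
    intro i j _; simp only [hx]; push_cast; ring
  have hcard : (I.card : ℝ) ≤ N / H := by
    have hsub : I ⊆ Finset.range (N / H) := by
      intro i hi
      rw [Finset.mem_range]
      have := (hI i hi).2.2.1
      exact (Nat.le_div_iff_mul_le hH).2 this
    have h1 := Finset.card_le_card hsub
    rw [Finset.card_range] at h1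
    calc (I.card : ℝ) ≤ ((N / H : ℕ) : ℝ) := by exact_mod_cast h1
      _ ≤ _ := Nat.cast_div_le
  have hBcard : (B.card : ℝ) ≤ (2 * κ / (H * s) + 1) * (m + 2) := by
    have hmain : ∀ A : ℝ, (∀ i ∈ B, A ≤ α i ∧ α i ≤ A + m) →
        (B.card : ℝ) ≤ (2 * κ / (H * s) + 1) * (m + 2) := by
      intro A hA
      apply count_near B α A m κ (H * s) hκ.le (by positivity) (by linarith) hA
      · intro i hi j hj hij
        have hi' := hI i (Finset.mem_filter.1 hi).1
        have hj' := hI j (Finset.mem_filter.1 hj).1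
        have hij' : (0:ℝ) < (j:ℝ) - i := by
          have : (i:ℝ) < j := by exact_mod_cast hij
          linarith
        have hlt : x i < x j := by
          have := hxlt i j hij
          have : 0 < m * H * ((j:ℝ) - i) := by positivity
          linarith
        obtain ⟨z, hz1, hz2, hz3⟩ := phi1_diff h hi'.1 hlt
        have hzN : z ≤ m * N + b := by
          refine hz2.le.trans ?_
          have hjN : j * H ≤ N := le_trans (by nlinarith) hj'.2.2.1
          have : ((m * (j * H) + b : ℕ) : ℝ) ≤ ((m * N + b : ℕ) : ℝ) := by
            have : m * (j * H) + b ≤ m * N + b := by gcongr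
            exact_mod_cast this
          simp only [hx]; push_cast at this ⊢; linarith
        have hsz := hlow z (hi'.1.trans hz1.le) hzN
        have hd : α i - α j = l * (m * (φ1 (x i) - φ1 (x j))) := by simp only [hα]; ring
        rw [hd, hz3, abs_mul, hxlt i j hij]
        have h0 : 0 ≤ H * s * ((j:ℝ) - i) := by positivity
        have hle : H * s * ((j:ℝ) - i) ≤ m * (m * H * ((j:ℝ) - i) * -φ2 z) := by
          have a1 : H * s * ((j:ℝ) - i) ≤ H * (-φ2 z) * ((j:ℝ) - i) := by gcongr
          have a2 : H * (-φ2 z) * ((j:ℝ) - i) ≤ (m:ℝ)^2 * (H * (-φ2 z) * ((j:ℝ) - i)) := by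
            apply le_mul_of_one_le_left
            · have : 0 < -φ2 z := by linarith
              positivity
            · nlinarith
          nlinarith
        rw [abs_of_nonneg (h0.trans hle)]
        nlinarith
      · intro i hi; exact (Finset.mem_filter.1 hi).2
    have habs : ∀ i ∈ B, |l * m * φ1 (x i)| ≤ m / 8 := by
      intro i hi
      have hi' := hI i (Finset.mem_filter.1 hi).1
      rw [abs_mul, abs_mul, abs_of_nonneg (by positivity : (0:ℝ) ≤ m), abs_of_pos (h.pos _ hi'.1)]
      have := hi'.2.2.2
      have h9 : |(l:ℝ)| * φ1 (x i) ≤ 1 / 8 := this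
      nlinarith
    apply hmain (t - m / 8)
    intro i hi
    have := abs_le.1 (habs i hi)
    simp only [hα]
    constructor <;> linarith
  have hterm : ∀ i ∈ I, ‖blockSum φ m b H (i * H) l t‖ ≤
      (6 * (H : ℝ) ^ 3 * m ^ 2 / Z + 1 / (2 * κ)) + (if |α i - round (α i)| ≤ κ then (H:ℝ) else 0) := by
    intro i hi
    obtain ⟨h1, h2, h3, h4⟩ := hI i hi
    have hb := block_bound h m b H (i * H) l t κ hκ h1
    have h5 : 44 * (H : ℝ) ^ 3 * m ^ 2 * (|(l : ℝ)| * φ1 ((m * (i * H) + b : ℕ) : ℝ)) /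
        ((m * (i * H) + b : ℕ) : ℝ) ≤ 6 * (H : ℝ) ^ 3 * m ^ 2 / Z := by
      have := h.pos _ h1
      calc _ ≤ 44 * (H : ℝ) ^ 3 * m ^ 2 * (1/8) / Z := by gcongr
        _ ≤ 48 * (H : ℝ) ^ 3 * m ^ 2 * (1/8) / Z := by gcongr; norm_num
        _ = _ := by ring
    have h6 : 0 ≤ 1 / (2 * κ) := by positivity
    simp only [hα, hx]
    split_ifs at hb ⊢ <;> linarith
  refine (Finset.sum_le_sum hterm).trans ?_
  rw [Finset.sum_add_distrib, Finset.sum_const, nsmul_eq_mul, ← Finset.sum_filter, Finset.sum_const,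
    nsmul_eq_mul]
  have : 0 ≤ 6 * (H : ℝ) ^ 3 * m ^ 2 / Z + 1 / (2 * κ) := by positivity
  apply add_le_add
  · exact mul_le_mul_of_nonneg_right hcard this
  · rw [mul_comm]
    exact mul_le_mul_of_nonneg_left hBcard hHp.le

end blocks
end DMP


namespace DMP

section fejer

/-- Fejer kernel type majorant -/
noncomputable def fej (J : ℕ) (y : ℝ) : ℝ := (1 / (J : ℝ)) * ‖∑ j ∈ Finset.range J, e (j * y)‖ ^ 2

lemma fej_nonneg (J : ℕ) (y : ℝ) : 0 ≤ fej J y := by unfold fej; positivity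

lemma e_re (t : ℝ) : (e t).re = Real.cos (2 * π * t) := by
  rw [e_eq, mul_comm, Complex.exp_ofReal_mul_I_re]

lemma fej_lower (J : ℕ) (hJ : 1 ≤ J) (y : ℝ) (k : ℤ) (h : |y - k| ≤ 1 / (8 * J)) :
    (J : ℝ) / 2 ≤ fej J y := by
  have hJ0 : (0:ℝ) < J := by exact_mod_cast hJ
  have h1 : ∀ j ∈ Finset.range J, √2 / 2 ≤ (e (j * y)).re := by
    intro j hj
    rw [Finset.mem_range] at hj
    have hjJ : (j:ℝ) ≤ J := by exact_mod_cast hj.le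
    have : e (j * y) = e (j * (y - k)) := by
      rw [← e_sub_int (j * y) (j * k)]; congr 1; push_cast; ring
    rw [this, e_re, ← Real.cos_pi_div_four, ← Real.cos_abs (2 * π * _)]
    have h2 : |2 * π * (j * (y - k))| ≤ π / 4 := by
      rw [abs_mul, abs_of_pos (by positivity : 0 < 2 * π), abs_mul, abs_of_nonneg (by positivity : (0:ℝ) ≤ j)]
      calc 2 * π * (j * |y - k|) ≤ 2 * π * (J * (1 / (8 * J))) := by gcongr
        _ = π / 4 := by field_simp; norm_num
    apply Real.cos_le_cos_of_nonneg_of_le_pi (abs_nonneg _) (by linarith [pi_pos]) h2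
  have h2 : J * (√2 / 2) ≤ ‖∑ j ∈ Finset.range J, e (j * y)‖ := by
    refine le_trans ?_ (Complex.re_le_norm _)
    rw [Complex.re_sum]
    have := Finset.sum_le_sum h1
    simpa using this
  unfold fej
  have h3 : (J * (√2 / 2)) ^ 2 ≤ ‖∑ j ∈ Finset.range J, e (j * y)‖ ^ 2 := by gcongr
  calc (J : ℝ) / 2 = 1 / (J:ℝ) * (J * (√2 / 2)) ^ 2 := by
        rw [mul_pow, div_pow, Real.sq_sqrt (by norm_num)]; field_simp
    _ ≤ _ := by gcongr

lemma fej_expand (J : ℕ) (hJ : 1 ≤ J) (y : ℝ) :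
    ((fej J y - 1 : ℝ) : ℂ) = (1 / (J : ℂ)) * ∑ j ∈ Finset.range J,
      ∑ j' ∈ (Finset.range J).erase j, e (((j : ℤ) - j' : ℤ) * y) := by
  have hJ0 : (J:ℂ) ≠ 0 := by
    have : J ≠ 0 := by omega
    exact_mod_cast this
  have h1 : ((‖∑ j ∈ Finset.range J, e (j * y)‖ ^ 2 : ℝ) : ℂ) =
      ∑ j ∈ Finset.range J, ∑ j' ∈ Finset.range J, e (((j : ℤ) - j' : ℤ) * y) := by
    push_cast
    rw [← Complex.mul_conj', map_sum, Finset.sum_mul_sum]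
    refine Finset.sum_congr rfl fun j _ => Finset.sum_congr rfl fun j' _ => ?_
    rw [e_conj, ← e_add]; congr 1; ring
  unfold fej
  push_cast at h1 ⊢
  rw [h1]
  have h2 : ∀ j ∈ Finset.range J, ∑ j' ∈ Finset.range J, e (((j : ℝ) - j') * y) =
      1 + ∑ j' ∈ (Finset.range J).erase j, e (((j : ℝ) - j') * y) := by
    intro j hj
    rw [← Finset.add_sum_erase _ _ hj]; simp [e_zero]
  rw [Finset.sum_congr rfl h2, Finset.sum_add_distrib]
  simp only [Finset.sum_const, Finset.card_range, nsmul_eq_mul]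
  rw [mul_add, mul_one, one_div, inv_mul_cancel₀ hJ0, add_sub_cancel_left]

end fejer

section majorant
variable {φ φ1 φ2 : ℝ → ℝ} {γ X0 : ℝ}

/-- the majorant -/
noncomputable def wmaj (φ : ℝ → ℝ) (m b H : ℕ) (I : Finset ℕ) (J : ℕ → ℕ) (n : ℕ) : ℝ :=
  if n / H ∈ I then fej (J (n / H)) (φ ((m * n + b : ℕ) : ℝ)) else 1

lemma wmaj_nonneg (m b H : ℕ) (I : Finset ℕ) (J : ℕ → ℕ) (n : ℕ) : 0 ≤ wmaj φ m b H I J n := by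
  unfold wmaj; split_ifs
  · exact fej_nonneg _ _
  · norm_num

lemma block_fej (m b H n0 J : ℕ) (hJ : 1 ≤ J) (t : ℝ) :
    ‖∑ u ∈ Finset.range H, ((fej J (φ ((m * (n0 + u) + b : ℕ) : ℝ)) - 1 : ℝ) : ℂ) *
      e (((n0 + u : ℕ) : ℝ) * t)‖ ≤
    ∑ l ∈ (Finset.Ioo (-(J:ℤ)) J).erase 0, ‖blockSum φ m b H n0 l t‖ := by
  have hJ0 : (0:ℝ) < J := by exact_mod_cast hJ
  have h1 : ∑ u ∈ Finset.range H, ((fej J (φ ((m * (n0 + u) + b : ℕ) : ℝ)) - 1 : ℝ) : ℂ) *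
      e (((n0 + u : ℕ) : ℝ) * t) = (1 / (J : ℂ)) * ∑ j ∈ Finset.range J,
      ∑ j' ∈ (Finset.range J).erase j, blockSum φ m b H n0 ((j:ℤ) - j') t := by
    unfold blockSum
    simp_rw [fej_expand J hJ, mul_assoc]
    rw [← Finset.mul_sum]
    congr 1
    simp_rw [Finset.sum_mul]
    rw [Finset.sum_comm]
    refine Finset.sum_congr rfl fun j _ => ?_
    rw [Finset.sum_comm]
    refine Finset.sum_congr rfl fun j' _ => Finset.sum_congr rfl fun u _ => ?_
    rw [← e_add]
  rw [h1, norm_mul]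
  have h2 : ∀ j ∈ Finset.range J, ‖∑ j' ∈ (Finset.range J).erase j, blockSum φ m b H n0 ((j:ℤ) - j') t‖ ≤
      ∑ l ∈ (Finset.Ioo (-(J:ℤ)) J).erase 0, ‖blockSum φ m b H n0 l t‖ := by
    intro j hj
    refine (norm_sum_le _ _).trans ?_
    have hinj : Set.InjOn (fun j' : ℕ => (j:ℤ) - j') ((Finset.range J).erase j : Finset ℕ) := by
      intro a _ b _ hab
      simp only at hab; omega
    rw [← Finset.sum_image (f := fun l => ‖blockSum φ m b H n0 l t‖) hinj]
    apply Finset.sum_le_sum_of_subset_of_nonneg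
    · intro l hl
      simp only [Finset.mem_image, Finset.mem_erase, Finset.mem_range, Finset.mem_Ioo] at hl hj ⊢
      obtain ⟨a, ha, rfl⟩ := hl
      omega
    · intros; positivity
  have h3 := (norm_sum_le _ _).trans (Finset.sum_le_sum h2)
  simp only [Finset.sum_const, Finset.card_range, nsmul_eq_mul] at h3
  rw [norm_div, norm_one, Complex.norm_natCast]
  calc _ ≤ 1 / (J:ℝ) * (J * ∑ l ∈ (Finset.Ioo (-(J:ℤ)) J).erase 0, ‖blockSum φ m b H n0 l t‖) := by
        gcongr
    _ = _ := by field_simp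

lemma sum_blocks (H N : ℕ) (hH : 1 ≤ H) (I : Finset ℕ) (hI : ∀ i ∈ I, (i + 1) * H ≤ N)
    (f : ℕ → ℂ) (hf : ∀ n, n / H ∉ I → f n = 0) :
    ∑ n ∈ Finset.range N, f n = ∑ i ∈ I, ∑ u ∈ Finset.range H, f (i * H + u) := by
  rw [← Finset.sum_product']
  symm
  have h0 : ∑ n ∈ Finset.range N, f n = ∑ n ∈ (Finset.range N).filter (fun n => n / H ∈ I), f n := by
    rw [Finset.sum_filter]
    refine Finset.sum_congr rfl fun n _ => ?_
    split_ifs with h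
    · rfl
    · exact hf n h
  rw [h0]
  have hdiv : ∀ i u, u < H → (i * H + u) / H = i := by
    intro i u hu
    rw [mul_comm, Nat.mul_add_div (by omega), Nat.div_eq_of_lt hu, add_zero]
  refine Finset.sum_nbij' (fun p => p.1 * H + p.2) (fun n => (n / H, n % H)) ?_ ?_ ?_ ?_ ?_
  · rintro ⟨i, u⟩ h
    simp only [Finset.mem_product, Finset.mem_range, Finset.mem_filter] at h ⊢
    rw [hdiv i u h.2]
    refine ⟨?_, h.1⟩
    have := hI i h.1
    nlinarith
  · intro n hn
    simp only [Finset.mem_product, Finset.mem_range, Finset.mem_filter] at hn ⊢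
    exact ⟨hn.2, Nat.mod_lt _ (by omega)⟩
  · rintro ⟨i, u⟩ h
    simp only [Finset.mem_product, Finset.mem_range] at h ⊢
    rw [hdiv i u h.2, Nat.mul_add_mod', Nat.mod_eq_of_lt h.2]
  · intro n _
    simp only
    exact Nat.div_add_mod' n H
  · intros; rfl

lemma wmaj_fourier (h : PhiOK φ φ1 φ2 γ X0) (m b H N Jm : ℕ) (hm : 1 ≤ m) (hH : 1 ≤ H) (I : Finset ℕ)
    (J : ℕ → ℕ) (t κ s Z : ℝ) (hκ : 0 < κ) (hs : 0 < s) (hZ : 0 < Z)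
    (hI : ∀ i ∈ I, X0 ≤ ((m * (i * H) + b : ℕ) : ℝ) ∧ Z ≤ ((m * (i * H) + b : ℕ) : ℝ) ∧
      (i + 1) * H ≤ N)
    (hJ : ∀ i, J i = max 1 ⌊1 / (8 * φ1 ((m * (i * H) + b : ℕ) : ℝ))⌋₊)
    (hJm : ∀ i ∈ I, J i ≤ Jm)
    (hlow : ∀ x : ℝ, X0 ≤ x → x ≤ m * N + b → s ≤ - φ2 x) :
    ‖∑ n ∈ Finset.range N, ((wmaj φ m b H I J n - 1 : ℝ) : ℂ) * e (n * t)‖ ≤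
      2 * Jm * (((N : ℝ) / H) * (6 * (H : ℝ) ^ 3 * m ^ 2 / Z + 1 / (2 * κ)) +
      H * ((2 * κ / (H * s) + 1) * (m + 2))) := by
  set Bd := (((N : ℝ) / H) * (6 * (H : ℝ) ^ 3 * m ^ 2 / Z + 1 / (2 * κ)) +
      H * ((2 * κ / (H * s) + 1) * (m + 2))) with hBd
  have hBd0 : 0 ≤ Bd := by positivity
  rw [sum_blocks H N hH I (fun i hi => (hI i hi).2.2) _ (by
    intro n hn; simp [wmaj, hn])]
  have hdiv : ∀ i u, u < H → (i * H + u) / H = i := by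
    intro i u hu
    rw [mul_comm, Nat.mul_add_div (by omega), Nat.div_eq_of_lt hu, add_zero]
  have h1 : ∀ i ∈ I, ‖∑ u ∈ Finset.range H, ((wmaj φ m b H I J (i * H + u) - 1 : ℝ) : ℂ) *
      e (((i * H + u : ℕ) : ℝ) * t)‖ ≤ ∑ l ∈ (Finset.Ioo (-(Jm:ℤ)) Jm).erase 0,
        if |l| < J i then ‖blockSum φ m b H (i * H) l t‖ else 0 := by
    intro i hi
    have h2 : ∑ u ∈ Finset.range H, ((wmaj φ m b H I J (i * H + u) - 1 : ℝ) : ℂ) *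
      e (((i * H + u : ℕ) : ℝ) * t) = ∑ u ∈ Finset.range H,
        ((fej (J i) (φ ((m * (i * H + u) + b : ℕ) : ℝ)) - 1 : ℝ) : ℂ) *
      e (((i * H + u : ℕ) : ℝ) * t) := by
      refine Finset.sum_congr rfl fun u hu => ?_
      rw [Finset.mem_range] at hu
      rw [wmaj, hdiv i u hu, if_pos hi]
    rw [h2]
    refine (block_fej m b H (i * H) (J i) (by rw [hJ]; exact le_max_left _ _) t).trans ?_
    rw [← Finset.sum_filter]
    apply Finset.sum_le_sum_of_subset_of_nonneg
    · intro l hl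
      have := hJm i hi
      simp only [Finset.mem_erase, Finset.mem_filter, Finset.mem_Ioo] at hl ⊢
      refine ⟨⟨hl.1, by omega, by omega⟩, ?_⟩
      rw [abs_lt]; exact hl.2
    · intros; positivity
  refine (norm_sum_le _ _).trans ((Finset.sum_le_sum h1).trans ?_)
  rw [Finset.sum_comm]
  have h3 : ∀ l ∈ (Finset.Ioo (-(Jm:ℤ)) Jm).erase 0,
      (∑ i ∈ I, if |l| < J i then ‖blockSum φ m b H (i * H) l t‖ else 0) ≤ Bd := by
    intro l hl
    have hl0 : l ≠ 0 := (Finset.mem_erase.1 hl).1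
    rw [← Finset.sum_filter]
    apply blocks_l h m b H N hm hH _ l hl0 t κ s Z hκ hs hZ _ hlow
    intro i hi
    rw [Finset.mem_filter] at hi
    obtain ⟨a1, a2, a3⟩ := hI i hi.1
    refine ⟨a1, a2, a3, ?_⟩
    have hp := h.pos _ a1
    have hlt := hi.2
    have h1l : 1 ≤ |l| := Int.one_le_abs hl0
    have hJi := hJ i
    have hle : |l| ≤ (⌊1 / (8 * φ1 ((m * (i * H) + b : ℕ) : ℝ))⌋₊ : ℤ) := by
      rcases le_total 1 ⌊1 / (8 * φ1 ((m * (i * H) + b : ℕ) : ℝ))⌋₊ with hh | hh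
      · rw [max_eq_right hh] at hJi; omega
      · rw [max_eq_left hh] at hJi; omega
    have hle' : |(l:ℝ)| ≤ (⌊1 / (8 * φ1 ((m * (i * H) + b : ℕ) : ℝ))⌋₊ : ℝ) := by
      exact_mod_cast hle
    have hfl := Nat.floor_le (by positivity : 0 ≤ 1 / (8 * φ1 ((m * (i * H) + b : ℕ) : ℝ)))
    have := hle'.trans hfl
    rw [le_div_iff₀ (by positivity)] at this
    linarith
  refine (Finset.sum_le_sum h3).trans ?_
  rw [Finset.sum_const, nsmul_eq_mul]
  have hc : (((Finset.Ioo (-(Jm:ℤ)) Jm).erase 0).card : ℝ) ≤ 2 * Jm := by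
    have : ((Finset.Ioo (-(Jm:ℤ)) Jm).erase 0).card ≤ 2 * Jm := by
      refine Finset.card_erase_le.trans ?_
      rw [Int.card_Ioo]; omega
    exact_mod_cast this
  gcongr

/-- lower bound for the majorant on the support -/
lemma wmaj_lower (h : PhiOK φ φ1 φ2 γ X0) (m b H : ℕ) (hH : 1 ≤ H) (I : Finset ℕ)
    (J : ℕ → ℕ) (hI : ∀ i ∈ I, X0 ≤ ((m * (i * H) + b : ℕ) : ℝ) ∧
      14 * ((m:ℝ) * H) ≤ ((m * (i * H) + b : ℕ) : ℝ))
    (hJ : ∀ i, J i = max 1 ⌊1 / (8 * φ1 ((m * (i * H) + b : ℕ) : ℝ))⌋₊)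
    (n : ℕ) (hn : n / H ∈ I) (k : ℕ) (hk : |φ ((m * n + b : ℕ) : ℝ) - k| ≤ φ1 ((m * n + b : ℕ) : ℝ)) :
    1 / φ1 ((m * n + b : ℕ) : ℝ) ≤ 64 * wmaj φ m b H I J n := by
  obtain ⟨a1, a2⟩ := hI _ hn
  rw [wmaj, if_pos hn]
  set i := n / H with hi
  set x := ((m * n + b : ℕ) : ℝ) with hx
  set y := ((m * (i * H) + b : ℕ) : ℝ) with hy
  have hiH : i * H ≤ n := Nat.div_mul_le_self n H
  have hiH2 : n < i * H + H := by
    have := Nat.lt_div_mul_add (a := n) (b := H) (by omega)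
    omega
  have hyx : y ≤ x := by
    have : m * (i * H) + b ≤ m * n + b := by gcongr
    rw [hx, hy]; exact_mod_cast this
  have hxy : x - y ≤ m * H := by
    have : m * n + b ≤ m * (i * H) + b + m * H := by nlinarith
    have h2 : x ≤ y + m * H := by rw [hx, hy]; exact_mod_cast this
    linarith
  have hp := h.pos y a1
  have hpx := h.pos x (a1.trans hyx)
  have hy0 : 0 < y := by linarith [h.X0_ge]
  have hanti : φ1 x ≤ φ1 y := phi1_anti h a1 (a1.trans hyx : X0 ≤ x) hyx
  have hhalf : φ1 y ≤ 2 * φ1 x := by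
    rcases hyx.eq_or_lt with he | hlt
    · rw [he]; linarith
    · obtain ⟨z, hz1, hz2, hz3⟩ := phi1_diff h a1 hlt
      have h1 := phi2_up h a1 hz1.le
      have h2 := phi2_nonpos h (a1.trans hz1.le)
      have h3 : (x - y) * (- φ2 z) ≤ (m * H) * (7 * φ1 y / y) := by
        gcongr; linarith
      have h4 : (m * H : ℝ) * (7 * φ1 y / y) ≤ φ1 y / 2 := by
        rw [mul_div_assoc', div_le_iff₀ hy0]
        nlinarith
      linarith
  have hJi := hJ i
  have hJ1 : 1 ≤ J i := by rw [hJi]; exact le_max_left _ _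
  have hup : 1 / φ1 y ≤ 16 * J i := by
    have hmain : 1 / (8 * φ1 y) ≤ 2 * J i := by
      have hf := Nat.lt_floor_add_one (1 / (8 * φ1 y))
      have h1 : (⌊1 / (8 * φ1 y)⌋₊ : ℝ) ≤ J i := by
        rw [hJi]; exact_mod_cast le_max_right _ _
      have h2 : (1:ℝ) ≤ J i := by exact_mod_cast hJ1
      linarith
    have : 1 / φ1 y = 8 * (1 / (8 * φ1 y)) := by field_simp
    linarith
  have hfej : (J i : ℝ) / 2 ≤ fej (J i) (φ x) := by
    rcases hJ1.eq_or_lt with he | hlt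
    · rw [← he]; simp [fej, e_zero]; norm_num
    · apply fej_lower (J i) hJ1 _ k
      push_cast
      refine hk.trans (hanti.trans ?_)
      have hJe : J i = ⌊1 / (8 * φ1 y)⌋₊ := by
        rcases le_total 1 ⌊1 / (8 * φ1 y)⌋₊ with hh | hh
        · rw [max_eq_right hh] at hJi; exact hJi
        · rw [max_eq_left hh] at hJi; omega
      have h1 : (J i : ℝ) ≤ 1 / (8 * φ1 y) := by
        rw [hJe]; exact Nat.floor_le (by positivity)
      have hJ0 : (0:ℝ) < J i := by exact_mod_cast hJ1
      rw [le_div_iff₀ (by positivity)] at h1 ⊢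
      linarith
  have h1 : 1 / φ1 x ≤ 2 / φ1 y := by
    rw [div_le_div_iff₀ hpx hp]; linarith
  have h2 : 2 / φ1 y = 2 * (1 / φ1 y) := by ring
  linarith

end majorant
end DMP


namespace DMP

lemma ev_const (K ε : ℝ) (hε : 0 < ε) : ∀ᶠ N : ℕ in atTop, K ≤ (N:ℝ) ^ ε :=
  ((tendsto_rpow_atTop hε).comp tendsto_natCast_atTop_atTop).eventually_ge_atTop K

lemma ev_log (ε : ℝ) (hε : 0 < ε) : ∀ᶠ N : ℕ in atTop, Real.log N ≤ (N:ℝ) ^ ε := by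
  have h := (isLittleO_log_rpow_atTop hε).bound (c := 1) one_pos
  have h2 := tendsto_natCast_atTop_atTop (R := ℝ) |>.eventually h
  filter_upwards [h2] with N hN
  rw [one_mul, Real.norm_eq_abs, Real.norm_eq_abs, abs_of_nonneg (by positivity : 0 ≤ (N:ℝ) ^ ε)] at hN
  exact (le_abs_self _).trans hN

variable {φ φ1 φ2 : ℝ → ℝ} {γ X0 : ℝ}

lemma aux_sq {x : ℝ} (hx : 1 ≤ x) : x + 2 ≤ 3 * x ^ 2 := by nlinarith

set_option maxHeartbeats 1600000 in
lemma exists_maj (h : PhiOK φ φ1 φ2 γ X0) (hγ : 15 / 16 < γ) :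
    ∀ᶠ N : ℕ in atTop, ∀ m b : ℕ, 1 ≤ m → (m:ℝ) ≤ Real.log N → b ≤ m - 1 →
    ∃ w : ℕ → ℝ, (∀ n, 0 ≤ w n) ∧
      (∀ n : ℕ, (N:ℝ) ^ (9/10 : ℝ) ≤ n → n ≤ N / 2 → ∀ k : ℕ,
        |φ ((m * n + b : ℕ) : ℝ) - k| ≤ φ1 ((m * n + b : ℕ) : ℝ) →
        1 / φ1 ((m * n + b : ℕ) : ℝ) ≤ 64 * w n) ∧
      ∀ t : ℝ, ‖∑ n ∈ Finset.range N, ((w n - 1 : ℝ) : ℂ) * e (n * t)‖ ≤ (N:ℝ) ^ (92/100 : ℝ) := by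
  obtain ⟨c1, hc1, hlow1⟩ := h.low (1/2000) (by norm_num)
  obtain ⟨c2, hc2, hlow2⟩ := h.low2 (1/2000) (by norm_num)
  have hX1 := h.X0_ge
  filter_upwards [ev_log (1/1000) (by norm_num), ev_const 100 (1/1000) (by norm_num),
    ev_const (1 / c1) (1/10000) (by norm_num), ev_const (1 / (c1 * c2)) (1/10000) (by norm_num),
    ev_const (2 * X0) (9/10) (by norm_num), ev_const 28 (1/2) (by norm_num), eventually_ge_atTop 2]
    with N hlog h100 hC1 hC2 hX0 h28 hN2 m b hm hmlog hb
  have hN1 : (1:ℝ) ≤ N := by exact_mod_cast (by omega : 1 ≤ N)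
  have hN0 : (0:ℝ) < N := by linarith
  have hm1 : (1:ℝ) ≤ m := by exact_mod_cast hm
  have hmN : (m:ℝ) ≤ (N:ℝ) ^ (1/1000 : ℝ) := hmlog.trans hlog
  have hbm : (b:ℝ) ≤ m := by exact_mod_cast (by omega : b ≤ m)
  have radd : ∀ a b : ℝ, (N:ℝ) ^ a * (N:ℝ) ^ b = (N:ℝ) ^ (a + b) := fun a b => (rpow_add hN0 a b).symm
  have rmono : ∀ {a b : ℝ}, a ≤ b → (N:ℝ) ^ a ≤ (N:ℝ) ^ b := fun hab => rpow_le_rpow_of_exponent_le hN1 hab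
  have rneg : ∀ a : ℝ, (N:ℝ) ^ (-a) = ((N:ℝ) ^ a)⁻¹ := fun a => rpow_neg hN0.le a
  have rpos : ∀ a : ℝ, 0 < (N:ℝ) ^ a := fun a => rpow_pos_of_pos hN0 a
  -- the range of x
  have hxmax : (m:ℝ) * N + b ≤ (N:ℝ) ^ (1002/1000 : ℝ) := by
    have e1 : (m:ℝ) * N + b ≤ 2 * (m * N) := by nlinarith
    calc (m:ℝ) * N + b ≤ 2 * (m * N) := e1
      _ ≤ (N:ℝ) ^ (1/1000 : ℝ) * ((N:ℝ) ^ (1/1000 : ℝ) * (N:ℝ) ^ (1:ℝ)) := by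
          rw [rpow_one]; gcongr; linarith
      _ = _ := by rw [radd, radd]; norm_num
  have hxpow : ∀ x : ℝ, X0 ≤ x → x ≤ m * N + b → ∀ a : ℝ, 0 ≤ a →
      (N:ℝ) ^ (-(1002/1000 * a)) ≤ x ^ (-a) := by
    intro x hx hx2 a ha
    have := rpow_le_rpow_of_nonpos (by linarith : 0 < x) (hx2.trans hxmax) (by linarith : -a ≤ 0)
    refine le_trans (le_of_eq ?_) this
    rw [← rpow_mul hN0.le]; congr 1; ring
  have hphi1 : ∀ x : ℝ, X0 ≤ x → x ≤ m * N + b → (N:ℝ) ^ (-(64/1000) : ℝ) ≤ φ1 x := by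
    intro x hx hx2
    have e1 := hlow1 x hx
    have e2 : x ^ (-(63/1000) : ℝ) ≤ x ^ (γ - 1 - 1/2000) :=
      rpow_le_rpow_of_exponent_le (by linarith) (by linarith)
    have e3 := hxpow x hx hx2 (63/1000) (by norm_num)
    have e4 : (N:ℝ) ^ (-(1/10000) : ℝ) ≤ c1 := by
      rw [rneg]
      exact inv_le_of_inv_le₀ hc1 (by rw [← one_div]; exact hC1)
    calc (N:ℝ) ^ (-(64/1000) : ℝ) ≤ (N:ℝ) ^ (-(1/10000) : ℝ) * (N:ℝ) ^ (-(1002/1000 * (63/1000)) : ℝ) := by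
          rw [radd]; apply rmono; norm_num
      _ ≤ c1 * x ^ (γ - 1 - 1/2000) := by
          apply mul_le_mul e4 (e3.trans e2) (rpos _).le hc1.le
      _ ≤ _ := e1
  have hphi2 : ∀ x : ℝ, X0 ≤ x → x ≤ m * N + b → (N:ℝ) ^ (-(107/100) : ℝ) ≤ - φ2 x := by
    intro x hx hx2
    have hx0 : 0 < x := by linarith
    have e1 := hlow1 x hx
    have e2 : x ^ (-(63/1000) : ℝ) ≤ x ^ (γ - 1 - 1/2000) :=
      rpow_le_rpow_of_exponent_le (by linarith) (by linarith)
    have e3 := hxpow x hx hx2 (10635/10000) (by norm_num)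
    have e4 : (N:ℝ) ^ (-(1/10000) : ℝ) ≤ c1 * c2 := by
      rw [rneg]
      exact inv_le_of_inv_le₀ (by positivity) (by rw [← one_div]; exact hC2)
    have e5 : x ^ (-(10635/10000) : ℝ) = x ^ (-(1/2000) : ℝ) * x ^ (-(63/1000) : ℝ) / x := by
      rw [← rpow_add hx0, ← rpow_sub_one hx0.ne']; norm_num
    calc (N:ℝ) ^ (-(107/100) : ℝ)
        ≤ (N:ℝ) ^ (-(1/10000) : ℝ) * (N:ℝ) ^ (-(1002/1000 * (10635/10000)) : ℝ) := by
          rw [radd]; apply rmono; norm_num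
      _ ≤ (c1 * c2) * x ^ (-(10635/10000) : ℝ) := by
          apply mul_le_mul e4 e3 (rpos _).le (by positivity)
      _ = c2 * x ^ (-(1/2000) : ℝ) * (c1 * x ^ (-(63/1000) : ℝ)) / x := by rw [e5]; ring
      _ ≤ c2 * x ^ (-(1/2000) : ℝ) * φ1 x / x := by
          have : c1 * x ^ (-(63/1000) : ℝ) ≤ φ1 x := le_trans (by gcongr) e1
          gcongr
      _ ≤ _ := hlow2 x hx
  -- parameters
  set Hr : ℝ := (N:ℝ) ^ (3/8 : ℝ) with hHr
  set H : ℕ := ⌊Hr⌋₊ with hH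
  have hHr1 : 1 ≤ Hr := one_le_rpow hN1 (by norm_num)
  have hH1 : 1 ≤ H := Nat.one_le_floor_iff _ |>.2 hHr1
  have hHle : (H:ℝ) ≤ Hr := Nat.floor_le (by linarith)
  have hHge : Hr / 2 ≤ H := by
    have := Nat.lt_floor_add_one Hr
    have h1 : (1:ℝ) ≤ H := by exact_mod_cast hH1
    rw [← hH] at this
    linarith
  have hHr28 : 28 * Hr ≤ (N:ℝ) ^ (9/10 : ℝ) := by
    calc 28 * Hr ≤ (N:ℝ) ^ (1/2 : ℝ) * (N:ℝ) ^ (3/8 : ℝ) := by rw [hHr]; gcongr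
      _ ≤ _ := by rw [radd]; apply rmono; norm_num
  have hHrN : 28 * Hr ≤ N := by
    refine hHr28.trans ?_
    have := rmono (by norm_num : (9/10:ℝ) ≤ 1)
    rwa [rpow_one] at this
  set I : Finset ℕ := (Finset.range N).filter (fun i => (N:ℝ) ^ (9/10:ℝ) / 2 ≤ ((i * H : ℕ) : ℝ) ∧
    (i + 1) * H ≤ N) with hIdef
  set J : ℕ → ℕ := fun i => max 1 ⌊1 / (8 * φ1 ((m * (i * H) + b : ℕ) : ℝ))⌋₊ with hJ
  have hIx : ∀ i ∈ I, (N:ℝ) ^ (9/10:ℝ) / 2 * m ≤ ((m * (i * H) + b : ℕ) : ℝ) := by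
    intro i hi
    have := (Finset.mem_filter.1 hi).2.1
    have e1 : ((m * (i * H) + b : ℕ) : ℝ) = m * ((i * H : ℕ) : ℝ) + b := by push_cast; ring
    rw [e1]
    have : (N:ℝ) ^ (9/10:ℝ) / 2 * m ≤ ((i * H : ℕ) : ℝ) * m := by gcongr
    have hb0 : (0:ℝ) ≤ b := by positivity
    linarith
  have hIx2 : ∀ i ∈ I, (N:ℝ) ^ (9/10:ℝ) / 2 ≤ ((m * (i * H) + b : ℕ) : ℝ) := by
    intro i hi
    refine le_trans ?_ (hIx i hi)
    have := rpos (9/10)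
    nlinarith
  have hIX : ∀ i ∈ I, X0 ≤ ((m * (i * H) + b : ℕ) : ℝ) := by
    intro i hi
    refine le_trans ?_ (hIx2 i hi); linarith
  have hIle : ∀ i ∈ I, ((m * (i * H) + b : ℕ) : ℝ) ≤ m * N + b := by
    intro i hi
    have h1 := (Finset.mem_filter.1 hi).2.2
    have h2 : m * (i * H) + b ≤ m * N + b := by
      have : i * H ≤ N := by nlinarith
      gcongr
    exact_mod_cast h2
  set Jm : ℕ := ⌊(N:ℝ) ^ (64/1000 : ℝ)⌋₊ with hJm
  have hJmle : ∀ i ∈ I, J i ≤ Jm := by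
    intro i hi
    have h1 := hphi1 _ (hIX i hi) (hIle i hi)
    apply max_le
    · exact Nat.one_le_floor_iff _ |>.2 (one_le_rpow hN1 (by norm_num))
    · apply Nat.floor_le_floor
      rw [rneg] at h1
      have hp := rpos (64/1000)
      have hp' := h.pos _ (hIX i hi)
      rw [inv_le_iff_one_le_mul₀ hp] at h1
      rw [div_le_iff₀ (by positivity)]
      nlinarith
  refine ⟨wmaj φ m b H I J, wmaj_nonneg m b H I J, ?_, ?_⟩
  · intro n hn1 hn2 k hk
    apply wmaj_lower h m b H hH1 I J _ (fun _ => rfl) n _ k hk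
    · intro i hi
      refine ⟨hIX i hi, ?_⟩
      have h1 := hIx i hi
      have h2 : 14 * ((m:ℝ) * H) ≤ (N:ℝ) ^ (9/10:ℝ) / 2 * m := by nlinarith
      linarith
    · have h1 : n / H * H ≤ n := Nat.div_mul_le_self n H
      have h2 : n < n / H * H + H := by
        have := Nat.lt_div_mul_add (a := n) (b := H) (by omega)
        omega
      have h3 : (n:ℝ) < ((n / H * H : ℕ) : ℝ) + H := by exact_mod_cast h2
      have h4 : H ≤ N / 2 := by
        rw [Nat.le_div_iff_mul_le (by norm_num)]
        have : (H:ℝ) * 2 ≤ N := by linarith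
        exact_mod_cast this
      rw [hIdef, Finset.mem_filter, Finset.mem_range]
      refine ⟨?_, by linarith, ?_⟩
      · have := Nat.div_le_self n H
        omega
      · rw [add_mul, one_mul]; omega
  · intro t
    have hmain := wmaj_fourier h m b H N Jm hm hH1 I J t ((N:ℝ) ^ (-(22/100) : ℝ)) ((N:ℝ) ^ (-(107/100) : ℝ))
      ((N:ℝ) ^ (9/10:ℝ) / 2) (rpos _) (rpos _) (by have := rpos (9/10); positivity)
      (fun i hi => ⟨hIX i hi, hIx2 i hi, (Finset.mem_filter.1 hi).2.2⟩) (fun _ => rfl) hJmle hphi2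
    refine hmain.trans ?_
    have hHp : (0:ℝ) < H := by linarith
    have hJmr : (Jm:ℝ) ≤ (N:ℝ) ^ (64/1000 : ℝ) := Nat.floor_le (rpos _).le
    have hm2 : (m:ℝ) ^ 2 ≤ (N:ℝ) ^ (2/1000 : ℝ) := by
      calc (m:ℝ)^2 ≤ ((N:ℝ) ^ (1/1000 : ℝ)) ^ 2 := by gcongr
        _ = _ := by rw [sq, radd]; norm_num
    have t1 : (N:ℝ) / H * (6 * (H:ℝ) ^ 3 * m ^ 2 / ((N:ℝ) ^ (9/10:ℝ) / 2)) ≤ 12 * m ^ 2 * (N:ℝ) ^ (85/100 : ℝ) := by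
      have : (N:ℝ) / H * (6 * (H:ℝ) ^ 3 * m ^ 2 / ((N:ℝ) ^ (9/10:ℝ) / 2)) =
          12 * m ^ 2 * ((N:ℝ) ^ (1:ℝ) * (H:ℝ) ^ 2 * (N:ℝ) ^ (-(9/10) : ℝ)) := by
        rw [rneg, rpow_one]; have := (rpos (9/10)).ne'; field_simp; norm_num
      rw [this]
      have h2 : (N:ℝ) ^ (1:ℝ) * (H:ℝ) ^ 2 * (N:ℝ) ^ (-(9/10) : ℝ) ≤
          (N:ℝ) ^ (1:ℝ) * Hr ^ 2 * (N:ℝ) ^ (-(9/10) : ℝ) := by gcongr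
      have h3 : (N:ℝ) ^ (1:ℝ) * Hr ^ 2 * (N:ℝ) ^ (-(9/10) : ℝ) = (N:ℝ) ^ (85/100 : ℝ) := by
        rw [hHr, sq, radd, radd, radd]; norm_num
      rw [h3] at h2
      gcongr
    have t2 : (N:ℝ) / H * (1 / (2 * (N:ℝ) ^ (-(22/100) : ℝ))) ≤ (N:ℝ) ^ (85/100 : ℝ) := by
      have h1 : (N:ℝ) / H ≤ 2 * (N:ℝ) ^ (5/8 : ℝ) := by
        rw [div_le_iff₀ hHp]
        calc (N:ℝ) = (N:ℝ) ^ (5/8 : ℝ) * Hr := by rw [hHr, radd]; norm_num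
          _ = 2 * (N:ℝ) ^ (5/8 : ℝ) * (Hr / 2) := by ring
          _ ≤ _ := by gcongr
      have h2 : 1 / (2 * (N:ℝ) ^ (-(22/100) : ℝ)) = (N:ℝ) ^ (22/100 : ℝ) / 2 := by
        rw [rneg]; field_simp
      rw [h2]
      calc _ ≤ 2 * (N:ℝ) ^ (5/8 : ℝ) * ((N:ℝ) ^ (22/100 : ℝ) / 2) := by
            gcongr
        _ = (N:ℝ) ^ (5/8 : ℝ) * (N:ℝ) ^ (22/100 : ℝ) := by ring
        _ ≤ _ := by rw [radd]; apply rmono; norm_num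
    have t3 : (H:ℝ) * ((2 * (N:ℝ) ^ (-(22/100) : ℝ) / (H * (N:ℝ) ^ (-(107/100) : ℝ)) + 1) * (m + 2)) ≤
        9 * m ^ 2 * (N:ℝ) ^ (85/100 : ℝ) := by
      have h1 : (H:ℝ) * ((2 * (N:ℝ) ^ (-(22/100) : ℝ) / (H * (N:ℝ) ^ (-(107/100) : ℝ)) + 1) * (m + 2)) =
          (2 * ((N:ℝ) ^ (-(22/100) : ℝ) * (N:ℝ) ^ (107/100 : ℝ)) + H) * (m + 2) := by
        rw [rneg (107/100)]; have := (rpos (107/100)).ne'; field_simp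
      rw [h1, radd]
      have h2 : (H:ℝ) ≤ (N:ℝ) ^ (85/100 : ℝ) := hHle.trans (rmono (by norm_num))
      have h3 : (-(22/100) : ℝ) + 107/100 = 85/100 := by norm_num
      rw [h3]
      have h4 : (m:ℝ) + 2 ≤ 3 * m ^ 2 := aux_sq hm1
      calc _ ≤ (2 * (N:ℝ) ^ (85/100 : ℝ) + (N:ℝ) ^ (85/100 : ℝ)) * (3 * m ^ 2) := by gcongr
        _ = _ := by ring
    have t4 : (N:ℝ) ^ (85/100 : ℝ) ≤ m ^ 2 * (N:ℝ) ^ (85/100 : ℝ) :=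
      le_mul_of_one_le_left (rpos _).le (one_le_pow₀ hm1)
    calc 2 * (Jm:ℝ) * _ ≤ 2 * (N:ℝ) ^ (64/1000 : ℝ) * (22 * (m ^ 2 * (N:ℝ) ^ (85/100 : ℝ))) := by
          gcongr
          rw [mul_add]; linarith
      _ ≤ 2 * (N:ℝ) ^ (64/1000 : ℝ) * (22 * ((N:ℝ) ^ (2/1000 : ℝ) * (N:ℝ) ^ (85/100 : ℝ))) := by gcongr
      _ = 44 * ((N:ℝ) ^ (64/1000 : ℝ) * ((N:ℝ) ^ (2/1000 : ℝ) * (N:ℝ) ^ (85/100 : ℝ))) := by ring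
      _ ≤ (N:ℝ) ^ (1/1000 : ℝ) * ((N:ℝ) ^ (64/1000 : ℝ) * ((N:ℝ) ^ (2/1000 : ℝ) * (N:ℝ) ^ (85/100 : ℝ))) := by
          gcongr; linarith
      _ ≤ _ := by rw [radd, radd, radd]; apply rmono; norm_num

end DMP


namespace DMP

section sieve
variable {T : ℕ} [NeZero T] {Q : ℕ}

/-- coefficients of the Ramanujan type expansion -/
noncomputable def gT (T Q : ℕ) (k : ZMod T) : ℝ :=
  if addOrderOf k ≤ Q then (ArithmeticFunction.moebius (addOrderOf k) : ℝ) / Nat.totient (addOrderOf k)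
  else 0

noncomputable def LT (T Q : ℕ) : ℝ := ∑ q ∈ T.divisors.filter (· ≤ Q), 1 / (Nat.totient q : ℝ)

lemma ord_dvd (k : ZMod T) : addOrderOf k ∣ T := by
  apply addOrderOf_dvd_of_nsmul_eq_zero
  simp

lemma ord_pos (k : ZMod T) : 0 < addOrderOf k := Nat.pos_of_dvd_of_pos (ord_dvd k) (NeZero.pos T)

lemma sum_by_order {M : Type*} [AddCommMonoid M] (f : ZMod T → M) :
    ∑ k : ZMod T, f k = ∑ q ∈ T.divisors, ∑ k ∈ Finset.univ.filter (fun k : ZMod T => addOrderOf k = q), f k := by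
  rw [Finset.sum_fiberwise_of_maps_to]
  intro k _
  exact Nat.mem_divisors.2 ⟨ord_dvd k, NeZero.ne T⟩

lemma card_order {q : ℕ} (hq : q ∣ T) :
    (Finset.univ.filter (fun k : ZMod T => addOrderOf k = q)).card = Nat.totient q := by
  apply IsAddCyclic.card_addOrderOf_eq_totient
  rw [ZMod.card]; exact hq

lemma sum_order_fun (f : ℕ → ℝ) :
    ∑ k : ZMod T, f (addOrderOf k) = ∑ q ∈ T.divisors, Nat.totient q * f q := by
  rw [sum_by_order]
  refine Finset.sum_congr rfl fun q hq => ?_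
  have h1 : ∀ k ∈ Finset.univ.filter (fun k : ZMod T => addOrderOf k = q), f (addOrderOf k) = f q := by
    intro k hk; rw [(Finset.mem_filter.1 hk).2]
  rw [Finset.sum_congr rfl h1, Finset.sum_const, card_order (Nat.dvd_of_mem_divisors hq), nsmul_eq_mul]

lemma tot_pos {q : ℕ} (hq : q ∣ T) : (0:ℝ) < Nat.totient q := by
  have : 0 < q := Nat.pos_of_dvd_of_pos hq (NeZero.pos T)
  exact_mod_cast Nat.totient_pos.2 this

lemma sum_g_sq (hT : Squarefree T) : ∑ k : ZMod T, gT T Q k ^ 2 = LT T Q := by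
  have := sum_order_fun (T := T) (fun q => (if q ≤ Q then (ArithmeticFunction.moebius q : ℝ) / Nat.totient q
    else 0) ^ 2)
  unfold gT
  rw [this, LT, Finset.sum_filter]
  refine Finset.sum_congr rfl fun q hq => ?_
  have hq' := Nat.dvd_of_mem_divisors hq
  have hp := tot_pos hq'
  split_ifs with h
  · have h1 := ArithmeticFunction.moebius_sq_eq_one_of_squarefree (hT.squarefree_of_dvd hq')
    have h2 : ((ArithmeticFunction.moebius q : ℤ) : ℝ) ^ 2 = 1 := by exact_mod_cast h1
    rw [div_pow, h2]; field_simp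
  · simp

lemma abs_g (hT : Squarefree T) (k : ZMod T) :
    |gT T Q k| = if addOrderOf k ≤ Q then 1 / (Nat.totient (addOrderOf k) : ℝ) else 0 := by
  unfold gT
  split_ifs with h
  · have h1 := ArithmeticFunction.moebius_sq_eq_one_of_squarefree (hT.squarefree_of_dvd (ord_dvd k))
    have h2 : |((ArithmeticFunction.moebius (addOrderOf k) : ℤ) : ℝ)| = 1 := by
      have : ((ArithmeticFunction.moebius (addOrderOf k) : ℤ) : ℝ) ^ 2 = 1 := by exact_mod_cast h1
      rw [sq, mul_self_eq_one_iff] at this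
      exact (abs_eq (by norm_num)).2 this
    rw [abs_div, h2, abs_of_pos (tot_pos (ord_dvd k))]
  · simp

lemma sum_abs_g (hT : Squarefree T) : ∑ k : ZMod T, |gT T Q k| ≤ Q := by
  simp_rw [abs_g hT]
  rw [sum_order_fun (T := T) (fun q => if q ≤ Q then 1 / (Nat.totient q : ℝ) else 0)]
  have h1 : ∀ q ∈ T.divisors, (Nat.totient q : ℝ) * (if q ≤ Q then 1 / (Nat.totient q : ℝ) else 0) =
      if q ≤ Q then 1 else 0 := by
    intro q hq
    have hp := tot_pos (Nat.dvd_of_mem_divisors hq)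
    split_ifs
    · field_simp
    · simp
  rw [Finset.sum_congr rfl h1, ← Finset.sum_filter, Finset.sum_const, nsmul_eq_mul, mul_one]
  have hsub : T.divisors.filter (· ≤ Q) ⊆ Finset.Icc 1 Q := by
    intro q hq
    rw [Finset.mem_filter] at hq
    rw [Finset.mem_Icc]
    exact ⟨Nat.pos_of_mem_divisors hq.1, hq.2⟩
  have := Finset.card_le_card hsub
  rw [Nat.card_Icc] at this
  exact_mod_cast this

lemma LT_ge_one (hQ : 1 ≤ Q) : 1 ≤ LT T Q := by
  unfold LT
  have h1 : 1 ∈ T.divisors.filter (· ≤ Q) := by simp [NeZero.ne T, hQ]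
  have := Finset.single_le_sum (f := fun q : ℕ => 1 / (Nat.totient q : ℝ)) (fun i _ => by positivity) h1
  simpa using this

/-- Ramanujan sums -/
lemma ramanujan (x : ℕ) (hx : Nat.Coprime x T) (q : ℕ) (hq : q ∣ T) :
    ∑ k ∈ Finset.univ.filter (fun k : ZMod T => addOrderOf k = q), ZMod.stdAddChar (k * (x : ZMod T)) =
      (ArithmeticFunction.moebius q : ℂ) := by
  have hT0 := NeZero.pos T
  induction q using Nat.strong_induction_on with
  | _ q ih =>
    have hq0 : 0 < q := Nat.pos_of_dvd_of_pos hq hT0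
    have hsum : ∑ d ∈ q.divisors, ∑ k ∈ Finset.univ.filter (fun k : ZMod T => addOrderOf k = d),
        ZMod.stdAddChar (k * (x : ZMod T)) = if q = 1 then 1 else 0 := by
      have h1 : ∑ d ∈ q.divisors, ∑ k ∈ Finset.univ.filter (fun k : ZMod T => addOrderOf k = d),
        ZMod.stdAddChar (k * (x : ZMod T)) = ∑ k ∈ Finset.univ.filter (fun k : ZMod T => q • k = 0),
        ZMod.stdAddChar (k * (x : ZMod T)) := by
        rw [← Finset.sum_fiberwise_of_maps_to (s := Finset.univ.filter (fun k : ZMod T => q • k = 0))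
          (t := q.divisors) (g := addOrderOf)]
        · refine Finset.sum_congr rfl fun d hd => Finset.sum_congr ?_ fun _ _ => rfl
          ext k
          simp only [Finset.mem_filter, Finset.mem_univ, true_and]
          constructor
          · intro h; refine ⟨?_, h⟩
            rw [← addOrderOf_dvd_iff_nsmul_eq_zero, h]; exact Nat.dvd_of_mem_divisors hd
          · exact fun h => h.2
        · intro k hk
          rw [Nat.mem_divisors]
          exact ⟨addOrderOf_dvd_iff_nsmul_eq_zero.2 (Finset.mem_filter.1 hk).2, hq0.ne'⟩
      rw [h1]
      split_ifs with h
      · subst h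
        simp [Finset.filter_eq']
      · obtain ⟨M, hM⟩ := hq
        set k0 : ZMod T := (M : ZMod T) with hk0
        have hqk0 : q • k0 = 0 := by
          rw [nsmul_eq_mul, hk0, ← Nat.cast_mul, ← hM]; simp
        set S := ∑ k ∈ Finset.univ.filter (fun k : ZMod T => q • k = 0), ZMod.stdAddChar (k * (x : ZMod T)) with hS
        have hshift : S = ZMod.stdAddChar (k0 * (x : ZMod T)) * S := by
          conv_rhs => rw [hS, Finset.mul_sum]
          rw [hS]
          refine Finset.sum_nbij' (fun k => k - k0) (fun k => k + k0) ?_ ?_ ?_ ?_ ?_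
          · intro k hk
            simp only [Finset.mem_filter, Finset.mem_univ, true_and] at hk ⊢
            rw [nsmul_sub, hk, hqk0, sub_zero]
          · intro k hk
            simp only [Finset.mem_filter, Finset.mem_univ, true_and] at hk ⊢
            rw [nsmul_add, hk, hqk0, add_zero]
          · intros; simp
          · intros; simp
          · intro k _
            rw [← AddChar.map_add_eq_mul]; congr 1; ring
        have hne : ZMod.stdAddChar (k0 * (x : ZMod T)) ≠ 1 := by
          rw [← AddChar.map_zero_eq_one (ZMod.stdAddChar (N := T))]
          intro hh
          have := ZMod.injective_stdAddChar hh
          rw [hk0, ← Nat.cast_mul, ZMod.natCast_eq_zero_iff] at this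
          have h2 : T ∣ M := (Nat.Coprime.dvd_of_dvd_mul_right hx.symm this)
          have hMpos : 0 < M := by
            rcases Nat.eq_zero_or_pos M with h0 | h0
            · rw [h0] at hM; omega
            · exact h0
          have h3 := Nat.le_of_dvd hMpos h2
          have : 2 ≤ q := by omega
          nlinarith
        have : (1 - ZMod.stdAddChar (k0 * (x : ZMod T))) * S = 0 := by
          rw [sub_mul, ← hshift]; ring
        rcases mul_eq_zero.1 this with h0 | h0
        · exact absurd (sub_eq_zero.1 h0).symm hne
        · exact h0
    have hmu : ∑ d ∈ q.divisors, (ArithmeticFunction.moebius d : ℂ) = if q = 1 then 1 else 0 := by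
      have h1 := congrArg (fun f => f q) ArithmeticFunction.moebius_mul_coe_zeta
      simp only [ArithmeticFunction.coe_mul_zeta_apply, ArithmeticFunction.one_apply] at h1
      exact_mod_cast h1
    rw [← Nat.cons_self_properDivisors hq0.ne', Finset.sum_cons] at hsum hmu
    have hrest : ∑ d ∈ q.properDivisors, ∑ k ∈ Finset.univ.filter (fun k : ZMod T => addOrderOf k = d),
        ZMod.stdAddChar (k * (x : ZMod T)) = ∑ d ∈ q.properDivisors, (ArithmeticFunction.moebius d : ℂ) := by
      refine Finset.sum_congr rfl fun d hd => ?_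
      rw [Nat.mem_properDivisors] at hd
      exact ih d hd.2 (hd.1.trans hq)
    rw [hrest] at hsum
    have := hsum.trans hmu.symm
    exact add_right_cancel this

lemma S1 (hT : Squarefree T) (x : ℕ) (hx : Nat.Coprime x T) :
    ∑ k : ZMod T, (gT T Q k : ℂ) * ZMod.stdAddChar (k * (x : ZMod T)) = (LT T Q : ℂ) := by
  rw [sum_by_order, LT]
  push_cast
  rw [Finset.sum_filter]
  refine Finset.sum_congr rfl fun q hq => ?_
  have hq' := Nat.dvd_of_mem_divisors hq
  have h1 : ∀ k ∈ Finset.univ.filter (fun k : ZMod T => addOrderOf k = q),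
      (gT T Q k : ℂ) * ZMod.stdAddChar (k * (x : ZMod T)) =
      (if q ≤ Q then (ArithmeticFunction.moebius q : ℂ) / Nat.totient q else 0) *
        ZMod.stdAddChar (k * (x : ZMod T)) := by
    intro k hk
    rw [gT, (Finset.mem_filter.1 hk).2]
    split_ifs <;> simp
  rw [Finset.sum_congr rfl h1, ← Finset.mul_sum, ramanujan x hx q hq']
  split_ifs
  · have h1 := ArithmeticFunction.moebius_sq_eq_one_of_squarefree (hT.squarefree_of_dvd hq')
    have h2 : ((ArithmeticFunction.moebius q : ℤ) : ℂ) ^ 2 = 1 := by exact_mod_cast h1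
    rw [div_mul_eq_mul_div, ← sq, h2]
  · simp

end sieve
end DMP


namespace DMP

section corr
variable {T : ℕ} [NeZero T] {Q : ℕ}

lemma inK_iff {p M : ℕ} (hp : p.Prime) (hTM : T = p * M) (hpM : ¬ p ∣ M) (k : ZMod T) :
    ¬ p ∣ addOrderOf k ↔ M • k = 0 := by
  rw [← addOrderOf_dvd_iff_nsmul_eq_zero]
  constructor
  · intro h
    have h1 : addOrderOf k ∣ p * M := (ord_dvd k).trans (dvd_of_eq hTM)
    exact Nat.Coprime.dvd_of_dvd_mul_left ((Nat.Prime.coprime_iff_not_dvd hp).2 h).symm h1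
  · exact fun h h2 => hpM (h2.trans h)

lemma g_proj (hT : Squarefree T) {p : ℕ} (hp : p.Prime) (k : ZMod T) (h : p ∣ addOrderOf k) :
    |gT T Q k| ≤ 1 / ((p:ℝ) - 1) * |gT T Q (p • k)| := by
  have hsq := hT.squarefree_of_dvd (ord_dvd k)
  obtain ⟨q', hq'⟩ := h
  have hord : addOrderOf (p • k) = q' := by
    rw [addOrderOf_nsmul' k hp.ne_zero, hq', Nat.gcd_eq_right (Dvd.intro q' rfl)]
    exact Nat.mul_div_cancel_left _ hp.pos
  have hcop : Nat.Coprime p q' := by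
    rw [hq'] at hsq; exact Nat.coprime_of_squarefree_mul hsq
  have hp1 : (1:ℝ) < p := by exact_mod_cast hp.one_lt
  have hq0 : 0 < q' := by
    have := ord_pos k
    rw [hq'] at this
    exact Nat.pos_of_mul_pos_left this
  have hphi : (0:ℝ) < Nat.totient q' := by exact_mod_cast Nat.totient_pos.2 hq0
  have hp1' : 0 < (p:ℝ) - 1 := by linarith
  rw [abs_g hT, abs_g hT, hord, hq']
  split_ifs with h1 h2 h2
  · rw [Nat.totient_mul hcop, Nat.totient_prime hp]
    push_cast [Nat.cast_sub hp.one_lt.le]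
    apply le_of_eq; field_simp
  · exfalso; apply h2; nlinarith [hp.one_lt]
  · positivity
  · simp

lemma S3 (hT : Squarefree T) {z : ℕ} (hz : 2 ≤ z) (hpz : ∀ p, p.Prime → p ∣ T → z ≤ p)
    (s : ZMod T) (hs : s ≠ 0) :
    ∑ k : ZMod T, |gT T Q k| * |gT T Q (k + s)| ≤ 4 / ((z:ℝ) - 1) * LT T Q := by
  have hord : addOrderOf s ≠ 1 := by rwa [Ne, AddMonoid.addOrderOf_eq_one_iff]
  obtain ⟨p, hp, hps⟩ := Nat.exists_prime_and_dvd hord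
  obtain ⟨M, hTM⟩ := hps.trans (ord_dvd s)
  have hpM : ¬ p ∣ M := by
    intro h
    rw [hTM] at hT
    have := Nat.coprime_of_squarefree_mul hT
    exact (Nat.Prime.coprime_iff_not_dvd hp).1 this h
  have hzp : z ≤ p := hpz p hp (hps.trans (ord_dvd s))
  set K : Finset (ZMod T) := Finset.univ.filter (fun k => M • k = 0) with hK
  have memK : ∀ k, k ∈ K ↔ M • k = 0 := by intro k; simp [hK]
  have notK : ∀ k, k ∉ K → p ∣ addOrderOf k := by
    intro k hk
    by_contra h
    exact hk ((memK k).2 ((inK_iff hp hTM hpM k).1 h))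
  have hsK : ¬ M • s = 0 := by
    intro h; exact (inK_iff hp hTM hpM s).2 h hps
  set P : ℝ := (p:ℝ) - 1 with hP
  have hz2 : (2:ℝ) ≤ z := by exact_mod_cast hz
  have hzp' : (z:ℝ) ≤ p := by exact_mod_cast hzp
  have hP1 : 1 ≤ P := by rw [hP]; linarith
  set L := LT T Q with hL
  have hg2 : ∑ k : ZMod T, gT T Q k ^ 2 = L := sum_g_sq hT
  have hL0 : 0 ≤ L := by rw [← hg2]; positivity
  have hsqproj : ∀ k, k ∉ K → gT T Q k ^ 2 ≤ 1 / P ^ 2 * gT T Q (p • k) ^ 2 := by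
    intro k hk
    have := g_proj (Q := Q) hT hp k (notK k hk)
    rw [← sq_abs (gT T Q k), ← sq_abs (gT T Q (p • k))]
    calc |gT T Q k| ^ 2 ≤ (1 / P * |gT T Q (p • k)|) ^ 2 := by gcongr
      _ = _ := by ring
  -- coset bound
  have hcoset : ∀ a : ZMod T, ¬ M • a = 0 → ∑ k ∈ K, gT T Q (k + a) ^ 2 ≤ 1 / P ^ 2 * L := by
    intro a ha
    have h1 : ∀ k ∈ K, gT T Q (k + a) ^ 2 ≤ 1 / P ^ 2 * gT T Q (p • (k + a)) ^ 2 := by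
      intro k hk
      apply hsqproj
      rw [memK] at hk ⊢
      rw [nsmul_add, hk, zero_add]; exact ha
    refine (Finset.sum_le_sum h1).trans ?_
    rw [← Finset.mul_sum]
    have hinj : Set.InjOn (fun k : ZMod T => p • (k + a)) (K : Set (ZMod T)) := by
      intro x hx y hy hxy
      have hx' := (memK x).1 hx
      have hy' := (memK y).1 hy
      simp only [nsmul_add, add_left_inj] at hxy
      have h2 : p • (x - y) = 0 := by rw [nsmul_sub, hxy, sub_self]
      have h3 : M • (x - y) = 0 := by rw [nsmul_sub, hx', hy', sub_self]
      have d1 := addOrderOf_dvd_iff_nsmul_eq_zero.2 h2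
      have d2 := addOrderOf_dvd_iff_nsmul_eq_zero.2 h3
      have d3 := Nat.dvd_gcd d1 d2
      rw [(Nat.Prime.coprime_iff_not_dvd hp).2 hpM] at d3
      have d4 := Nat.dvd_one.1 d3
      rw [AddMonoid.addOrderOf_eq_one_iff] at d4
      exact sub_eq_zero.1 d4
    have h2 : ∑ k ∈ K, gT T Q (p • (k + a)) ^ 2 ≤ L := by
      rw [← hg2, ← Finset.sum_image (f := fun k => gT T Q k ^ 2) hinj]
      exact Finset.sum_le_sum_of_subset_of_nonneg (Finset.subset_univ _) (fun _ _ _ => by positivity)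
    gcongr
  -- complement bound
  have hcompl : ∑ k ∈ Kᶜ, gT T Q k ^ 2 ≤ 2 / P * L := by
    have h1 : ∑ k ∈ Kᶜ, gT T Q k ^ 2 ≤ ∑ k ∈ Kᶜ, 1 / P ^ 2 * gT T Q (p • k) ^ 2 :=
      Finset.sum_le_sum fun k hk => hsqproj k (Finset.mem_compl.1 hk)
    have h2 : ∑ k ∈ Kᶜ, 1 / P ^ 2 * gT T Q (p • k) ^ 2 ≤ ∑ k : ZMod T, 1 / P ^ 2 * gT T Q (p • k) ^ 2 :=
      Finset.sum_le_sum_of_subset_of_nonneg (Finset.subset_univ _) (fun _ _ _ => by positivity)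
    have hfib : ∀ j : ZMod T, ((Finset.univ.filter (fun k : ZMod T => p • k = j)).card : ℝ) ≤ p := by
      intro j
      have : (Finset.univ.filter (fun k : ZMod T => p • k = j)).card ≤ p := by
        rcases (Finset.univ.filter (fun k : ZMod T => p • k = j)).eq_empty_or_nonempty with h | ⟨k0, hk0⟩
        · rw [h]; simp
        · have hk0' : p • k0 = j := by simpa using hk0
          refine le_trans ?_ (IsAddCyclic.card_nsmul_eq_zero_le (α := ZMod T) hp.pos)
          apply Finset.card_le_card_of_injOn (fun k => k - k0)
          · intro k hk
            have hk' : p • k = j := by simpa using hk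
            simp only [Finset.coe_filter, Finset.mem_univ, true_and, Set.mem_setOf_eq]
            rw [nsmul_sub, hk', hk0', sub_self]
          · intro x _ y _ hxy
            simpa using hxy
      exact_mod_cast this
    have h3 : ∑ k : ZMod T, gT T Q (p • k) ^ 2 ≤ p * L := by
      rw [← Finset.sum_fiberwise (s := (Finset.univ : Finset (ZMod T))) (fun k => p • k), ← hg2, Finset.mul_sum]
      refine Finset.sum_le_sum fun j _ => ?_
      have : ∀ k ∈ Finset.univ.filter (fun k : ZMod T => p • k = j), gT T Q (p • k) ^ 2 = gT T Q j ^ 2 := by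
        intro k hk; rw [(Finset.mem_filter.1 hk).2]
      rw [Finset.sum_congr rfl this, Finset.sum_const, nsmul_eq_mul]
      exact mul_le_mul_of_nonneg_right (hfib j) (by positivity)
    rw [← Finset.mul_sum (Finset.univ)] at h2
    have h4 : 1 / P ^ 2 * (p * L) ≤ 2 / P * L := by
      have : (p:ℝ) ≤ 2 * P := by rw [hP]; linarith
      calc 1 / P ^ 2 * (p * L) ≤ 1 / P ^ 2 * ((2 * P) * L) := by gcongr
        _ = _ := by field_simp
    calc _ ≤ _ := h1
      _ ≤ _ := h2
      _ ≤ 1 / P ^ 2 * (p * L) := by gcongr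
      _ ≤ _ := h4
  have amgm : ∀ x y : ℝ, |x| * |y| ≤ 1 / 2 * (1 / P * x ^ 2 + P * y ^ 2) := by
    intro x y
    rw [← sq_abs x, ← sq_abs y]
    have h0 : 0 ≤ 1 / P * (|x| - P * |y|) ^ 2 := by positivity
    have h1 : 1 / P * (|x| - P * |y|) ^ 2 = 1 / P * |x| ^ 2 + P * |y| ^ 2 - 2 * (|x| * |y|) := by
      field_simp; ring
    linarith
  set gg := gT T Q with hgg
  have hpt : ∀ k : ZMod T, |gg k| * |gg (k + s)| ≤
      (if k ∈ K then 1 / 2 * (1 / P * gg k ^ 2 + P * gg (k + s) ^ 2) else 0) +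
      (if k + s ∈ K then 1 / 2 * (1 / P * gg (k + s) ^ 2 + P * gg (k + s - s) ^ 2) else 0) +
      (1 / 2 * (if k ∈ Kᶜ then gg k ^ 2 else 0) + 1 / 2 * (if k + s ∈ Kᶜ then gg (k + s) ^ 2 else 0)) := by
    intro k
    have a1 := amgm (gg k) (gg (k + s))
    have a2 := amgm (gg (k + s)) (gg k)
    rw [add_sub_cancel_right]
    have a3 : |gg k| * |gg (k + s)| ≤ 1 / 2 * gg k ^ 2 + 1 / 2 * gg (k + s) ^ 2 := by
      rw [← sq_abs (gg k), ← sq_abs (gg (k + s))]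
      nlinarith [sq_nonneg (|gg k| - |gg (k + s)|)]
    have b1 : 0 ≤ 1 / 2 * (1 / P * gg k ^ 2 + P * gg (k + s) ^ 2) := by positivity
    have b2 : 0 ≤ 1 / 2 * (1 / P * gg (k + s) ^ 2 + P * gg k ^ 2) := by positivity
    have b3 := sq_nonneg (gg k)
    have b4 := sq_nonneg (gg (k + s))
    simp only [Finset.mem_compl]
    by_cases c1 : k ∈ K <;> by_cases c2 : k + s ∈ K <;> simp only [c1, c2, if_true, if_false, not_true,
      not_false_iff] <;> linarith
  refine (Finset.sum_le_sum fun k _ => hpt k).trans ?_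
  have re : ∀ f : ZMod T → ℝ, ∑ k : ZMod T, f (k + s) = ∑ k, f k := fun f =>
    Equiv.sum_comp (Equiv.addRight s) f
  rw [Finset.sum_add_distrib, Finset.sum_add_distrib, Finset.sum_add_distrib]
  rw [re (fun k => if k ∈ K then 1 / 2 * (1 / P * gg k ^ 2 + P * gg (k - s) ^ 2) else 0)]
  rw [re (fun k => 1 / 2 * (if k ∈ Kᶜ then gg k ^ 2 else 0))]
  simp only [← Finset.mul_sum]
  rw [Finset.sum_ite_mem, Finset.sum_ite_mem, Finset.sum_ite_mem]
  simp only [Finset.univ_inter]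
  simp only [← Finset.mul_sum, Finset.sum_add_distrib]
  have hKL : ∑ k ∈ K, gg k ^ 2 ≤ L := by
    rw [← hg2]
    exact Finset.sum_le_sum_of_subset_of_nonneg (Finset.subset_univ _) (fun _ _ _ => by positivity)
  have c1 := hcoset s hsK
  have c2 := hcoset (-s) (by rw [smul_neg, neg_eq_zero]; exact hsK)
  simp only [← sub_eq_add_neg] at c2
  have d1 : P * (1 / P ^ 2 * L) = 1 / P * L := by field_simp
  have d2 : P * ∑ k ∈ K, gg (k + s) ^ 2 ≤ 1 / P * L := by rw [← d1]; gcongr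
  have d3 : P * ∑ k ∈ K, gg (k - s) ^ 2 ≤ 1 / P * L := by rw [← d1]; gcongr
  have d4 : 1 / P * ∑ k ∈ K, gg k ^ 2 ≤ 1 / P * L := by gcongr
  have d5 : 4 / P * L ≤ 4 / ((z:ℝ) - 1) * L := by
    have : (0:ℝ) < z - 1 := by linarith
    gcongr
    rw [hP]; linarith
  have d6 : 4 / P * L = 2 * (1 / P * L) + 2 / P * L := by ring
  set A1 := ∑ k ∈ K, gg k ^ 2
  linarith

end corr
end DMP


namespace DMP

section mass

noncomputable def Hs (S : Finset ℕ) (Q : ℕ) : ℝ :=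
  ∑ U ∈ S.powerset, if ∏ p ∈ U, p ≤ Q then ∏ p ∈ U, 1 / ((p:ℝ) - 1) else 0

lemma prod_nonneg_aux (U : Finset ℕ) (h : ∀ p ∈ U, 2 ≤ p) : 0 ≤ ∏ p ∈ U, 1 / ((p:ℝ) - 1) := by
  apply Finset.prod_nonneg
  intro p hp
  have : (2:ℝ) ≤ p := by exact_mod_cast h p hp
  have : 0 < (p:ℝ) - 1 := by linarith
  positivity

lemma Hs_nonneg (S : Finset ℕ) (Q : ℕ) (h : ∀ p ∈ S, 2 ≤ p) : 0 ≤ Hs S Q := by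
  apply Finset.sum_nonneg
  intro U hU
  rw [Finset.mem_powerset] at hU
  split_ifs
  · exact prod_nonneg_aux U (fun p hp => h p (hU hp))
  · exact le_rfl

lemma Hs_mono {S S' : Finset ℕ} (Q : ℕ) (h : ∀ p ∈ S', 2 ≤ p) (hSS : S ⊆ S') : Hs S Q ≤ Hs S' Q := by
  apply Finset.sum_le_sum_of_subset_of_nonneg (Finset.powerset_mono.2 hSS)
  intro U hU _
  rw [Finset.mem_powerset] at hU
  split_ifs
  · exact prod_nonneg_aux U (fun p hp => h p (hU hp))
  · exact le_rfl

lemma Hs_insert (S : Finset ℕ) (Q p : ℕ) (hp : 2 ≤ p) (h : ∀ p ∈ S, 2 ≤ p) :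
    Hs (insert p S) Q ≤ (p / ((p:ℝ) - 1)) * Hs S Q := by
  have hp2 : (2:ℝ) ≤ p := by exact_mod_cast hp
  have hp1 : 0 < (p:ℝ) - 1 := by linarith
  have h0 := Hs_nonneg S Q h
  have heq : (p / ((p:ℝ) - 1)) = 1 + 1 / ((p:ℝ) - 1) := by field_simp; ring
  by_cases hpS : p ∈ S
  · rw [Finset.insert_eq_of_mem hpS, heq]
    have : 0 ≤ 1 / ((p:ℝ) - 1) := by positivity
    nlinarith
  · rw [Hs, Finset.sum_powerset_insert hpS, heq, add_mul, one_mul]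
    apply add_le_add le_rfl
    rw [Hs, Finset.mul_sum]
    refine Finset.sum_le_sum fun U hU => ?_
    rw [Finset.mem_powerset] at hU
    have hpU : p ∉ U := fun hh => hpS (hU hh)
    rw [Finset.prod_insert hpU, Finset.prod_insert hpU]
    have h1 := prod_nonneg_aux U (fun p hp => h p (hU hp))
    split_ifs with c1 c2 c2
    · exact le_rfl
    · exfalso; apply c2
      refine le_trans ?_ c1
      exact Nat.le_mul_of_pos_left _ (by omega)
    · have : 0 ≤ 1 / ((p:ℝ) - 1) := by positivity
      positivity
    · simp

lemma Hs_union (S D : Finset ℕ) (Q : ℕ) (hS : ∀ p ∈ S, 2 ≤ p) (hD : ∀ p ∈ D, 2 ≤ p) :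
    Hs (D ∪ S) Q ≤ (∏ p ∈ D, (p / ((p:ℝ) - 1))) * Hs S Q := by
  induction D using Finset.induction_on with
  | empty => simp
  | insert p D hpD ih =>
    rw [Finset.insert_union, Finset.prod_insert hpD, mul_assoc]
    have hp : 2 ≤ p := hD p (Finset.mem_insert_self _ _)
    have hD' : ∀ p ∈ D, 2 ≤ p := fun p hp => hD p (Finset.mem_insert_of_mem hp)
    have hp2 : (2:ℝ) ≤ p := by exact_mod_cast hp
    have hp1 : 0 < (p:ℝ) - 1 := by linarith
    refine (Hs_insert _ Q p hp ?_).trans ?_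
    · intro q hq
      rcases Finset.mem_union.1 hq with h | h
      · exact hD' q h
      · exact hS q h
    · have := ih hD'
      gcongr

lemma Hs_lower (Q : ℕ) :
    ∑ q ∈ (Finset.Icc 1 Q).filter Squarefree, 1 / (q:ℝ) ≤ Hs (Nat.primesBelow (Q + 1)) Q := by
  unfold Hs
  have hinj : Set.InjOn (fun q : ℕ => q.primeFactors) ((Finset.Icc 1 Q).filter Squarefree : Finset ℕ) := by
    intro a ha b hb hab
    have ha' := (Finset.mem_filter.1 ha).2
    have hb' := (Finset.mem_filter.1 hb).2
    rw [← Nat.prod_primeFactors_of_squarefree ha', ← Nat.prod_primeFactors_of_squarefree hb']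
    simp only at hab
    rw [hab]
  have hsub : ((Finset.Icc 1 Q).filter Squarefree).image (fun q : ℕ => q.primeFactors) ⊆
      (Nat.primesBelow (Q + 1)).powerset := by
    intro U hU
    obtain ⟨q, hq, rfl⟩ := Finset.mem_image.1 hU
    rw [Finset.mem_filter, Finset.mem_Icc] at hq
    rw [Finset.mem_powerset]
    intro p hp
    rw [Nat.mem_primesBelow]
    have := Nat.le_of_mem_primeFactors hp
    exact ⟨by omega, Nat.prime_of_mem_primeFactors hp⟩
  refine le_trans ?_ (Finset.sum_le_sum_of_subset_of_nonneg hsub ?_)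
  · rw [Finset.sum_image hinj]
    refine Finset.sum_le_sum fun q hq => ?_
    rw [Finset.mem_filter, Finset.mem_Icc] at hq
    rw [if_pos (by rw [Nat.prod_primeFactors_of_squarefree hq.2]; exact hq.1.2)]
    have : (q:ℝ) = ∏ p ∈ q.primeFactors, (p:ℝ) := by
      rw [← Nat.cast_prod, Nat.prod_primeFactors_of_squarefree hq.2]
    conv_lhs => rw [this]
    rw [one_div, ← Finset.prod_inv_distrib]
    apply Finset.prod_le_prod
    · intros; positivity
    · intro p hp
      have : 2 ≤ p := (Nat.prime_of_mem_primeFactors hp).two_le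
      have h2 : (2:ℝ) ≤ p := by exact_mod_cast this
      rw [← one_div]
      apply one_div_le_one_div_of_le <;> linarith
  · intro U hU _
    rw [Finset.mem_powerset] at hU
    split_ifs
    · exact prod_nonneg_aux U (fun p hp => (Nat.prime_of_mem_primesBelow (hU hp)).two_le)
    · exact le_rfl

lemma sqfree_harmonic (Q : ℕ) :
    Real.log Q ≤ 2 * ∑ q ∈ (Finset.Icc 1 Q).filter Squarefree, 1 / (q:ℝ) := by
  rcases Nat.eq_zero_or_pos Q with h0 | hQ
  · subst h0; simp
  have h1 : Real.log Q ≤ ∑ n ∈ Finset.Icc 1 Q, 1 / (n:ℝ) := by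
    have h2 := log_add_one_le_harmonic Q
    have h3 : Real.log Q ≤ Real.log (Q + 1 : ℕ) := by
      apply Real.log_le_log (by exact_mod_cast hQ); push_cast; linarith
    have h4 : ((harmonic Q : ℚ) : ℝ) = ∑ n ∈ Finset.Icc 1 Q, 1 / (n:ℝ) := by
      rw [harmonic_eq_sum_Icc]; push_cast; simp
    push_cast at h3 h2
    linarith
  refine h1.trans ?_
  choose! f g hfg using fun n : ℕ => Nat.sq_mul_squarefree n
  have hinj : Set.InjOn (fun n : ℕ => (g n, f n)) ((Finset.Icc 1 Q : Finset ℕ) : Set ℕ) := by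
    intro a _ b _ hab
    simp only [Prod.mk.injEq] at hab
    rw [← (hfg a).1, ← (hfg b).1, hab.1, hab.2]
  have h2 : ∑ n ∈ Finset.Icc 1 Q, 1 / (n:ℝ) ≤ ∑ x ∈ Finset.Ioo 0 (Q + 1) ×ˢ (Finset.Icc 1 Q).filter Squarefree,
      ((x.1:ℝ) ^ 2)⁻¹ * (1 / (x.2:ℝ)) := by
    have h3 : ∑ n ∈ Finset.Icc 1 Q, 1 / (n:ℝ) = ∑ x ∈ (Finset.Icc 1 Q).image (fun n : ℕ => (g n, f n)),
        ((x.1:ℝ) ^ 2)⁻¹ * (1 / (x.2:ℝ)) := by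
      rw [Finset.sum_image hinj]
      refine Finset.sum_congr rfl fun n _ => ?_
      have : (n:ℝ) = (g n:ℝ) ^ 2 * f n := by exact_mod_cast (hfg n).1.symm
      conv_lhs => rw [this]
      rw [one_div, mul_inv, one_div]
    rw [h3]
    apply Finset.sum_le_sum_of_subset_of_nonneg
    · intro x hx
      obtain ⟨n, hn, rfl⟩ := Finset.mem_image.1 hx
      rw [Finset.mem_Icc] at hn
      obtain ⟨e1, e2⟩ := hfg n
      have hg0 : 0 < g n := by
        rcases Nat.eq_zero_or_pos (g n) with h | h
        · rw [h] at e1; simp at e1; omega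
        · exact h
      have hf0 : 0 < f n := by
        rcases Nat.eq_zero_or_pos (f n) with h | h
        · rw [h] at e1; simp at e1; omega
        · exact h
      simp only [Finset.mem_product, Finset.mem_Ioo, Finset.mem_filter, Finset.mem_Icc]
      refine ⟨⟨hg0, ?_⟩, ⟨hf0, ?_⟩, e2⟩
      · have : g n ≤ g n ^ 2 * f n := by nlinarith [Nat.mul_pos hg0 hf0]
        omega
      · have : f n ≤ g n ^ 2 * f n := Nat.le_mul_of_pos_left _ (by positivity)
        omega
    · intros; positivity
  refine h2.trans ?_
  rw [Finset.sum_product]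
  simp only
  rw [← Finset.sum_mul_sum]
  have h4 := sum_Ioo_inv_sq_le (α := ℝ) 0 (Q + 1)
  have h5 : 0 ≤ ∑ q ∈ (Finset.Icc 1 Q).filter Squarefree, 1 / (q:ℝ) := by positivity
  norm_num at h4
  gcongr

noncomputable def Vz (z : ℕ) : ℝ := ∏ p ∈ Nat.primesBelow z, (p / ((p:ℝ) - 1))

lemma totient_prod (U : Finset ℕ) (hU : ∀ p ∈ U, p.Prime) :
    (Nat.totient (∏ p ∈ U, p) : ℝ) = ∏ p ∈ U, ((p:ℝ) - 1) := by
  have h1 := Nat.totient_mul_prod_primeFactors (∏ p ∈ U, p)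
  rw [Nat.primeFactors_prod hU] at h1
  have h0 : 0 < ∏ p ∈ U, p := Finset.prod_pos fun p hp => (hU p hp).pos
  rw [mul_comm] at h1
  have h2 := Nat.eq_of_mul_eq_mul_left h0 h1
  rw [h2]; push_cast
  refine Finset.prod_congr rfl fun p hp => ?_
  rw [Nat.cast_sub (hU p hp).one_lt.le]; simp

/-- sifting primes -/
def sieveP (m z Q : ℕ) : Finset ℕ := (Nat.primesBelow (Q + 1)).filter (fun p => z ≤ p ∧ ¬ p ∣ m)

def Tz (m z Q : ℕ) : ℕ := ∏ p ∈ sieveP m z Q, p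

lemma sieveP_prime {m z Q p : ℕ} (h : p ∈ sieveP m z Q) : p.Prime :=
  Nat.prime_of_mem_primesBelow (Finset.mem_filter.1 h).1

lemma Tz_pos (m z Q : ℕ) : 0 < Tz m z Q := Finset.prod_pos fun _ hp => (sieveP_prime hp).pos

lemma prime_dvd_Tz {m z Q p : ℕ} (hp : p.Prime) (h : p ∣ Tz m z Q) : p ∈ sieveP m z Q := by
  rw [Tz, Prime.dvd_finsetProd_iff hp.prime] at h
  obtain ⟨q, hq, hpq⟩ := h
  rwa [(Nat.prime_dvd_prime_iff_eq hp (sieveP_prime hq)).1 hpq]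

lemma Tz_sqfree (m z Q : ℕ) : Squarefree (Tz m z Q) := by
  rw [Tz]
  apply Finset.squarefree_prod_of_pairwise_isCoprime
  · intro a ha b hb hab
    exact Nat.coprime_iff_isRelPrime.1 ((Nat.coprime_primes (sieveP_prime ha) (sieveP_prime hb)).2 hab)
  · intro p hp; exact (sieveP_prime hp).prime.squarefree

lemma Tz_coprime_m (m z Q : ℕ) : Nat.Coprime m (Tz m z Q) := by
  apply Nat.Coprime.symm
  apply Nat.coprime_of_dvd
  intro p hp h1 h2
  have := prime_dvd_Tz hp h1
  exact (Finset.mem_filter.1 this).2.2 h2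

lemma prime_coprime_Tz (m z Q x : ℕ) (hx : x.Prime) (hxQ : Q < x) : Nat.Coprime x (Tz m z Q) := by
  rw [Nat.Prime.coprime_iff_not_dvd hx]
  intro h
  have := prime_dvd_Tz hx h
  have := Nat.lt_of_mem_primesBelow (Finset.mem_filter.1 this).1
  omega

lemma LT_ge_Hs (m z Q : ℕ) : Hs (sieveP m z Q) Q ≤ LT (Tz m z Q) Q := by
  unfold Hs LT
  rw [← Finset.sum_filter]
  have hpr : ∀ U ∈ (sieveP m z Q).powerset.filter (fun U => ∏ p ∈ U, p ≤ Q), ∀ p ∈ U, p.Prime := by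
    intro U hU p hp
    exact sieveP_prime (Finset.mem_powerset.1 (Finset.mem_filter.1 hU).1 hp)
  have hinj : Set.InjOn (fun U : Finset ℕ => ∏ p ∈ U, p)
      ((sieveP m z Q).powerset.filter (fun U => ∏ p ∈ U, p ≤ Q) : Finset (Finset ℕ)) := by
    intro U hU V hV hUV
    simp only at hUV
    rw [← Nat.primeFactors_prod (hpr U hU), ← Nat.primeFactors_prod (hpr V hV), hUV]
  have h1 : ∑ U ∈ (sieveP m z Q).powerset.filter (fun U => ∏ p ∈ U, p ≤ Q), ∏ p ∈ U, 1 / ((p:ℝ) - 1) =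
      ∑ q ∈ ((sieveP m z Q).powerset.filter (fun U => ∏ p ∈ U, p ≤ Q)).image (fun U : Finset ℕ => ∏ p ∈ U, p),
        1 / (Nat.totient q : ℝ) := by
    rw [Finset.sum_image hinj]
    refine Finset.sum_congr rfl fun U hU => ?_
    rw [totient_prod U (hpr U hU)]
    simp
  rw [h1]
  apply Finset.sum_le_sum_of_subset_of_nonneg
  · intro q hq
    obtain ⟨U, hU, rfl⟩ := Finset.mem_image.1 hq
    rw [Finset.mem_filter] at hU ⊢
    refine ⟨Nat.mem_divisors.2 ⟨?_, (Tz_pos m z Q).ne'⟩, hU.2⟩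
    exact Finset.prod_dvd_prod_of_subset _ _ _ (Finset.mem_powerset.1 hU.1)
  · intros; positivity

lemma S4 (m z Q : ℕ) (hm : 1 ≤ m) :
    Real.log Q ≤ 2 * (Vz z * ((m:ℝ) / Nat.totient m) * LT (Tz m z Q) Q) := by
  have hphi : (0:ℝ) < Nat.totient m := by exact_mod_cast Nat.totient_pos.2 (by omega)
  have h1 := sqfree_harmonic Q
  have h2 := Hs_lower Q
  have hsub : Nat.primesBelow (Q + 1) ⊆ Nat.primesBelow z ∪ (m.primeFactors ∪ sieveP m z Q) := by
    intro p hp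
    have hpp := Nat.prime_of_mem_primesBelow hp
    simp only [Finset.mem_union, Nat.mem_primesBelow, Nat.mem_primeFactors, sieveP, Finset.mem_filter]
    by_cases c1 : p < z
    · left; exact ⟨c1, hpp⟩
    · by_cases c2 : p ∣ m
      · right; left; exact ⟨hpp, c2, by omega⟩
      · right; right; exact ⟨Nat.mem_primesBelow.1 hp, by omega, c2⟩
  have g1 : ∀ p ∈ Nat.primesBelow z, 2 ≤ p := fun p hp => (Nat.prime_of_mem_primesBelow hp).two_le
  have g2 : ∀ p ∈ m.primeFactors, 2 ≤ p := fun p hp => (Nat.prime_of_mem_primeFactors hp).two_le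
  have g3 : ∀ p ∈ sieveP m z Q, 2 ≤ p := fun p hp => (sieveP_prime hp).two_le
  have g4 : ∀ p ∈ m.primeFactors ∪ sieveP m z Q, 2 ≤ p := by
    intro p hp
    rcases Finset.mem_union.1 hp with h | h
    · exact g2 p h
    · exact g3 p h
  have g5 : ∀ p ∈ Nat.primesBelow z ∪ (m.primeFactors ∪ sieveP m z Q), 2 ≤ p := by
    intro p hp
    rcases Finset.mem_union.1 hp with h | h
    · exact g1 p h
    · exact g4 p h
  have h3 := Hs_mono Q g5 hsub
  have h4 := Hs_union _ _ Q g4 g1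
  have h5 := Hs_union _ _ Q g3 g2
  have hm' : ∏ p ∈ m.primeFactors, (p / ((p:ℝ) - 1)) = (m:ℝ) / Nat.totient m := by
    rw [Finset.prod_div_distrib]
    have h6 := Nat.totient_mul_prod_primeFactors m
    have h7 : (Nat.totient m : ℝ) * ∏ p ∈ m.primeFactors, (p:ℝ) = m * ∏ p ∈ m.primeFactors, ((p:ℝ) - 1) := by
      have h8 : ∏ p ∈ m.primeFactors, ((p:ℝ) - 1) = ((∏ p ∈ m.primeFactors, (p - 1) : ℕ) : ℝ) := by
        push_cast
        refine Finset.prod_congr rfl fun p hp => ?_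
        have := g2 p hp
        rw [Nat.cast_sub (by omega)]; simp
      rw [h8, ← Nat.cast_prod, ← Nat.cast_mul, ← Nat.cast_mul]
      exact congrArg _ h6
    have h9 : 0 < ∏ p ∈ m.primeFactors, ((p:ℝ) - 1) := by
      apply Finset.prod_pos
      intro p hp
      have : (2:ℝ) ≤ p := by exact_mod_cast g2 p hp
      linarith
    rw [div_eq_div_iff h9.ne' hphi.ne']
    linarith
  have hV : 0 ≤ Vz z := by
    apply Finset.prod_nonneg
    intro p hp
    have : (2:ℝ) ≤ p := by exact_mod_cast g1 p hp
    have : 0 < (p:ℝ) - 1 := by linarith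
    positivity
  rw [hm'] at h5
  have h6 := LT_ge_Hs m z Q
  have h7 : Vz z * Hs (m.primeFactors ∪ sieveP m z Q) Q ≤ Vz z * ((m:ℝ) / Nat.totient m * LT (Tz m z Q) Q) := by
    apply mul_le_mul_of_nonneg_left _ hV
    refine h5.trans ?_
    gcongr
  have h8 : Hs (Nat.primesBelow z ∪ (m.primeFactors ∪ sieveP m z Q)) Q ≤
    Vz z * Hs (m.primeFactors ∪ sieveP m z Q) Q := h4
  rw [mul_assoc (Vz z)]
  linarith

end mass
end DMP


namespace DMP

lemma card_primes_small (η : ℝ) (hη : 0 < η) :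
    ∃ j0 : ℕ, ∀ j ≥ j0, ((Nat.primesBelow (2 ^ j)).card : ℝ) ≤ η * 2 ^ j := by
  have h1 := Chebyshev.eventually_primeCounting_le (ε := 1) one_pos
  have h2 : ∀ᶠ x : ℝ in atTop, (Real.log 4 + 1) / η ≤ Real.log x :=
    Real.tendsto_log_atTop.eventually_ge_atTop _
  have h3 : Tendsto (fun j : ℕ => (2:ℝ) ^ j) atTop atTop := tendsto_pow_atTop_atTop_of_one_lt (by norm_num)
  obtain ⟨j0, hj⟩ := eventually_atTop.1 (h3.eventually (h1.and h2))
  refine ⟨j0, fun j hj' => ?_⟩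
  obtain ⟨g1, g2⟩ := hj j hj'
  have h4 : ⌊(2:ℝ) ^ j⌋₊ = 2 ^ j := by
    have : ((2:ℝ) ^ j) = ((2 ^ j : ℕ) : ℝ) := by push_cast; rfl
    rw [this, Nat.floor_natCast]
  rw [h4] at g1
  have h5 : (Nat.primesBelow (2 ^ j)).card ≤ Nat.primeCounting (2 ^ j) := by
    rw [Nat.primesBelow_card_eq_primeCounting']
    exact Nat.monotone_primeCounting' (Nat.le_succ _)
  have hl4 : 0 < Real.log 4 := Real.log_pos (by norm_num)
  have h6 : 0 < Real.log ((2:ℝ) ^ j) := lt_of_lt_of_le (by positivity) g2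
  calc ((Nat.primesBelow (2 ^ j)).card : ℝ) ≤ (Nat.primeCounting (2 ^ j) : ℝ) := by exact_mod_cast h5
    _ ≤ _ := g1
    _ ≤ _ := by
      rw [div_le_iff₀ h6]
      rw [div_le_iff₀ hη] at g2
      have : (0:ℝ) ≤ 2 ^ j := by positivity
      nlinarith

lemma Vz_factor {p : ℕ} (hp : p.Prime) : 1 ≤ (p:ℝ) / ((p:ℝ) - 1) := by
  have : (2:ℝ) ≤ p := by exact_mod_cast hp.two_le
  rw [le_div_iff₀ (by linarith)]; linarith

lemma Vz_mono {a b : ℕ} (h : a ≤ b) : Vz a ≤ Vz b := by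
  unfold Vz
  apply Finset.prod_le_prod_of_subset_of_one_le
  · intro p hp
    rw [Nat.mem_primesBelow] at hp ⊢
    exact ⟨by omega, hp.2⟩
  · intro p hp
    have := Vz_factor (Nat.prime_of_mem_primesBelow hp)
    linarith
  · intro p hp _
    exact Vz_factor (Nat.prime_of_mem_primesBelow hp)

lemma Vz_pos (a : ℕ) : 0 < Vz a :=
  Finset.prod_pos fun p hp => by
    have := Vz_factor (Nat.prime_of_mem_primesBelow hp); linarith

lemma Vz_step (j : ℕ) (hj : 1 ≤ j) (η : ℝ)
    (h : ((Nat.primesBelow (2 ^ (j+1))).card : ℝ) ≤ η * 2 ^ (j+1)) :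
    Vz (2 ^ (j+1)) ≤ Vz (2 ^ j) * Real.exp (4 * η) := by
  have hsub : Nat.primesBelow (2 ^ j) ⊆ Nat.primesBelow (2 ^ (j+1)) := by
    intro p hp
    rw [Nat.mem_primesBelow] at hp ⊢
    have : 2 ^ j ≤ 2 ^ (j+1) := Nat.pow_le_pow_right (by norm_num) (by omega)
    exact ⟨by omega, hp.2⟩
  have h2j : (2:ℝ) ≤ 2 ^ j := by
    calc (2:ℝ) = 2 ^ 1 := by norm_num
      _ ≤ 2 ^ j := pow_le_pow_right₀ (by norm_num) hj
  unfold Vz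
  rw [← Finset.prod_sdiff hsub, mul_comm]
  refine mul_le_mul_of_nonneg_left ?_ (Vz_pos _).le
  calc ∏ p ∈ Nat.primesBelow (2 ^ (j+1)) \ Nat.primesBelow (2 ^ j), ((p:ℝ) / ((p:ℝ) - 1))
      ≤ ∏ p ∈ Nat.primesBelow (2 ^ (j+1)) \ Nat.primesBelow (2 ^ j), Real.exp (2 / 2 ^ j) := by
        apply Finset.prod_le_prod
        · intro p hp
          have := Vz_factor (Nat.prime_of_mem_primesBelow (Finset.mem_sdiff.1 hp).1); linarith
        · intro p hp
          obtain ⟨hp1, hp2⟩ := Finset.mem_sdiff.1 hp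
          have hpp := Nat.prime_of_mem_primesBelow hp1
          have h3 : 2 ^ j ≤ p := by
            by_contra h'
            exact hp2 (Nat.mem_primesBelow.2 ⟨by omega, hpp⟩)
          have h4 : (2:ℝ) ^ j ≤ p := by exact_mod_cast h3
          have h5 : (p:ℝ) / ((p:ℝ) - 1) = 1 / ((p:ℝ) - 1) + 1 := by
            field_simp [show (p:ℝ) - 1 ≠ 0 by linarith]; ring
          have h6 : 1 / ((p:ℝ) - 1) ≤ 2 / 2 ^ j := by
            rw [div_le_div_iff₀ (by linarith) (by linarith)]; linarith
          rw [h5]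
          linarith [Real.add_one_le_exp (2 / (2:ℝ) ^ j)]
    _ = Real.exp ((Nat.primesBelow (2 ^ (j+1)) \ Nat.primesBelow (2 ^ j)).card * (2 / 2 ^ j)) := by
        rw [Finset.prod_const, Real.exp_nat_mul]
    _ ≤ Real.exp (4 * η) := by
        apply Real.exp_le_exp.2
        have h7 : ((Nat.primesBelow (2 ^ (j+1)) \ Nat.primesBelow (2 ^ j)).card : ℝ) ≤ η * 2 ^ (j+1) :=
          le_trans (by exact_mod_cast Finset.card_le_card Finset.sdiff_subset) h
        calc _ ≤ η * 2 ^ (j+1) * (2 / 2 ^ j) := by gcongr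
          _ = _ := by field_simp; ring

lemma Vz_bound (ε : ℝ) (hε : 0 < ε) : ∃ C > 0, ∀ z : ℕ, 1 ≤ z → Vz z ≤ C * (z:ℝ) ^ ε := by
  have hl2 : 0 < Real.log 2 := Real.log_pos (by norm_num)
  obtain ⟨j0, hj0⟩ := card_primes_small (ε * Real.log 2 / 4) (by positivity)
  set J := j0 + 1 with hJ
  have key : ∀ i : ℕ, Vz (2 ^ (J + i)) ≤ Vz (2 ^ J) * ((2:ℝ) ^ ε) ^ i := by
    intro i
    induction i with
    | zero => simp
    | succ i ih =>
      have h := Vz_step (J + i) (by omega) _ (hj0 (J + i + 1) (by omega))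
      have : Real.exp (4 * (ε * Real.log 2 / 4)) = (2:ℝ) ^ ε := by
        rw [Real.rpow_def_of_pos (by norm_num)]; congr 1; ring
      rw [this] at h
      calc _ ≤ _ := h
        _ ≤ Vz (2 ^ J) * ((2:ℝ) ^ ε) ^ i * (2:ℝ) ^ ε := by gcongr
        _ = _ := by rw [pow_succ]; ring
  have h2e : (1:ℝ) ≤ 2 ^ ε := Real.one_le_rpow (by norm_num) hε.le
  refine ⟨Vz (2 ^ J) * 2 ^ ε, mul_pos (Vz_pos _) (by linarith), fun z hz => ?_⟩
  have h1 : z < 2 ^ (Nat.log 2 z + 1) := Nat.lt_pow_succ_log_self (by norm_num) z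
  have h2 : 2 ^ (Nat.log 2 z) ≤ z := Nat.pow_log_le_self 2 (by omega)
  set l := Nat.log 2 z
  have h3 : ((2:ℝ) ^ ε) ^ l ≤ (z:ℝ) ^ ε := by
    rw [← Real.rpow_natCast, ← Real.rpow_mul (by norm_num), mul_comm, Real.rpow_mul (by norm_num),
      Real.rpow_natCast]
    apply Real.rpow_le_rpow (by positivity) _ hε.le
    exact_mod_cast h2
  calc Vz z ≤ Vz (2 ^ (J + (l + 1))) := Vz_mono (le_trans h1.le (Nat.pow_le_pow_right (by norm_num) (by omega)))
    _ ≤ Vz (2 ^ J) * ((2:ℝ) ^ ε) ^ (l + 1) := key _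
    _ = Vz (2 ^ J) * 2 ^ ε * ((2:ℝ) ^ ε) ^ l := by rw [pow_succ]; ring
    _ ≤ _ := by
      have := Vz_pos (2 ^ J)
      gcongr

end DMP


namespace DMP

variable {T : ℕ} [NeZero T] {Q : ℕ}

lemma char_eq (k : ZMod T) (x : ℕ) :
    ZMod.stdAddChar (k * (x : ZMod T)) = e ((k.val:ℝ) * x / T) := by
  have h : k * (x : ZMod T) = (((k.val * x : ℕ) : ℤ) : ZMod T) := by
    push_cast; rw [ZMod.natCast_zmod_val]
  rw [h, ZMod.stdAddChar_coe, e]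
  congr 1
  push_cast
  ring

/-- separation of the frequencies -/
lemma separation (m : ℕ) (hm : Nat.Coprime m T) (D : ℤ) (q : ℕ) (hq : 0 < q)
    (h1 : ((q * D : ℤ) : ZMod T) = 0) (h2 : ((D : ℤ) : ZMod T) ≠ 0) (j : ℤ) :
    1 / (q:ℝ) ≤ |(m:ℝ) * D / T - j| := by
  have hT : (0:ℝ) < T := by exact_mod_cast NeZero.pos T
  rw [ZMod.intCast_zmod_eq_zero_iff_dvd] at h1
  have h2' : ¬ (T:ℤ) ∣ D := fun h => h2 ((ZMod.intCast_zmod_eq_zero_iff_dvd _ _).2 h)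
  have h3 : ¬ (T:ℤ) ∣ m * D := by
    intro h
    apply h2'
    have hc : IsCoprime (T:ℤ) (m:ℤ) := Nat.isCoprime_iff_coprime.2 hm.symm
    exact hc.dvd_of_dvd_mul_left h
  have h4 : (T:ℤ) ∣ q * (m * D - j * T) := by
    have : (q:ℤ) * (m * D - j * T) = m * (q * D) - (T:ℤ) * (q * j) := by ring
    rw [this]
    exact dvd_sub (h1.mul_left _) (dvd_mul_right _ _)
  have h5 : (m * D - j * T : ℤ) ≠ 0 := by
    intro h
    apply h3
    exact ⟨j, by linarith⟩
  have h6 : (T:ℤ) ≤ |(q:ℤ) * (m * D - j * T)| := by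
    apply Int.le_of_dvd
    · apply abs_pos.2; apply mul_ne_zero _ h5; exact_mod_cast hq.ne'
    · exact (dvd_abs _ _).2 h4
  have h7 : (T:ℝ) ≤ q * |(m:ℝ) * D - j * T| := by
    have : ((T:ℤ):ℝ) ≤ ((|(q:ℤ) * (m * D - j * T)| : ℤ) : ℝ) := by exact_mod_cast h6
    push_cast at this
    rw [abs_mul] at this
    simpa using this
  have h8 : (m:ℝ) * D / T - j = ((m:ℝ) * D - j * T) / T := by field_simp
  rw [h8, abs_div, abs_of_pos hT, div_le_div_iff₀ (by exact_mod_cast hq) hT]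
  linarith

noncomputable def bet (m : ℕ) (θ : ℝ) (k k' : ZMod T) : ℝ := (m:ℝ) * ((k.val:ℝ) - k'.val) / T + θ


lemma g_ne {k : ZMod T} (h : gT T Q k ≠ 0) : addOrderOf k ≤ Q := by
  by_contra h'
  exact h (by rw [gT, if_neg h'])

lemma ex_bad (m : ℕ) (hm : Nat.Coprime m T) (θ : ℝ) (hQ : 1 ≤ Q) :
    ∃ s : ZMod T, ∀ k k' : ZMod T, k ≠ k' → gT T Q k ≠ 0 → gT T Q k' ≠ 0 → k - k' ≠ s →
      1 / (2 * (Q:ℝ) ^ 4) ≤ |bet m θ k k' - round (bet m θ k k')| := by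
  by_cases hb : ∃ k k' : ZMod T, k ≠ k' ∧ gT T Q k ≠ 0 ∧ gT T Q k' ≠ 0 ∧
      |bet m θ k k' - round (bet m θ k k')| < 1 / (2 * (Q:ℝ) ^ 4)
  · obtain ⟨l, l', hl, h1, h2, h3⟩ := hb
    refine ⟨l - l', fun k k' hk g1 g2 hne => ?_⟩
    by_contra hlt
    push Not at hlt
    have o1 := g_ne h1
    have o2 := g_ne h2
    have o3 := g_ne g1
    have o4 := g_ne g2
    set q := addOrderOf l * addOrderOf l' * (addOrderOf k * addOrderOf k') with hq
    have hqp : 0 < q := by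
      have := ord_pos l; have := ord_pos l'; have := ord_pos k; have := ord_pos k'
      positivity
    have hqle : (q:ℝ) ≤ (Q:ℝ) ^ 4 := by
      have : q ≤ Q ^ 4 := by
        calc q ≤ Q * Q * (Q * Q) := Nat.mul_le_mul (Nat.mul_le_mul o1 o2) (Nat.mul_le_mul o3 o4)
          _ = Q ^ 4 := by ring
      exact_mod_cast this
    have z1 : (addOrderOf l : ZMod T) * l = 0 := by rw [← nsmul_eq_mul, addOrderOf_nsmul_eq_zero]
    have z2 : (addOrderOf l' : ZMod T) * l' = 0 := by rw [← nsmul_eq_mul, addOrderOf_nsmul_eq_zero]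
    have z3 : (addOrderOf k : ZMod T) * k = 0 := by rw [← nsmul_eq_mul, addOrderOf_nsmul_eq_zero]
    have z4 : (addOrderOf k' : ZMod T) * k' = 0 := by rw [← nsmul_eq_mul, addOrderOf_nsmul_eq_zero]
    have hs := separation (T := T) m hm ((k.val:ℤ) - k'.val - (l.val - l'.val)) q hqp
      (by
        push_cast
        simp only [ZMod.natCast_zmod_val]
        rw [hq]; push_cast
        linear_combination (addOrderOf l : ZMod T) * addOrderOf l' * addOrderOf k' * z3
          - (addOrderOf l : ZMod T) * addOrderOf l' * addOrderOf k * z4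
          - (addOrderOf l' : ZMod T) * addOrderOf k * addOrderOf k' * z1
          + (addOrderOf l : ZMod T) * addOrderOf k * addOrderOf k' * z2)
      (by
        push_cast
        simp only [ZMod.natCast_zmod_val]
        exact sub_ne_zero.2 hne)
      (round (bet m θ k k') - round (bet m θ l l'))
    have hQ4 : (0:ℝ) < (Q:ℝ) ^ 4 := by
      have : (0:ℝ) < Q := by exact_mod_cast hQ
      positivity
    have e1 : (m:ℝ) * (((k.val:ℤ) - k'.val - (l.val - l'.val) : ℤ) : ℝ) / T
        - ((round (bet m θ k k') - round (bet m θ l l') : ℤ) : ℝ)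
        = (bet m θ k k' - round (bet m θ k k')) - (bet m θ l l' - round (bet m θ l l')) := by
      unfold bet; push_cast; ring
    rw [e1] at hs
    have e2 := abs_sub (bet m θ k k' - round (bet m θ k k')) (bet m θ l l' - round (bet m θ l l'))
    have e3 : 1 / (Q:ℝ) ^ 4 ≤ 1 / (q:ℝ) := by
      apply one_div_le_one_div_of_le _ hqle
      exact_mod_cast hqp
    have e4 : 1 / (2 * (Q:ℝ) ^ 4) + 1 / (2 * (Q:ℝ) ^ 4) = 1 / (Q:ℝ) ^ 4 := by field_simp; norm_num
    linarith
  · push Not at hb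
    exact ⟨0, fun k k' h1 h2 h3 _ => hb k k' h1 h2 h3⟩

noncomputable def SS (T Q m b : ℕ) [NeZero T] (n : ℕ) : ℂ :=
  ∑ k : ZMod T, (gT T Q k : ℂ) * e ((k.val:ℝ) * (m * n + b) / T)

lemma SS_eq (hT : Squarefree T) (m b n : ℕ) (hx : Nat.Coprime (m * n + b) T) :
    SS T Q m b n = (LT T Q : ℂ) := by
  rw [← S1 (Q := Q) hT _ hx, SS]
  refine Finset.sum_congr rfl fun k _ => ?_
  rw [char_eq]; push_cast; rfl

lemma SS_sq (m b n : ℕ) : ((‖SS T Q m b n‖ ^ 2 : ℝ) : ℂ) =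
    ∑ k : ZMod T, ∑ k' : ZMod T, (gT T Q k : ℂ) * (gT T Q k' : ℂ) *
      e (((k.val:ℝ) - k'.val) * (m * n + b) / T) := by
  have h1 : ((‖SS T Q m b n‖ ^ 2 : ℝ) : ℂ) = SS T Q m b n * (starRingEnd ℂ) (SS T Q m b n) := by
    rw [Complex.mul_conj, Complex.normSq_eq_norm_sq]
  rw [h1, SS, map_sum, Finset.sum_mul_sum]
  refine Finset.sum_congr rfl fun k _ => Finset.sum_congr rfl fun k' _ => ?_
  rw [map_mul, Complex.conj_ofReal, e_conj]
  have : e (((k.val:ℝ) - k'.val) * (m * n + b) / T)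
      = e ((k.val:ℝ) * (m * n + b) / T) * e (-((k'.val:ℝ) * (m * n + b) / T)) := by
    rw [← e_add]; congr 1; ring
  rw [this]; ring

lemma expand (m b N : ℕ) (u : ℕ → ℂ) (θ : ℝ) :
    ∑ n ∈ Finset.range N, u n * ((‖SS T Q m b n‖ ^ 2 : ℝ) : ℂ) * e (n * θ) =
    ∑ k : ZMod T, ∑ k' : ZMod T, (gT T Q k : ℂ) * (gT T Q k' : ℂ) * e (((k.val:ℝ) - k'.val) * b / T) *
      ∑ n ∈ Finset.range N, u n * e (n * bet m θ k k') := by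
  simp_rw [SS_sq, Finset.mul_sum, Finset.sum_mul]
  rw [Finset.sum_comm]
  refine Finset.sum_congr rfl fun k _ => ?_
  rw [Finset.sum_comm]
  refine Finset.sum_congr rfl fun k' _ => Finset.sum_congr rfl fun n _ => ?_
  have : e (((k.val:ℝ) - k'.val) * (m * n + b) / T) * e (n * θ)
     = e (((k.val:ℝ) - k'.val) * b / T) * e (n * bet m θ k k') := by
    rw [← e_add, ← e_add]; congr 1; unfold bet; ring
  linear_combination (u n * (gT T Q k : ℂ) * (gT T Q k' : ℂ)) * this

lemma sum_abs_sq (hT : Squarefree T) :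
    ∑ k : ZMod T, ∑ k' : ZMod T, |gT T Q k| * |gT T Q k'| ≤ (Q:ℝ) ^ 2 := by
  rw [← Finset.sum_mul_sum]
  have h := sum_abs_g (Q := Q) hT
  have h0 : 0 ≤ ∑ k, |gT T Q k| := Finset.sum_nonneg fun _ _ => abs_nonneg _
  nlinarith

lemma W_diff (hT : Squarefree T) (m b N : ℕ) (u : ℕ → ℂ) (B : ℝ)
    (hu : ∀ t : ℝ, ‖∑ n ∈ Finset.range N, u n * e (n * t)‖ ≤ B) (θ : ℝ) :
    ‖∑ n ∈ Finset.range N, u n * ((‖SS T Q m b n‖ ^ 2 : ℝ) : ℂ) * e (n * θ)‖ ≤ (Q:ℝ) ^ 2 * B := by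
  have hB : 0 ≤ B := le_trans (norm_nonneg _) (hu 0)
  rw [expand]
  calc _ ≤ ∑ k : ZMod T, ∑ k' : ZMod T, |gT T Q k| * |gT T Q k'| * B := by
        refine le_trans (norm_sum_le _ _) (Finset.sum_le_sum fun k _ => ?_)
        refine le_trans (norm_sum_le _ _) (Finset.sum_le_sum fun k' _ => ?_)
        rw [norm_mul, norm_mul, norm_mul, norm_e, Complex.norm_real, Complex.norm_real, mul_one,
          Real.norm_eq_abs, Real.norm_eq_abs]
        exact mul_le_mul_of_nonneg_left (hu _) (by positivity)
    _ = (∑ k : ZMod T, ∑ k' : ZMod T, |gT T Q k| * |gT T Q k'|) * B := by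
        simp_rw [Finset.sum_mul]
    _ ≤ _ := mul_le_mul_of_nonneg_right (sum_abs_sq hT) hB

lemma D_main (hT : Squarefree T) (m b N z : ℕ) (hm : Nat.Coprime m T) (hQ : 1 ≤ Q) (hz : 2 ≤ z)
    (hpz : ∀ p, p.Prime → p ∣ T → z ≤ p) (θ : ℝ) :
    ‖∑ n ∈ Finset.range N, ((‖SS T Q m b n‖ ^ 2 : ℝ) : ℂ) * e (n * θ)
      - (LT T Q : ℂ) * ∑ n ∈ Finset.range N, e (n * θ)‖ ≤
      N * (4 / ((z:ℝ) - 1) * LT T Q) + (Q:ℝ) ^ 6 := by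
  have hQ0 : (0:ℝ) < Q := by exact_mod_cast hQ
  obtain ⟨s, hs⟩ := ex_bad (Q := Q) m hm θ hQ
  have hz' : (0:ℝ) < (z:ℝ) - 1 := by
    have : (2:ℝ) ≤ z := by exact_mod_cast hz
    linarith
  have hL := LT_ge_one (T := T) hQ
  have h1 : ∑ n ∈ Finset.range N, ((‖SS T Q m b n‖ ^ 2 : ℝ) : ℂ) * e (n * θ) =
    ∑ k : ZMod T, ∑ k' : ZMod T, (gT T Q k : ℂ) * (gT T Q k' : ℂ) * e (((k.val:ℝ) - k'.val) * b / T) *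
      ∑ n ∈ Finset.range N, e (n * bet m θ k k') := by
    have := expand (T := T) (Q := Q) m b N (fun _ => 1) θ
    simpa using this
  have h2 : (LT T Q : ℂ) * ∑ n ∈ Finset.range N, e (n * θ) =
     ∑ k : ZMod T, ∑ k' : ZMod T, if k' = k then (gT T Q k : ℂ) * (gT T Q k' : ℂ) *
      e (((k.val:ℝ) - k'.val) * b / T) * ∑ n ∈ Finset.range N, e (n * bet m θ k k') else 0 := by
    simp only [Finset.sum_ite_eq', Finset.mem_univ, if_true]
    rw [← sum_g_sq (Q := Q) hT]
    push_cast
    rw [Finset.sum_mul]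
    refine Finset.sum_congr rfl fun k _ => ?_
    have : bet m θ k k = θ := by unfold bet; simp
    rw [this]
    simp only [sub_self, zero_mul, zero_div, e_zero]
    ring
  rw [h1, h2, ← Finset.sum_sub_distrib]
  have h3 : ∀ k k' : ZMod T, ‖(gT T Q k : ℂ) * (gT T Q k' : ℂ) * e (((k.val:ℝ) - k'.val) * b / T) *
      ∑ n ∈ Finset.range N, e (n * bet m θ k k') - (if k' = k then (gT T Q k : ℂ) * (gT T Q k' : ℂ) *
      e (((k.val:ℝ) - k'.val) * b / T) * ∑ n ∈ Finset.range N, e (n * bet m θ k k') else 0)‖ ≤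
      |gT T Q k| * |gT T Q k'| * (Q:ℝ) ^ 4 +
        (if s ≠ 0 ∧ k = k' + s then |gT T Q k'| * |gT T Q k| * N else 0) := by
    intro k k'
    have hnn : 0 ≤ (if s ≠ 0 ∧ k = k' + s then |gT T Q k'| * |gT T Q k| * (N:ℝ) else 0) := by
      split_ifs <;> positivity
    by_cases hk : k' = k
    · rw [if_pos hk, sub_self, norm_zero]
      positivity
    rw [if_neg hk, sub_zero, norm_mul, norm_mul, norm_mul, norm_e, Complex.norm_real,
      Complex.norm_real, mul_one, Real.norm_eq_abs, Real.norm_eq_abs]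
    by_cases g1 : gT T Q k = 0
    · rw [g1]; simp
    by_cases g2 : gT T Q k' = 0
    · rw [g2]; simp
    by_cases hd : k - k' = s
    · have hs0 : s ≠ 0 := by rw [← hd]; exact sub_ne_zero.2 (Ne.symm hk)
      rw [if_pos ⟨hs0, by rw [← hd]; ring⟩]
      have := geom_trivial N (fun n => n * bet m θ k k')
      have : |gT T Q k| * |gT T Q k'| * ‖∑ n ∈ Finset.range N, e (n * bet m θ k k')‖ ≤
        |gT T Q k| * |gT T Q k'| * N := mul_le_mul_of_nonneg_left this (by positivity)
      have : 0 ≤ |gT T Q k| * |gT T Q k'| * (Q:ℝ) ^ 4 := by positivity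
      linarith
    · have := geom_bound N (by positivity) (hs k k' (Ne.symm hk) g1 g2 hd)
      have e1 : 1 / (2 * (1 / (2 * (Q:ℝ) ^ 4))) = (Q:ℝ) ^ 4 := by field_simp
      rw [e1] at this
      have : |gT T Q k| * |gT T Q k'| * ‖∑ n ∈ Finset.range N, e (n * bet m θ k k')‖ ≤
        |gT T Q k| * |gT T Q k'| * (Q:ℝ) ^ 4 := mul_le_mul_of_nonneg_left this (by positivity)
      linarith
  calc _ ≤ ∑ k : ZMod T, ∑ k' : ZMod T, (|gT T Q k| * |gT T Q k'| * (Q:ℝ) ^ 4 +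
        (if s ≠ 0 ∧ k = k' + s then |gT T Q k'| * |gT T Q k| * N else 0)) := by
        refine le_trans (norm_sum_le _ _) (Finset.sum_le_sum fun k _ => ?_)
        rw [← Finset.sum_sub_distrib]
        exact le_trans (norm_sum_le _ _) (Finset.sum_le_sum fun k' _ => h3 k k')
    _ = (∑ k : ZMod T, ∑ k' : ZMod T, |gT T Q k| * |gT T Q k'|) * (Q:ℝ) ^ 4 +
        ∑ k' : ZMod T, ∑ k : ZMod T, (if s ≠ 0 ∧ k = k' + s then |gT T Q k'| * |gT T Q k| * N else 0) := by
        simp_rw [Finset.sum_add_distrib, Finset.sum_mul]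
        congr 1
        rw [Finset.sum_comm]
    _ ≤ (Q:ℝ) ^ 2 * (Q:ℝ) ^ 4 + N * (4 / ((z:ℝ) - 1) * LT T Q) := by
        gcongr
        · exact sum_abs_sq hT
        · by_cases hs0 : s = 0
          · simp only [hs0, ne_eq, not_true_eq_false, false_and, if_false, Finset.sum_const_zero]
            positivity
          · simp only [ne_eq, hs0, not_false_eq_true, true_and, Finset.sum_ite_eq', Finset.mem_univ, if_true]
            rw [← Finset.sum_mul, mul_comm]
            exact mul_le_mul_of_nonneg_left (S3 hT hz hpz s hs0) (by positivity)
    _ = _ := by ring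

lemma E_sq (N : ℕ) (R : Finset ℕ) (c : ℕ → ℂ) (n : ℕ) :
    ((‖∑ ξ ∈ R, c ξ * e (-((ξ:ℝ) * n / N))‖ ^ 2 : ℝ) : ℂ) =
    ∑ ξ ∈ R, ∑ η ∈ R, c ξ * (starRingEnd ℂ) (c η) * e (n * (((η:ℝ) - ξ) / N)) := by
  have h1 : ((‖∑ ξ ∈ R, c ξ * e (-((ξ:ℝ) * n / N))‖ ^ 2 : ℝ) : ℂ) =
      (∑ ξ ∈ R, c ξ * e (-((ξ:ℝ) * n / N))) * (starRingEnd ℂ) (∑ ξ ∈ R, c ξ * e (-((ξ:ℝ) * n / N))) := by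
    rw [Complex.mul_conj, Complex.normSq_eq_norm_sq]
  rw [h1, map_sum, Finset.sum_mul_sum]
  refine Finset.sum_congr rfl fun ξ _ => Finset.sum_congr rfl fun η _ => ?_
  rw [map_mul, e_conj]
  have : e (n * (((η:ℝ) - ξ) / N)) = e (-((ξ:ℝ) * n / N)) * e (- -((η:ℝ) * n / N)) := by
    rw [← e_add]; congr 1; ring
  rw [this]; ring

/-- the restriction inequality -/
lemma large_sieve (hT : Squarefree T) (m b N z : ℕ) (hm : Nat.Coprime m T) (hQ : 1 ≤ Q) (hz : 2 ≤ z)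
    (hpz : ∀ p, p.Prime → p ∣ T → z ≤ p) (w : ℕ → ℝ) (B : ℝ)
    (hw : ∀ t : ℝ, ‖∑ n ∈ Finset.range N, ((w n - 1 : ℝ) : ℂ) * e (n * t)‖ ≤ B)
    (R : Finset ℕ) (hR : R ⊆ Finset.range N) (c : ℕ → ℂ) (hc : ∀ ξ, ‖c ξ‖ ≤ 1) :
    ∑ n ∈ Finset.range N, w n * ‖SS T Q m b n‖ ^ 2 * ‖∑ ξ ∈ R, c ξ * e (-((ξ:ℝ) * n / N))‖ ^ 2 ≤
      R.card * (LT T Q * N) +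
        (R.card:ℝ) ^ 2 * (N * (4 / ((z:ℝ) - 1) * LT T Q) + (Q:ℝ) ^ 6 + (Q:ℝ) ^ 2 * B) := by
  have hL := LT_ge_one (T := T) hQ
  set Err := N * (4 / ((z:ℝ) - 1) * LT T Q) + (Q:ℝ) ^ 6 + (Q:ℝ) ^ 2 * B with hErr
  set W : ℝ → ℂ := fun θ => ∑ n ∈ Finset.range N, (w n : ℂ) * ((‖SS T Q m b n‖ ^ 2 : ℝ) : ℂ) * e (n * θ) with hW
  have hWθ : ∀ θ, ‖W θ - (LT T Q : ℂ) * ∑ n ∈ Finset.range N, e (n * θ)‖ ≤ Err := by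
    intro θ
    have h1 := D_main (Q := Q) hT m b N z hm hQ hz hpz θ
    have h2 := W_diff (Q := Q) hT m b N (fun n => ((w n - 1 : ℝ) : ℂ)) B hw θ
    have h3 : W θ - (LT T Q : ℂ) * ∑ n ∈ Finset.range N, e (n * θ) =
       (∑ n ∈ Finset.range N, ((‖SS T Q m b n‖ ^ 2 : ℝ) : ℂ) * e (n * θ)
      - (LT T Q : ℂ) * ∑ n ∈ Finset.range N, e (n * θ)) +
      ∑ n ∈ Finset.range N, ((w n - 1 : ℝ) : ℂ) * ((‖SS T Q m b n‖ ^ 2 : ℝ) : ℂ) * e (n * θ) := by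
      rw [sub_add_eq_add_sub, ← Finset.sum_add_distrib]
      congr 1
      refine Finset.sum_congr rfl fun n _ => ?_
      push_cast; ring
    rw [h3]
    exact le_trans (norm_add_le _ _) (by linarith)
  have hErr0 : 0 ≤ Err := le_trans (norm_nonneg _) (hWθ 0)
  have hpair : ∀ ξ ∈ R, ∀ η ∈ R, ‖W (((η:ℝ) - ξ) / N)‖ ≤ (if ξ = η then LT T Q * N else 0) + Err := by
    intro ξ hξ η hη
    have h := hWθ (((η:ℝ) - ξ) / N)
    split_ifs with he
    · have h1 := geom_trivial N (fun n => n * (((η:ℝ) - ξ) / N))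
      have h2 : ‖(LT T Q : ℂ) * ∑ n ∈ Finset.range N, e (n * (((η:ℝ) - ξ) / N))‖ ≤ LT T Q * N := by
        rw [norm_mul, Complex.norm_real, Real.norm_eq_abs, abs_of_pos (by linarith)]
        exact mul_le_mul_of_nonneg_left h1 (by linarith)
      have h3 := norm_sub_norm_le (W (((η:ℝ) - ξ) / N)) ((LT T Q : ℂ) * ∑ n ∈ Finset.range N, e (n * (((η:ℝ) - ξ) / N)))
      linarith
    · have hx := Finset.mem_range.1 (hR hξ)
      have hy := Finset.mem_range.1 (hR hη)
      have h0 := geom_zero (N := N) (by omega) ((η:ℤ) - ξ) (by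
        intro hd
        have := Int.eq_zero_of_abs_lt_dvd hd (by rw [abs_lt]; omega)
        omega)
      push_cast at h0
      rw [h0, mul_zero, sub_zero] at h
      linarith
  have hkey : ((∑ n ∈ Finset.range N, w n * ‖SS T Q m b n‖ ^ 2 * ‖∑ ξ ∈ R, c ξ * e (-((ξ:ℝ) * n / N))‖ ^ 2 : ℝ) : ℂ)
      = ∑ ξ ∈ R, ∑ η ∈ R, c ξ * (starRingEnd ℂ) (c η) * W (((η:ℝ) - ξ) / N) := by
    rw [Complex.ofReal_sum]
    simp_rw [Complex.ofReal_mul, E_sq, Finset.mul_sum, hW, Finset.mul_sum]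
    rw [Finset.sum_comm]
    refine Finset.sum_congr rfl fun k _ => ?_
    rw [Finset.sum_comm]
    refine Finset.sum_congr rfl fun k' _ => Finset.sum_congr rfl fun n _ => ?_
    ring
  calc _ ≤ ‖((∑ n ∈ Finset.range N, w n * ‖SS T Q m b n‖ ^ 2 * ‖∑ ξ ∈ R, c ξ * e (-((ξ:ℝ) * n / N))‖ ^ 2 : ℝ) : ℂ)‖ := by
        rw [Complex.norm_real]; exact le_abs_self _
    _ ≤ ∑ ξ ∈ R, ∑ η ∈ R, ((if ξ = η then LT T Q * N else 0) + Err) := by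
        rw [hkey]
        refine le_trans (norm_sum_le _ _) (Finset.sum_le_sum fun ξ hξ => ?_)
        refine le_trans (norm_sum_le _ _) (Finset.sum_le_sum fun η hη => ?_)
        rw [norm_mul, norm_mul, RCLike.norm_conj]
        have h1 := hc ξ
        have h2 := hc η
        have h3 : ‖c ξ‖ * ‖c η‖ ≤ 1 := mul_le_one₀ h1 (norm_nonneg _) h2
        refine le_trans ?_ (hpair ξ hξ η hη)
        exact mul_le_of_le_one_left (norm_nonneg _) h3
    _ = _ := by
        simp only [Finset.sum_add_distrib, Finset.sum_ite_eq, Finset.sum_const, nsmul_eq_mul]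
        rw [Finset.sum_ite_mem, Finset.inter_self, Finset.sum_const, nsmul_eq_mul]
        ring

end DMP


namespace DMP

/-- admissible weights: what we know about the main part of `a` -/
structure Adm (φ φ1 : ℝ → ℝ) (N m b : ℕ) (a : ℕ → ℝ) : Prop where
  nonneg : ∀ n, 0 ≤ a n
  supp : ∀ n, a n ≠ 0 → (N:ℝ) ^ (9/10 : ℝ) ≤ n ∧ n ≤ N / 2 ∧ (m * n + b).Prime ∧
    ∃ k : ℕ, |φ ((m * n + b : ℕ) : ℝ) - k| ≤ φ1 ((m * n + b : ℕ) : ℝ)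
  le : ∀ n, a n ≠ 0 → a n ≤ (Nat.totient m : ℝ) * Real.log ((m * n + b : ℕ) : ℝ) / (m * N) *
    (1 / φ1 ((m * n + b : ℕ) : ℝ))

lemma bracket (N L ρ Q y z : ℝ) (hN1 : 1 < N) (hN0 : 0 < N) (hρ1 : 1 ≤ ρ) (hL1 : 1 ≤ L)
    (hQ0 : 0 ≤ Q) (hQy : Q ≤ y) (hy : y = N ^ (1/200 : ℝ)) (f1 : 2 ≤ N ^ (3/100 : ℝ))
    (hRc : ρ ≤ N ^ (1/25 : ℝ)) (hz : z = 4 * ρ + 2) :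
    ρ * (L * N) + ρ ^ 2 * (N * (4 / (z - 1) * L) + Q ^ 6 + Q ^ 2 * N ^ (92/100 : ℝ))
      ≤ 3 * (ρ * L * N) := by
  have b1 : ρ * (4 / (z - 1)) ≤ 1 := by
    have : z = 4 * ρ + 2 := by exact hz
    rw [this, mul_div_assoc', div_le_one (by linarith)]
    linarith
  have b2 : Q ^ 6 ≤ N ^ (93/100 : ℝ) := by
    calc Q ^ 6 ≤ y ^ 6 := by gcongr
      _ = N ^ (6/200 : ℝ) := by rw [hy, ← Real.rpow_natCast, ← Real.rpow_mul hN0.le]; norm_num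
      _ ≤ _ := Real.rpow_le_rpow_of_exponent_le hN1.le (by norm_num)
  have b3 : Q ^ 2 * N ^ (92/100 : ℝ) ≤ N ^ (93/100 : ℝ) := by
    calc Q ^ 2 * N ^ (92/100 : ℝ) ≤ y ^ 2 * N ^ (92/100 : ℝ) := by gcongr
      _ = N ^ (2/200 : ℝ) * N ^ (92/100 : ℝ) := by
        rw [hy, ← Real.rpow_natCast, ← Real.rpow_mul hN0.le]; norm_num
      _ = _ := by rw [← Real.rpow_add hN0]; norm_num
  have b4 : ρ * (2 * N ^ (93/100 : ℝ)) ≤ N := by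
    calc ρ * (2 * N ^ (93/100 : ℝ)) ≤ N ^ (1/25 : ℝ) * (N ^ (3/100 : ℝ) * N ^ (93/100 : ℝ)) := by
          gcongr
      _ = N := by
        rw [← Real.rpow_add hN0, ← Real.rpow_add hN0]; norm_num
  have b5 : ρ ^ 2 * (N * (4 / (z - 1) * L)) ≤ ρ * L * N := by
    calc ρ ^ 2 * (N * (4 / (z - 1) * L)) = (ρ * (4 / (z - 1))) * (ρ * L * N) := by ring
      _ ≤ 1 * (ρ * L * N) := by gcongr
      _ = _ := one_mul _
  have b6 : ρ ^ 2 * (Q ^ 6 + Q ^ 2 * N ^ (92/100 : ℝ)) ≤ ρ * L * N := by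
    calc _ ≤ ρ ^ 2 * (N ^ (93/100 : ℝ) + N ^ (93/100 : ℝ)) := by gcongr
      _ = ρ * (ρ * (2 * N ^ (93/100 : ℝ))) := by ring
      _ ≤ ρ * N := by gcongr
      _ = ρ * 1 * N := by ring
      _ ≤ _ := by gcongr
  linarith

set_option maxHeartbeats 2000000 in
lemma restr_aux {φ φ1 φ2 : ℝ → ℝ} {γ X0 : ℝ} (h : PhiOK φ φ1 φ2 γ X0) (hγ : 15 / 16 < γ) :
    ∀ᶠ N : ℕ in atTop, ∀ m b : ℕ, 1 ≤ m → (m:ℝ) ≤ Real.log N → b ≤ m - 1 →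
    ∀ a : ℕ → ℝ, Adm φ φ1 N m b a → ∀ R : Finset ℕ, R ⊆ Finset.range N → R.Nonempty →
    (R.card : ℝ) ≤ (N:ℝ) ^ (1/25 : ℝ) → ∀ c : ℕ → ℂ, (∀ ξ, ‖c ξ‖ ≤ 1) →
    ∑ n ∈ Finset.range N, a n * ‖∑ ξ ∈ R, c ξ * e (-((ξ:ℝ) * n / N))‖ ^ 2 ≤
      307200 * Vz (4 * R.card + 2) * R.card := by
  filter_upwards [exists_maj h hγ, ev_const 2 (3/100) (by norm_num), ev_const 2 (1/400) (by norm_num),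
    ev_log 1 (by norm_num), eventually_ge_atTop 2] with N hmaj f1 f2 f3 hN2 m b hm hmN hb a ha R hR hRne hRc c hc
  obtain ⟨w, hw0, hw1, hw2⟩ := hmaj m b hm hmN hb
  have hN1 : (1:ℝ) < N := by exact_mod_cast (show 1 < N by omega)
  have hN0 : (0:ℝ) < N := by linarith
  have hlN : 0 < Real.log N := Real.log_pos hN1
  rw [Real.rpow_one] at f3
  set ρ : ℝ := (R.card : ℝ) with hρ
  have hρ1 : 1 ≤ ρ := by rw [hρ]; exact_mod_cast hRne.card_pos
  set y : ℝ := (N:ℝ) ^ (1/200 : ℝ) with hy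
  set Q : ℕ := ⌊y⌋₊ with hQdef
  have hy0 : 0 < y := Real.rpow_pos_of_pos hN0 _
  have hQy : (Q:ℝ) ≤ y := Nat.floor_le hy0.le
  have hyQ : y < Q + 1 := Nat.lt_floor_add_one y
  have hysq : y = ((N:ℝ) ^ (1/400 : ℝ)) ^ 2 := by
    rw [hy, ← Real.rpow_natCast, ← Real.rpow_mul hN0.le]; norm_num
  have hQ400 : (N:ℝ) ^ (1/400 : ℝ) ≤ Q := by nlinarith
  have hQ1 : 1 ≤ Q := by
    have : (1:ℝ) ≤ Q := by linarith
    exact_mod_cast this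
  have hlogQ : Real.log N ≤ 400 * Real.log Q := by
    have := Real.log_le_log (by positivity) hQ400
    rw [Real.log_rpow hN0] at this
    linarith
  have hlogQ0 : 0 < Real.log Q := by linarith
  set z := 4 * R.card + 2 with hz
  set T := Tz m z Q with hT
  have : NeZero T := ⟨(Tz_pos m z Q).ne'⟩
  have hTs : Squarefree T := Tz_sqfree m z Q
  have hpz : ∀ p, p.Prime → p ∣ T → z ≤ p := fun p hp hd =>
    (Finset.mem_filter.1 (prime_dvd_Tz hp hd)).2.1
  have LS := large_sieve (Q := Q) hTs m b N z (Tz_coprime_m m z Q) hQ1 (by omega) hpz w _ hw2 R hR c hc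
  have hL1 := LT_ge_one (T := T) hQ1
  set L := LT T Q with hL
  have hL0 : 0 < L := by linarith
  have hphi : (0:ℝ) < Nat.totient m := by exact_mod_cast Nat.totient_pos.2 (by omega)
  have hm0 : (0:ℝ) < m := by exact_mod_cast hm
  have hS4 := S4 m z Q hm
  rw [← hT, ← hL] at hS4
  have hcop : ∀ x : ℕ, x.Prime → Q < x → Nat.Coprime x T := fun x h1 h2 => prime_coprime_Tz m z Q x h1 h2
  have hSSL : ∀ n : ℕ, Nat.Coprime (m * n + b) T → ‖SS T Q m b n‖ = L := by
    intro n hn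
    rw [SS_eq (Q := Q) hTs m b n hn, Complex.norm_real, Real.norm_eq_abs, abs_of_pos hL0]
  have hzr : (z:ℝ) = 4 * ρ + 2 := by rw [hz, hρ]; push_cast; ring
  clear hpz
  clear_value L T z Q y
  have hV := Vz_pos z
  -- bounding the bracket
  have hbr : ρ * (L * N) + ρ ^ 2 * (N * (4 / ((z:ℝ) - 1) * L) + (Q:ℝ) ^ 6 + (Q:ℝ) ^ 2 * (N:ℝ) ^ (92/100 : ℝ))
      ≤ 3 * (ρ * L * N) :=
    bracket N L ρ Q y z hN1 hN0 hρ1 hL1 (Nat.cast_nonneg _) hQy hy f1 hRc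
      hzr
  set K := 128 * ((Nat.totient m : ℝ) / m) * Real.log N / (N * L ^ 2) with hK
  have hK0 : 0 ≤ K := by positivity
  have hpt : ∀ n ∈ Finset.range N, a n ≤ K * (w n * ‖SS T Q m b n‖ ^ 2) := by
    intro n hn
    by_cases ha0 : a n = 0
    · rw [ha0]; have := hw0 n; positivity
    obtain ⟨s1, s2, s3, k, s4⟩ := ha.supp n ha0
    have t1 := ha.le n ha0
    have t2 := hw1 n s1 s2 k s4
    have hxge : n ≤ m * n + b := by nlinarith
    have hQx : Q < m * n + b := by
      have : (Q:ℝ) < n := by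
        calc (Q:ℝ) ≤ y := hQy
          _ = (N:ℝ) ^ (1/200 : ℝ) := hy
          _ < (N:ℝ) ^ (9/10 : ℝ) := Real.rpow_lt_rpow_of_exponent_lt hN1 (by norm_num)
          _ ≤ n := s1
      have : Q < n := by exact_mod_cast this
      omega
    have hSn : ‖SS T Q m b n‖ = L := hSSL n (hcop _ s3 hQx)
    have hlog : Real.log ((m * n + b : ℕ) : ℝ) ≤ 2 * Real.log N := by
      have hmN' : m ≤ N := by exact_mod_cast hmN.trans f3
      have : m * n + b ≤ N ^ 2 := by
        have h1 : n + 1 ≤ N := by omega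
        calc m * n + b ≤ m * (n + 1) := by rw [mul_add]; omega
          _ ≤ N * N := Nat.mul_le_mul hmN' h1
          _ = N ^ 2 := by ring
      have h2 : ((m * n + b : ℕ) : ℝ) ≤ (N:ℝ) ^ 2 := by exact_mod_cast this
      have h3 := Real.log_le_log (by exact_mod_cast s3.pos) h2
      rw [Real.log_pow] at h3
      exact_mod_cast h3
    have hwn := hw0 n
    have hlog0 : 0 ≤ Real.log ((m * n + b : ℕ) : ℝ) := Real.log_natCast_nonneg _
    calc a n ≤ _ := t1
      _ ≤ (Nat.totient m : ℝ) * Real.log ((m * n + b : ℕ) : ℝ) / (m * N) * (64 * w n) := by gcongr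
      _ ≤ (Nat.totient m : ℝ) * (2 * Real.log N) / (m * N) * (64 * w n) := by gcongr
      _ = K * (w n * ‖SS T Q m b n‖ ^ 2) := by
        rw [hSn, hK]; field_simp; ring
  calc _ ≤ ∑ n ∈ Finset.range N, K * (w n * ‖SS T Q m b n‖ ^ 2 * ‖∑ ξ ∈ R, c ξ * e (-((ξ:ℝ) * n / N))‖ ^ 2) := by
        refine Finset.sum_le_sum fun n hn => ?_
        rw [← mul_assoc]
        exact mul_le_mul_of_nonneg_right (hpt n hn) (by positivity)
    _ ≤ K * (3 * (ρ * L * N)) := by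
        rw [← Finset.mul_sum]
        exact mul_le_mul_of_nonneg_left (LS.trans hbr) hK0
    _ = 384 * (((Nat.totient m : ℝ) / m) / L) * Real.log N * ρ := by
        rw [hK]; field_simp; ring
    _ ≤ 384 * (((Nat.totient m : ℝ) / m) / L) * (400 * (2 * (Vz z * ((m:ℝ) / Nat.totient m) * L))) * ρ := by
        gcongr
        linarith
    _ = 307200 * Vz z * ρ := by field_simp; ring

end DMP


namespace DMP

lemma plancherel (N : ℕ) (hN : 0 < N) (a : ℕ → ℝ) :
    ∑ ξ ∈ Finset.range N, ‖fourierZN N a ξ‖ ^ 2 = N * ∑ n ∈ Finset.range N, a n ^ 2 := by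
  have hN0 : (N:ℝ) ≠ 0 := by exact_mod_cast hN.ne'
  have h1 : ∀ ξ : ℕ, fourierZN N a ξ = ∑ n ∈ Finset.range N, (a n : ℂ) * e (-((n:ℝ) * ξ / N)) := by
    intro ξ
    unfold fourierZN
    refine Finset.sum_congr rfl fun n _ => ?_
    rw [mul_comm (ξ:ℝ)]
  have h2 : ((∑ ξ ∈ Finset.range N, ‖fourierZN N a ξ‖ ^ 2 : ℝ) : ℂ) = ((N * ∑ n ∈ Finset.range N, a n ^ 2 : ℝ) : ℂ) := by
    rw [Complex.ofReal_sum]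
    simp_rw [h1, E_sq, Complex.conj_ofReal]
    rw [Finset.sum_comm]
    push_cast
    rw [Finset.mul_sum]
    refine Finset.sum_congr rfl fun x hx => ?_
    rw [Finset.sum_comm]
    simp_rw [← Finset.mul_sum]
    rw [Finset.sum_eq_single x]
    · simp only [sub_self, zero_div, mul_zero, e_zero, Finset.sum_const, Finset.card_range, nsmul_eq_mul]
      ring
    · intro y hy hne
      have hx' := Finset.mem_range.1 hx
      have hy' := Finset.mem_range.1 hy
      have h0 := geom_zero (N := N) hN ((y:ℤ) - x) (by
        intro hd
        have := Int.eq_zero_of_abs_lt_dvd hd (by rw [abs_lt]; omega)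
        omega)
      push_cast at h0
      rw [h0, mul_zero]
    · intro h; exact absurd hx h
  exact_mod_cast h2

lemma ordered (f g : ℕ → ℝ) : ∀ (n : ℕ) (S : Finset ℕ), S.card = n →
    (∀ R ⊆ S, R.Nonempty → ∃ ξ ∈ R, f ξ ≤ g R.card) → ∑ ξ ∈ S, f ξ ≤ ∑ k ∈ Finset.range n, g (k + 1) := by
  intro n
  induction n with
  | zero => intro S hS _; rw [Finset.card_eq_zero.1 hS]; simp
  | succ n ih =>
    intro S hS h
    obtain ⟨ξ, hξ, hle⟩ := h S (Finset.Subset.refl S) (Finset.card_pos.1 (by omega))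
    rw [← Finset.add_sum_erase S f hξ, Finset.sum_range_succ]
    have := ih (S.erase ξ) (by rw [Finset.card_erase_of_mem hξ, hS]; rfl)
      (fun R hR hne => h R (hR.trans (Finset.erase_subset _ _)) hne)
    rw [hS] at hle
    linarith

lemma dual_phase (z : ℂ) : ∃ c : ℂ, ‖c‖ ≤ 1 ∧ c * z = (‖z‖ : ℂ) := by
  by_cases hz : z = 0
  · exact ⟨0, by simp, by simp [hz]⟩
  · refine ⟨(starRingEnd ℂ) z / (‖z‖ : ℂ), ?_, ?_⟩
    · have : ‖z‖ ≠ 0 := norm_ne_zero_iff.2 hz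
      rw [norm_div, RCLike.norm_conj, Complex.norm_real, norm_norm, div_self this]
    · have : (‖z‖ : ℂ) ≠ 0 := by exact_mod_cast norm_ne_zero_iff.2 hz
      rw [div_mul_eq_mul_div, div_eq_iff this, mul_comm, Complex.mul_conj, Complex.normSq_eq_norm_sq]
      push_cast; ring

lemma large_vals {φ φ1 φ2 : ℝ → ℝ} {γ X0 : ℝ} (h : PhiOK φ φ1 φ2 γ X0) (hγ : 15 / 16 < γ)
    (ε : ℝ) (hε : 0 < ε) :
    ∃ C > 0, ∀ᶠ N : ℕ in atTop, ∀ m b : ℕ, 1 ≤ m → (m:ℝ) ≤ Real.log N → b ≤ m - 1 →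
    ∀ a : ℕ → ℝ, Adm φ φ1 N m b a → (∑ n ∈ Finset.range N, a n ≤ C) ∧
    ∀ R : Finset ℕ, R ⊆ Finset.range N → R.Nonempty →
    (R.card : ℝ) ≤ (N:ℝ) ^ (1/25 : ℝ) →
    (∑ ξ ∈ R, ‖fourierZN N a ξ‖) ^ 2 ≤ C ^ 2 * (R.card:ℝ) ^ (1 + ε) := by
  obtain ⟨C0, hC0, hV⟩ := Vz_bound ε hε
  set C := 307200 * (C0 * 6 ^ ε) with hC
  have hCpos : 0 < C := by positivity
  refine ⟨C, hCpos, ?_⟩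
  filter_upwards [restr_aux h hγ, ev_const 1 (1/25) (by norm_num), eventually_ge_atTop 1]
    with N hN f1 hN1 m b hm hmN hb a ha
  have hmain : ∀ R : Finset ℕ, R ⊆ Finset.range N → R.Nonempty →
    (R.card : ℝ) ≤ (N:ℝ) ^ (1/25 : ℝ) → ∀ c : ℕ → ℂ, (∀ ξ, ‖c ξ‖ ≤ 1) →
    ∑ n ∈ Finset.range N, a n * ‖∑ ξ ∈ R, c ξ * e (-((ξ:ℝ) * n / N))‖ ^ 2 ≤ C * (R.card:ℝ) ^ (1 + ε) := by
    intro R hR hne hRc c hc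
    have h1 := hN m b hm hmN hb a ha R hR hne hRc c hc
    have hρ : (1:ℝ) ≤ R.card := by exact_mod_cast hne.card_pos
    have h2 := hV (4 * R.card + 2) (by omega)
    have h3 : ((4 * R.card + 2 : ℕ) : ℝ) ^ ε ≤ 6 ^ ε * (R.card:ℝ) ^ ε := by
      rw [← Real.mul_rpow (by norm_num) (by positivity)]
      apply Real.rpow_le_rpow (by positivity) _ hε.le
      push_cast; linarith
    calc _ ≤ _ := h1
      _ ≤ 307200 * (C0 * (6 ^ ε * (R.card:ℝ) ^ ε)) * R.card := by
        gcongr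
        exact h2.trans (mul_le_mul_of_nonneg_left h3 hC0.le)
      _ = _ := by
        rw [Real.rpow_add (by linarith), Real.rpow_one, hC]; ring
  have hsum : ∑ n ∈ Finset.range N, a n ≤ C := by
    have h1 := hmain {0} (by simp; omega) (by simp) (by simpa using f1) (fun _ => 1) (by simp)
    simpa [e_zero] using h1
  refine ⟨hsum, fun R hR hne hRc => ?_⟩
  choose c hc1 hc2 using fun ξ : ℕ => dual_phase (fourierZN N a ξ)
  have h1 := hmain R hR hne hRc c hc1
  set E : ℕ → ℝ := fun n => ‖∑ ξ ∈ R, c ξ * e (-((ξ:ℝ) * n / N))‖ with hE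
  have h2 : ∑ ξ ∈ R, ‖fourierZN N a ξ‖ ≤ ∑ n ∈ Finset.range N, a n * E n := by
    have h3 : ((∑ ξ ∈ R, ‖fourierZN N a ξ‖ : ℝ) : ℂ) =
        ∑ n ∈ Finset.range N, (a n : ℂ) * ∑ ξ ∈ R, c ξ * e (-((ξ:ℝ) * n / N)) := by
      rw [Complex.ofReal_sum]
      simp_rw [← hc2, fourierZN, Finset.mul_sum]
      rw [Finset.sum_comm]
      refine Finset.sum_congr rfl fun n _ => Finset.sum_congr rfl fun ξ _ => ?_
      ring
    calc ∑ ξ ∈ R, ‖fourierZN N a ξ‖ ≤ ‖((∑ ξ ∈ R, ‖fourierZN N a ξ‖ : ℝ) : ℂ)‖ := by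
          rw [Complex.norm_real]; exact le_abs_self _
      _ ≤ _ := by
          rw [h3]
          refine le_trans (norm_sum_le _ _) (Finset.sum_le_sum fun n _ => ?_)
          rw [norm_mul, Complex.norm_real, Real.norm_eq_abs, abs_of_nonneg (ha.nonneg n)]
  have h3 : (∑ n ∈ Finset.range N, a n * E n) ^ 2 ≤
      (∑ n ∈ Finset.range N, a n) * ∑ n ∈ Finset.range N, a n * E n ^ 2 := by
    have := Finset.sum_mul_sq_le_sq_mul_sq (Finset.range N) (fun n => Real.sqrt (a n)) (fun n => Real.sqrt (a n) * E n)
    simp_rw [mul_pow, ← mul_assoc, Real.mul_self_sqrt (ha.nonneg _), Real.sq_sqrt (ha.nonneg _)] at this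
    exact this
  have h4 : 0 ≤ ∑ ξ ∈ R, ‖fourierZN N a ξ‖ := Finset.sum_nonneg fun _ _ => norm_nonneg _
  calc _ ≤ (∑ n ∈ Finset.range N, a n * E n) ^ 2 := by gcongr
    _ ≤ _ := h3
    _ ≤ C * (C * (R.card:ℝ) ^ (1 + ε)) := by
      apply mul_le_mul hsum h1 _ hCpos.le
      exact Finset.sum_nonneg fun n _ => mul_nonneg (ha.nonneg n) (by positivity)
    _ = _ := by ring

end DMP


namespace DMP

variable {φ φ1 φ2 : ℝ → ℝ} {γ X0 : ℝ}

lemma deriv_bound (h : PhiOK φ φ1 φ2 γ X0) (hγ1 : γ ≤ 1) (ε : ℝ) (hε : 0 < ε) :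
    ∃ C > 0, ∀ x : ℕ, 1 ≤ x → |1 / deriv φ (x:ℝ)| ≤ C * (x:ℝ) ^ (1 - γ + ε) := by
  obtain ⟨c', hc', hlow⟩ := h.low ε hε
  set C3 := ∑ x ∈ Finset.range (⌈X0⌉₊ + 1), |1 / deriv φ ((x:ℕ):ℝ)| with hC3
  have hC3' : 0 ≤ C3 := Finset.sum_nonneg fun _ _ => abs_nonneg _
  refine ⟨1 / c' + C3, by positivity, fun x hx => ?_⟩
  have hx1 : (1:ℝ) ≤ x := by exact_mod_cast hx
  have hx0 : (0:ℝ) < x := by linarith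
  have hp1 : 1 ≤ (x:ℝ) ^ (1 - γ + ε) := Real.one_le_rpow hx1 (by linarith)
  by_cases hX : X0 ≤ x
  · rw [(h.d1 x hX).deriv]
    have h1 := hlow x hX
    have h2 := h.pos x hX
    rw [abs_of_pos (by positivity)]
    have h3 : (x:ℝ) ^ (1 - γ + ε) * (x:ℝ) ^ (γ - 1 - ε) = 1 := by
      rw [← Real.rpow_add hx0]; ring_nf; exact Real.rpow_zero _
    have h4 : 1 / φ1 x ≤ 1 / c' * (x:ℝ) ^ (1 - γ + ε) := by
      rw [div_le_iff₀ h2]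
      calc (1:ℝ) = 1 / c' * (x:ℝ) ^ (1 - γ + ε) * (c' * (x:ℝ) ^ (γ - 1 - ε)) := by
            rw [show 1 / c' * (x:ℝ) ^ (1 - γ + ε) * (c' * (x:ℝ) ^ (γ - 1 - ε)) =
              (1 / c' * c') * ((x:ℝ) ^ (1 - γ + ε) * (x:ℝ) ^ (γ - 1 - ε)) by ring, h3]
            field_simp
        _ ≤ _ := by gcongr
    nlinarith
  · push Not at hX
    have h1 : |1 / deriv φ (x:ℝ)| ≤ C3 := by
      rw [hC3]
      apply Finset.single_le_sum (f := fun x : ℕ => |1 / deriv φ ((x:ℕ):ℝ)|) (fun _ _ => abs_nonneg _)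
      rw [Finset.mem_range]
      have := hX.trans_le (Nat.le_ceil X0)
      have : x < ⌈X0⌉₊ := by exact_mod_cast this
      omega
    have : 0 < 1 / c' := by positivity
    nlinarith

lemma lamh_le {c : ℝ} (F : Fc c) (h : PhiOK φ φ1 φ2 γ X0) (hγ0 : 0 ≤ γ) (hγ1 : γ ≤ 1) (η : ℝ) (hη : 0 < η) :
    ∀ᶠ N : ℕ in atTop, ∀ m b : ℕ, 1 ≤ m → (m:ℝ) ≤ Real.log N → b ≤ m - 1 →
    ∀ n : ℕ, n ≤ N / 2 → |lamh F φ b m N n| ≤ (N:ℝ) ^ (η - γ) := by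
  set ε := min (η / 5) 1 with hε
  have hε0 : 0 < ε := by rw [hε]; apply lt_min; positivity; norm_num
  have hε1 : ε ≤ 1 := min_le_right _ _
  have hε5 : 5 * ε ≤ η := by
    have : ε ≤ η / 5 := min_le_left _ _
    linarith
  obtain ⟨C, hC, hd⟩ := deriv_bound h hγ1 ε hε0
  filter_upwards [ev_log ε hε0, ev_const (2 * C) ε hε0, eventually_ge_atTop 2]
    with N f1 f2 hN2 m b hm hmN hb n hn
  have hN1 : (1:ℝ) < N := by exact_mod_cast (show 1 < N by omega)
  have hN0 : (0:ℝ) < N := by linarith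
  unfold lamh
  split_ifs with hc
  · set x := m * n + b with hx
    have hxp : x.Prime := hc.2.1
    have hx1 : (1:ℝ) ≤ x := by exact_mod_cast hxp.one_lt.le
    have hm0 : (0:ℝ) < m := by exact_mod_cast hm
    have hphi : (Nat.totient m : ℝ) ≤ m := by exact_mod_cast Nat.totient_le m
    have hxN : (x:ℝ) ≤ (N:ℝ) ^ (1 + ε) := by
      have h1 : n + 1 ≤ N := by omega
      have h2 : x ≤ m * N := by
        calc x ≤ m * (n + 1) := by rw [hx, mul_add]; omega
          _ ≤ m * N := Nat.mul_le_mul_left _ h1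
      calc (x:ℝ) ≤ m * N := by exact_mod_cast h2
        _ ≤ (N:ℝ) ^ ε * N := by gcongr; linarith
        _ = _ := by rw [Real.rpow_add hN0, Real.rpow_one]; ring
    have hlogx : Real.log x ≤ 2 * (N:ℝ) ^ ε := by
      have h1 := Real.log_le_log (by linarith) hxN
      rw [Real.log_rpow hN0] at h1
      have : 0 < Real.log N := Real.log_pos hN1
      nlinarith
    have hlogx0 : 0 ≤ Real.log x := Real.log_nonneg hx1
    have hxe : (x:ℝ) ^ (1 - γ + ε) ≤ (N:ℝ) ^ ((1 + ε) * (1 - γ + ε)) := by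
      rw [Real.rpow_mul hN0.le]
      exact Real.rpow_le_rpow (by positivity) hxN (by linarith)
    have hcast : ((m:ℝ) * n + b) = (x:ℝ) := by rw [hx]; push_cast; ring
    rw [hcast]
    have e1 : (Nat.totient m : ℝ) * Real.log x / (m * N * deriv φ (x:ℝ)) =
      ((Nat.totient m : ℝ) / m) * (Real.log x / N) * (1 / deriv φ (x:ℝ)) := by
      rw [div_mul_div_comm, div_mul_div_comm, mul_one]
    rw [e1, abs_mul, abs_of_nonneg (by positivity)]
    have e2 : (Nat.totient m : ℝ) / m ≤ 1 := (div_le_one hm0).2 hphi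
    calc ((Nat.totient m : ℝ) / m) * (Real.log x / N) * |1 / deriv φ (x:ℝ)|
        ≤ 1 * (2 * (N:ℝ) ^ ε / N) * (C * (N:ℝ) ^ ((1 + ε) * (1 - γ + ε))) := by
          gcongr
          exact (hd x hxp.one_lt.le).trans (by gcongr)
      _ = (2 * C) * ((N:ℝ) ^ ε * (N:ℝ) ^ ((1 + ε) * (1 - γ + ε)) * (N:ℝ) ^ (-1:ℝ)) := by
          rw [Real.rpow_neg_one]; field_simp
      _ ≤ (N:ℝ) ^ ε * ((N:ℝ) ^ ε * (N:ℝ) ^ ((1 + ε) * (1 - γ + ε)) * (N:ℝ) ^ (-1:ℝ)) := by gcongr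
      _ = (N:ℝ) ^ (ε + (ε + (1 + ε) * (1 - γ + ε) + -1)) := by
          rw [Real.rpow_add hN0, Real.rpow_add hN0, Real.rpow_add hN0]
      _ ≤ _ := by
          apply Real.rpow_le_rpow_of_exponent_le hN1.le
          nlinarith
  · rw [abs_zero]; positivity

lemma adm {c : ℝ} (F : Fc c) (h : PhiOK φ φ1 φ2 γ X0) (hX : F.toFun F.x₀ ≤ X0)
    (hφ₁ : ∀ x ≥ F.x₀, φ (F.toFun x) = x)
    (hφ₂ : ∀ y ≥ F.toFun F.x₀, F.toFun (φ y) = y)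
    (hφ₃ : ∀ y ≥ F.toFun F.x₀, F.x₀ ≤ φ y) :
    ∀ᶠ N : ℕ in atTop, ∀ m b : ℕ, 1 ≤ m →
    ∀ A : Finset ℕ, A ⊆ Finset.Icc 1 (N / 2) →
    Adm φ φ1 N m b (fun n => if (N:ℝ) ^ (9/10 : ℝ) ≤ n then (if n ∈ A then lamh F φ b m N n else 0) else 0) := by
  filter_upwards [ev_const X0 (9/10) (by norm_num), eventually_ge_atTop 2] with N f1 hN2 m b hm A hA
  have hN0 : (0:ℝ) < N := by exact_mod_cast (show 0 < N by omega)
  have hm0 : (0:ℝ) < m := by exact_mod_cast hm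
  have hX0 : ∀ n : ℕ, (N:ℝ) ^ (9/10 : ℝ) ≤ n → X0 ≤ ((m * n + b : ℕ) : ℝ) := by
    intro n hn
    have : n ≤ m * n + b := by nlinarith
    have : (n:ℝ) ≤ ((m * n + b : ℕ) : ℝ) := by exact_mod_cast this
    linarith
  have key : ∀ n : ℕ, (N:ℝ) ^ (9/10 : ℝ) ≤ n → lamh F φ b m N n ≠ 0 → m * n + b ∈ Ph F := by
    intro n _ h0
    by_contra h'
    exact h0 (by rw [lamh, if_neg (fun h => h' h.2)])
  have hval : ∀ n : ℕ, (N:ℝ) ^ (9/10 : ℝ) ≤ n → m * n + b ∈ Ph F → n ≤ N → lamh F φ b m N n =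
      (Nat.totient m : ℝ) * Real.log ((m * n + b : ℕ) : ℝ) / (m * N) * (1 / φ1 ((m * n + b : ℕ) : ℝ)) := by
    intro n hn hp hnN
    rw [lamh, if_pos ⟨hnN, hp⟩, (h.d1 _ (hX0 n hn)).deriv, div_mul_div_comm, mul_one]
    push_cast; rfl
  constructor
  · intro n
    split_ifs with h1 h2
    · by_cases h0 : lamh F φ b m N n = 0
      · rw [h0]
      · have := Finset.mem_Icc.1 (hA h2)
        rw [hval n h1 (key n h1 h0) (by omega)]
        have := h.pos _ (hX0 n h1)
        have := Real.log_natCast_nonneg (m * n + b)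
        positivity
    · exact le_rfl
    · exact le_rfl
  · intro n hn
    split_ifs at hn with h1 h2
    · have h3 := Finset.mem_Icc.1 (hA h2)
      have hp := key n h1 hn
      refine ⟨h1, h3.2, hp.1, ?_⟩
      obtain ⟨k, k1, k2⟩ := Ph_near F φ h hX hφ₁ hφ₂ hφ₃ hp (hX0 n h1)
      refine ⟨k, ?_⟩
      rw [abs_sub_comm, abs_of_nonneg k1]
      exact k2
    · exact absurd rfl hn
    · exact absurd rfl hn
  · intro n hn
    split_ifs at hn ⊢ with h1 h2
    · have h3 := Finset.mem_Icc.1 (hA h2)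
      exact (hval n h1 (key n h1 hn) (by omega)).le
    · exact absurd rfl hn
    · exact absurd rfl hn

end DMP


namespace DMP

lemma sum_le_zeta (σ : ℝ) (hσ : 1 < σ) : ∃ Z > 0, ∀ n : ℕ,
    ∑ k ∈ Finset.range n, ((k + 1 : ℕ) : ℝ) ^ (-σ) ≤ Z := by
  have h1 : Summable (fun k : ℕ => (k : ℝ) ^ (-σ)) := Real.summable_nat_rpow.2 (by linarith)
  have h2 : Summable (fun k : ℕ => ((k + 1 : ℕ) : ℝ) ^ (-σ)) := (summable_nat_add_iff 1).2 h1
  refine ⟨∑' k : ℕ, ((k + 1 : ℕ) : ℝ) ^ (-σ) + 1, ?_, fun n => ?_⟩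
  · have : 0 ≤ ∑' k : ℕ, ((k + 1 : ℕ) : ℝ) ^ (-σ) := tsum_nonneg fun k => by positivity
    linarith
  · have := h2.sum_le_tsum (Finset.range n) (fun k _ => by positivity)
    linarith

lemma concl (N K : ℕ) (f f1 : ℕ → ℝ) (hf : ∀ ξ, 0 ≤ f ξ) (C1 ε r δ Z Ct : ℝ) (hC1 : 0 < C1)
    (hr : 2 < r) (hδ : 0 < δ)
    (hd : ∀ ξ, f ξ ≤ f1 ξ + δ / 2)
    (hlv : ∀ R : Finset ℕ, R ⊆ Finset.range N → R.Nonempty → R.card ≤ K →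
      (∑ ξ ∈ R, f1 ξ) ^ 2 ≤ C1 ^ 2 * (R.card:ℝ) ^ (1 + ε))
    (hK : 1 ≤ K) (hK2 : C1 ^ 2 * (K:ℝ) ^ (1 + ε) < (K * (δ / 2)) ^ 2)
    (hZ : ∀ n : ℕ, ∑ k ∈ Finset.range n, ((k + 1 : ℕ) : ℝ) ^ (-((1 - ε) / 2 * r)) ≤ Z)
    (ht : δ ^ (r - 2) * ∑ ξ ∈ Finset.range N, f ξ ^ 2 ≤ Ct) :
    ∑ ξ ∈ Finset.range N, f ξ ^ r ≤ (2 * C1) ^ r * Z + Ct := by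
  set S := (Finset.range N).filter (fun ξ => δ ≤ f ξ) with hS
  have hSN : S ⊆ Finset.range N := Finset.filter_subset _ _
  have hSf : ∀ ξ ∈ S, δ ≤ f ξ := fun ξ hξ => (Finset.mem_filter.1 hξ).2
  have hcard : S.card ≤ K := by
    by_contra hlt
    push Not at hlt
    obtain ⟨R, hRS, hRc⟩ := Finset.exists_subset_card_eq hlt.le
    have h1 := hlv R (hRS.trans hSN) (Finset.card_pos.1 (by omega)) hRc.le
    rw [hRc] at h1
    have h2 : (K:ℝ) * (δ / 2) ≤ ∑ ξ ∈ R, f1 ξ := by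
      rw [← hRc, ← nsmul_eq_mul]
      apply Finset.card_nsmul_le_sum
      intro ξ hξ
      have := hd ξ
      have := hSf ξ (hRS hξ)
      linarith
    have h3 : ((K:ℝ) * (δ / 2)) ^ 2 ≤ (∑ ξ ∈ R, f1 ξ) ^ 2 := by gcongr
    linarith
  have hmain : ∑ ξ ∈ S, f ξ ^ r ≤ (2 * C1) ^ r * Z := by
    have h1 := ordered (fun ξ => f ξ ^ r) (fun k => (2 * C1) ^ r * (k:ℝ) ^ (-((1 - ε) / 2 * r))) S.card S rfl ?_
    · refine h1.trans ?_
      rw [← Finset.mul_sum]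
      exact mul_le_mul_of_nonneg_left (hZ _) (by positivity)
    · intro R hR hne
      have hρ : (1:ℝ) ≤ R.card := by exact_mod_cast hne.card_pos
      have hρ0 : (0:ℝ) < R.card := by linarith
      set ρ : ℝ := (R.card : ℝ) with hρd
      have h2 := hlv R (hR.trans hSN) hne ((Finset.card_le_card hR).trans hcard)
      have h3 : ∃ ξ ∈ R, f ξ ≤ 2 * (C1 * ρ ^ (-((1 - ε) / 2))) := by
        by_contra hcon
        push Not at hcon
        have h4 : ρ * (C1 * ρ ^ (-((1 - ε) / 2))) < ∑ ξ ∈ R, f1 ξ := by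
          rw [hρd, ← nsmul_eq_mul, ← Finset.sum_const]
          apply Finset.sum_lt_sum_of_nonempty hne
          intro ξ hξ
          have := hd ξ
          have := hSf ξ (hR hξ)
          have := hcon ξ hξ
          linarith
        have h5 : (ρ * (C1 * ρ ^ (-((1 - ε) / 2)))) ^ 2 < (∑ ξ ∈ R, f1 ξ) ^ 2 := by gcongr
        have h6 : (ρ * (C1 * ρ ^ (-((1 - ε) / 2)))) ^ 2 = C1 ^ 2 * ρ ^ (1 + ε) := by
          have h7 : ρ ^ (1 + ε) = ρ ^ 2 * (ρ ^ (-((1 - ε) / 2))) ^ 2 := by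
            rw [← Real.rpow_natCast, ← Real.rpow_natCast, ← Real.rpow_mul hρ0.le, ← Real.rpow_add hρ0]
            congr 1; push_cast; ring
          rw [h7]; ring
        linarith
      obtain ⟨ξ, hξ, hle⟩ := h3
      refine ⟨ξ, hξ, ?_⟩
      calc f ξ ^ r ≤ (2 * (C1 * ρ ^ (-((1 - ε) / 2)))) ^ r := Real.rpow_le_rpow (hf ξ) hle (by linarith)
        _ = _ := by
          rw [← mul_assoc, Real.mul_rpow (by positivity) (by positivity), ← Real.rpow_mul hρ0.le]
          congr 2; ring
  have htail : ∑ ξ ∈ (Finset.range N).filter (fun ξ => ¬ δ ≤ f ξ), f ξ ^ r ≤ Ct := by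
    refine le_trans ?_ ht
    rw [Finset.mul_sum]
    refine le_trans ?_ (Finset.sum_le_sum_of_subset_of_nonneg (Finset.filter_subset (fun ξ => ¬ δ ≤ f ξ) _) ?_)
    · refine Finset.sum_le_sum fun ξ hξ => ?_
      have h1 := (Finset.mem_filter.1 hξ).2
      push Not at h1
      have h2 : f ξ ^ r = f ξ ^ (r - 2) * f ξ ^ 2 := by
        rw [← Real.rpow_natCast, ← Real.rpow_add_of_nonneg (hf ξ) (by linarith) (by norm_num)]
        congr 1; push_cast; ring
      rw [h2]
      apply mul_le_mul_of_nonneg_right _ (by positivity)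
      exact Real.rpow_le_rpow (hf ξ) h1.le (by linarith)
    · intros; positivity
  rw [← Finset.sum_filter_add_sum_filter_not (Finset.range N) (fun ξ => δ ≤ f ξ)]
  linarith

lemma small_N {c : ℝ} (F : Fc c) (φ : ℝ → ℝ) (r : ℝ) (hr : 0 < r) (N : ℕ) :
    ∃ C > 0, ∀ m b : ℕ, 1 ≤ m → (m : ℝ) ≤ Real.log N → b ≤ m - 1 → ∀ A : Finset ℕ,
      ∑ ξ ∈ Finset.range N,
        ‖fourierZN N (fun n => if n ∈ A then lamh F φ b m N n else 0) ξ‖ ^ r ≤ C := by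
  set M : ℝ := ∑ m ∈ Finset.range (N + 1), ∑ b ∈ Finset.range (N + 1), ∑ n ∈ Finset.range N, |lamh F φ b m N n| with hM
  have hM0 : 0 ≤ M := Finset.sum_nonneg fun _ _ => Finset.sum_nonneg fun _ _ => Finset.sum_nonneg fun _ _ => abs_nonneg _
  refine ⟨N * M ^ r + 1, by positivity, fun m b hm hmN hb A => ?_⟩
  have hmN' : m ≤ N := by
    have : (m:ℝ) ≤ N := hmN.trans (Real.log_le_self (Nat.cast_nonneg _))
    exact_mod_cast this
  have h1 : ∀ ξ, ‖fourierZN N (fun n => if n ∈ A then lamh F φ b m N n else 0) ξ‖ ≤ M := by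
    intro ξ
    calc _ ≤ ∑ n ∈ Finset.range N, |lamh F φ b m N n| := by
          unfold fourierZN
          refine le_trans (norm_sum_le _ _) (Finset.sum_le_sum fun n _ => ?_)
          rw [norm_mul, norm_e, mul_one, Complex.norm_real, Real.norm_eq_abs]
          beta_reduce
          split_ifs
          · exact le_rfl
          · rw [abs_zero]; exact abs_nonneg _
      _ ≤ ∑ b ∈ Finset.range (N + 1), ∑ n ∈ Finset.range N, |lamh F φ b m N n| :=
          Finset.single_le_sum (f := fun b => ∑ n ∈ Finset.range N, |lamh F φ b m N n|)
            (fun _ _ => Finset.sum_nonneg fun _ _ => abs_nonneg _) (Finset.mem_range.2 (by omega))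
      _ ≤ M := Finset.single_le_sum (f := fun m => ∑ b ∈ Finset.range (N + 1), ∑ n ∈ Finset.range N, |lamh F φ b m N n|)
            (fun _ _ => Finset.sum_nonneg fun _ _ => Finset.sum_nonneg fun _ _ => abs_nonneg _) (Finset.mem_range.2 (by omega))
  calc _ ≤ ∑ ξ ∈ Finset.range N, M ^ r := Finset.sum_le_sum fun ξ _ => Real.rpow_le_rpow (norm_nonneg _) (h1 ξ) hr.le
    _ = N * M ^ r := by simp
    _ ≤ _ := by linarith

end DMP


namespace DMP

lemma numK (C1 ε : ℝ) (hε : ε ≤ 1 / 20) (N : ℕ) (hN1 : (1:ℝ) < N)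
    (f1 : 2 ≤ (N:ℝ) ^ (1/25 : ℝ)) (f2 : 8 * C1 ^ 2 + 1 ≤ (N:ℝ) ^ (1/500 : ℝ)) :
    1 ≤ ⌊(N:ℝ) ^ (1/25 : ℝ)⌋₊ ∧ C1 ^ 2 * (⌊(N:ℝ) ^ (1/25 : ℝ)⌋₊ : ℝ) ^ (1 + ε) <
      ((⌊(N:ℝ) ^ (1/25 : ℝ)⌋₊ : ℝ) * ((N:ℝ) ^ (-(1/56) : ℝ) / 2)) ^ 2 := by
  have hN0 : (0:ℝ) < N := by linarith
  set y := (N:ℝ) ^ (1/25 : ℝ) with hy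
  have hfl : y < ⌊y⌋₊ + 1 := Nat.lt_floor_add_one y
  set K := ⌊y⌋₊ with hK
  have hK1 : (1:ℝ) ≤ K := by
    have : 1 ≤ K := by rw [hK]; exact Nat.le_floor (by push_cast; linarith)
    exact_mod_cast this
  refine ⟨by exact_mod_cast hK1, ?_⟩
  have hK0 : (0:ℝ) < K := by linarith
  have hKy : y / 2 ≤ K := by linarith
  have e1 : (K:ℝ) ^ 2 = (K:ℝ) ^ (1 + ε) * (K:ℝ) ^ (1 - ε) := by
    rw [← Real.rpow_add hK0, ← Real.rpow_natCast]; congr 1; push_cast; ring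
  have e2 : (N:ℝ) ^ (19/500 : ℝ) / 2 ≤ (K:ℝ) ^ (1 - ε) := by
    calc (N:ℝ) ^ (19/500 : ℝ) / 2 = y ^ (19/20 : ℝ) / 2 := by
          rw [hy, ← Real.rpow_mul hN0.le]; norm_num
      _ ≤ y ^ (19/20 : ℝ) / 2 ^ (19/20 : ℝ) := by
          gcongr
          calc (2:ℝ) ^ (19/20 : ℝ) ≤ 2 ^ (1:ℝ) := Real.rpow_le_rpow_of_exponent_le (by norm_num) (by norm_num)
            _ = 2 := Real.rpow_one _
      _ = (y / 2) ^ (19/20 : ℝ) := by rw [Real.div_rpow (by positivity) (by norm_num)]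
      _ ≤ (K:ℝ) ^ (19/20 : ℝ) := Real.rpow_le_rpow (by positivity) hKy (by norm_num)
      _ ≤ _ := Real.rpow_le_rpow_of_exponent_le hK1 (by linarith)
  have e3 : ((N:ℝ) ^ (-(1/56) : ℝ)) ^ 2 = (N:ℝ) ^ (-(1/28) : ℝ) := by
    rw [← Real.rpow_natCast, ← Real.rpow_mul hN0.le]; norm_num
  have e4 : (N:ℝ) ^ (1/500 : ℝ) ≤ (N:ℝ) ^ (19/500 : ℝ) * (N:ℝ) ^ (-(1/28) : ℝ) := by
    rw [← Real.rpow_add hN0]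
    exact Real.rpow_le_rpow_of_exponent_le hN1.le (by norm_num)
  have e5 : 0 < (K:ℝ) ^ (1 + ε) := by positivity
  have e6 : 0 < (N:ℝ) ^ (-(1/28) : ℝ) := by positivity
  calc C1 ^ 2 * (K:ℝ) ^ (1 + ε) < ((N:ℝ) ^ (19/500 : ℝ) / 2 * (N:ℝ) ^ (-(1/28) : ℝ) / 4) * (K:ℝ) ^ (1 + ε) := by
        apply mul_lt_mul_of_pos_right _ e5
        linarith
    _ ≤ ((K:ℝ) ^ (1 - ε) * (N:ℝ) ^ (-(1/28) : ℝ) / 4) * (K:ℝ) ^ (1 + ε) := by gcongr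
    _ = _ := by
      rw [mul_pow, div_pow, e3, e1]; ring

lemma big_N {c : ℝ} (F : Fc c) {φ φ1 φ2 : ℝ → ℝ} {γ X0 : ℝ} (h : PhiOK φ φ1 φ2 γ X0)
    (hX : F.toFun F.x₀ ≤ X0) (hγ : 15 / 16 < γ) (hγ1 : γ ≤ 1)
    (hφ₁ : ∀ x ≥ F.x₀, φ (F.toFun x) = x)
    (hφ₂ : ∀ y ≥ F.toFun F.x₀, F.toFun (φ y) = y)
    (hφ₃ : ∀ y ≥ F.toFun F.x₀, F.x₀ ≤ φ y)
    (r : ℝ) (hr2 : 2 < r) (hr : 1 - γ < (r - 2) / 56) :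
    ∃ C > 0, ∀ᶠ N : ℕ in atTop, ∀ m b : ℕ, 1 ≤ m → (m : ℝ) ≤ Real.log N → b ≤ m - 1 →
      ∀ A : Finset ℕ, A ⊆ Finset.Icc 1 (N / 2) →
      ∑ ξ ∈ Finset.range N,
        ‖fourierZN N (fun n => if n ∈ A then lamh F φ b m N n else 0) ξ‖ ^ r ≤ C := by
  set ε := min ((1 - 2 / r) / 2) (1 / 20) with hε
  have hr0 : 0 < r := by linarith
  have h2r : 2 / r < 1 := (div_lt_one hr0).2 hr2
  have hε0 : 0 < ε := lt_min (by linarith) (by norm_num)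
  have hε1 : ε ≤ 1 / 20 := min_le_right _ _
  have hε2 : ε ≤ (1 - 2 / r) / 2 := min_le_left _ _
  have hσ : 1 < (1 - ε) / 2 * r := by
    have : (1 - (1 - 2 / r) / 2) / 2 * r = r / 4 + 1 / 2 := by field_simp; ring
    nlinarith
  obtain ⟨Z, hZ0, hZ⟩ := sum_le_zeta _ hσ
  obtain ⟨C1, hC1, hlv⟩ := large_vals h hγ ε hε0
  set η := (r - 2) / 56 - (1 - γ) with hη
  have hη0 : 0 < η := by rw [hη]; linarith
  refine ⟨(2 * C1) ^ r * Z + (C1 + 1), by positivity, ?_⟩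
  filter_upwards [hlv, adm F h hX hφ₁ hφ₂ hφ₃, lamh_le F h (by linarith) hγ1 η hη0,
    lamh_le F h (by linarith) hγ1 (1/200) (by norm_num), ev_const 4 (1/100) (by norm_num),
    ev_const 2 (1/25) (by norm_num), ev_const (8 * C1 ^ 2 + 1) (1/500) (by norm_num), eventually_ge_atTop 2]
    with N g1 g2 g3 g4 g5 g6 g7 hN2 m b hm hmN hb A hA
  have hN1 : (1:ℝ) < N := by exact_mod_cast (show 1 < N by omega)
  have hN0 : (0:ℝ) < N := by linarith
  set a : ℕ → ℝ := fun n => if n ∈ A then lamh F φ b m N n else 0 with ha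
  set a1 : ℕ → ℝ := fun n => if (N:ℝ) ^ (9/10 : ℝ) ≤ n then a n else 0 with ha1
  have hadm : Adm φ φ1 N m b a1 := g2 m b hm A hA
  obtain ⟨k1, k2⟩ := g1 m b hm hmN hb a1 hadm
  obtain ⟨n1, n2⟩ := numK C1 ε hε1 N hN1 g6 g7
  have hamax : ∀ M : ℝ, 0 ≤ M → (∀ n ≤ N / 2, |lamh F φ b m N n| ≤ M) → ∀ n, |a n| ≤ M := by
    intro M hM h n
    simp only [ha]
    split_ifs with h1
    · exact h n (Finset.mem_Icc.1 (hA h1)).2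
    · rwa [abs_zero]
  have m1 := hamax _ (by positivity) (g3 m b hm hmN hb)
  have m2 := hamax _ (by positivity) (g4 m b hm hmN hb)
  -- the short part
  have hshort : ∑ n ∈ Finset.range N, |a n - a1 n| ≤ (N:ℝ) ^ (-(1/56) : ℝ) / 2 := by
    have s1 : ∀ n ∈ Finset.range N, |a n - a1 n| ≤
        if n ∈ Finset.range (⌊(N:ℝ) ^ (9/10 : ℝ)⌋₊ + 1) then (N:ℝ) ^ (1/200 - γ) else 0 := by
      intro n _
      simp only [ha1]
      by_cases hc : (N:ℝ) ^ (9/10 : ℝ) ≤ n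
      · rw [if_pos hc, sub_self, abs_zero]
        split_ifs <;> positivity
      · rw [if_neg hc, sub_zero, if_pos]
        · exact m2 n
        · push Not at hc
          rw [Finset.mem_range, Nat.lt_add_one_iff]
          exact Nat.le_floor hc.le
    have hone : (1:ℝ) ≤ (N:ℝ) ^ (9/10 : ℝ) := Real.one_le_rpow hN1.le (by norm_num)
    calc _ ≤ ∑ n ∈ Finset.range N, (if n ∈ Finset.range (⌊(N:ℝ) ^ (9/10 : ℝ)⌋₊ + 1) then (N:ℝ) ^ (1/200 - γ) else 0) :=
          Finset.sum_le_sum s1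
      _ = ∑ n ∈ Finset.range N ∩ Finset.range (⌊(N:ℝ) ^ (9/10 : ℝ)⌋₊ + 1), (N:ℝ) ^ (1/200 - γ) := by
          rw [Finset.sum_ite_mem]
      _ ≤ ∑ n ∈ Finset.range (⌊(N:ℝ) ^ (9/10 : ℝ)⌋₊ + 1), (N:ℝ) ^ (1/200 - γ) :=
          Finset.sum_le_sum_of_subset_of_nonneg Finset.inter_subset_right (fun _ _ _ => by positivity)
      _ = (⌊(N:ℝ) ^ (9/10 : ℝ)⌋₊ + 1) * (N:ℝ) ^ (1/200 - γ) := by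
          rw [Finset.sum_const, Finset.card_range, nsmul_eq_mul]; push_cast; ring
      _ ≤ (2 * (N:ℝ) ^ (9/10 : ℝ)) * (N:ℝ) ^ (1/200 - 15/16 : ℝ) := by
          have := Nat.floor_le (show 0 ≤ (N:ℝ) ^ (9/10 : ℝ) by positivity)
          gcongr
          · linarith
          · exact hN1.le
      _ = 4 * ((N:ℝ) ^ (9/10 : ℝ) * (N:ℝ) ^ (1/200 - 15/16 : ℝ)) / 2 := by ring
      _ ≤ (N:ℝ) ^ (1/100 : ℝ) * ((N:ℝ) ^ (9/10 : ℝ) * (N:ℝ) ^ (1/200 - 15/16 : ℝ)) / 2 := by gcongr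
      _ ≤ _ := by
          rw [← Real.rpow_add hN0, ← Real.rpow_add hN0]
          gcongr
          · exact hN1.le
          · norm_num
  have hδ1 : (N:ℝ) ^ (-(1/56) : ℝ) ≤ 1 := Real.rpow_le_one_of_one_le_of_nonpos hN1.le (by norm_num)
  have hδ0 : 0 < (N:ℝ) ^ (-(1/56) : ℝ) := by positivity
  have hl1 : ∑ n ∈ Finset.range N, |a n| ≤ C1 + 1 := by
    have : ∑ n ∈ Finset.range N, |a n| ≤ ∑ n ∈ Finset.range N, (a1 n + |a n - a1 n|) := by
      refine Finset.sum_le_sum fun n _ => ?_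
      have h1 := abs_add_le (a1 n) (a n - a1 n)
      rw [add_sub_cancel, abs_of_nonneg (hadm.nonneg n)] at h1
      exact h1
    rw [Finset.sum_add_distrib] at this
    linarith
  refine concl N ⌊(N:ℝ) ^ (1/25 : ℝ)⌋₊ (fun ξ => ‖fourierZN N a ξ‖) (fun ξ => ‖fourierZN N a1 ξ‖)
    (fun _ => norm_nonneg _) C1 ε r ((N:ℝ) ^ (-(1/56) : ℝ)) Z (C1 + 1) hC1 hr2 hδ0 ?_ ?_ n1 n2 hZ ?_
  · intro ξ
    have h1 : fourierZN N a ξ = fourierZN N a1 ξ + ∑ n ∈ Finset.range N, ((a n - a1 n : ℝ) : ℂ) * e (-((ξ : ℝ) * n / N)) := by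
      unfold fourierZN
      rw [← Finset.sum_add_distrib]
      refine Finset.sum_congr rfl fun n _ => ?_
      push_cast; ring
    have h2 : ‖∑ n ∈ Finset.range N, ((a n - a1 n : ℝ) : ℂ) * e (-((ξ : ℝ) * n / N))‖ ≤ ∑ n ∈ Finset.range N, |a n - a1 n| := by
      refine le_trans (norm_sum_le _ _) (Finset.sum_le_sum fun n _ => ?_)
      rw [norm_mul, norm_e, mul_one, Complex.norm_real, Real.norm_eq_abs]
    rw [h1]
    exact (norm_add_le _ _).trans (by linarith)
  · intro R hR hne hRc
    apply k2 R hR hne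
    calc (R.card:ℝ) ≤ (⌊(N:ℝ) ^ (1/25 : ℝ)⌋₊ : ℝ) := by exact_mod_cast hRc
      _ ≤ _ := Nat.floor_le (by positivity)
  · rw [plancherel N (by omega) a]
    have h1 : ∑ n ∈ Finset.range N, a n ^ 2 ≤ (N:ℝ) ^ (η - γ) * (C1 + 1) := by
      calc _ ≤ ∑ n ∈ Finset.range N, (N:ℝ) ^ (η - γ) * |a n| := by
            refine Finset.sum_le_sum fun n _ => ?_
            rw [← sq_abs, sq]
            exact mul_le_mul_of_nonneg_right (m1 n) (abs_nonneg _)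
        _ ≤ _ := by
            rw [← Finset.mul_sum]
            exact mul_le_mul_of_nonneg_left hl1 (by positivity)
    calc ((N:ℝ) ^ (-(1/56) : ℝ)) ^ (r - 2) * (N * ∑ n ∈ Finset.range N, a n ^ 2)
        ≤ ((N:ℝ) ^ (-(1/56) : ℝ)) ^ (r - 2) * (N * ((N:ℝ) ^ (η - γ) * (C1 + 1))) := by gcongr
      _ = ((N:ℝ) ^ (-(1/56) * (r - 2) : ℝ) * (N:ℝ) ^ (1:ℝ) * (N:ℝ) ^ (η - γ)) * (C1 + 1) := by
          rw [Real.rpow_mul hN0.le, Real.rpow_one]; ring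
      _ = C1 + 1 := by
          rw [← Real.rpow_add hN0, ← Real.rpow_add hN0]
          have : -(1/56) * (r - 2) + 1 + (η - γ) = 0 := by rw [hη]; ring
          rw [this, Real.rpow_zero, one_mul]
      _ ≤ _ := le_rfl

end DMP

theorem discrete_majorant_property {c : ℝ} (hc₁ : 1 ≤ c) (hc₂ : c < 16 / 15)
    (γ : ℝ) (hγ : γ = 1 / c) (F : Fc c)
    (φ : ℝ → ℝ) (hφ₁ : ∀ x ≥ F.x₀, φ (F.toFun x) = x)
    (hφ₂ : ∀ y ≥ F.toFun F.x₀, F.toFun (φ y) = y)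
    (hφ₃ : ∀ y ≥ F.toFun F.x₀, F.x₀ ≤ φ y)
    (r : ℝ) (hr : (26 - 24 * γ) / (16 * γ - 15) < r) :
    ∃ C > 0, ∀ N : ℕ, N.Prime → ∀ m b : ℕ, 1 ≤ m → (m : ℝ) ≤ Real.log N →
      b ≤ m - 1 → Nat.gcd b m = 1 →
      ∀ A : Finset ℕ, A ⊆ Finset.Icc 1 (N / 2) →
      ∑ ξ ∈ Finset.range N,
        ‖fourierZN N (fun n => if n ∈ A then lamh F φ b m N n else 0) ξ‖ ^ r ≤ C := by
  obtain ⟨φ1, φ2, X0, hX, h⟩ := DMP.phi_ok F φ hc₁ hφ₁ hφ₂ hφ₃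
  rw [← hγ] at h
  have hc0 : 0 < c := by linarith
  have hγ1 : γ ≤ 1 := by rw [hγ, div_le_one hc0]; exact hc₁
  have hγ0 : 15 / 16 < γ := by
    rw [hγ, lt_div_iff₀ hc0]; linarith
  have hpos : 0 < 16 * γ - 15 := by linarith
  have hr' : 1 - γ < (r - 2) / 56 ∧ 2 < r := by
    have h1 : (26 - 24 * γ) / (16 * γ - 15) = 2 + 56 * ((1 - γ) / (16 * γ - 15)) := by
      have hne : 16 * γ - 15 ≠ 0 := hpos.ne'
      rw [div_eq_iff hne, add_mul, mul_assoc, div_mul_cancel₀ _ hne]; ring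
    have h2 : 1 - γ ≤ (1 - γ) / (16 * γ - 15) := by
      rw [le_div_iff₀ hpos]; nlinarith
    constructor <;> linarith
  obtain ⟨C, hC, hbig⟩ := DMP.big_N F h hX hγ0 hγ1 hφ₁ hφ₂ hφ₃ r hr'.2 hr'.1
  obtain ⟨N0, hN0⟩ := eventually_atTop.1 hbig
  choose D hD hsmall using DMP.small_N F φ r (by linarith [hr'.2])
  have hsum : 0 ≤ ∑ N ∈ Finset.range N0, D N := Finset.sum_nonneg fun N _ => (hD N).le
  refine ⟨C + ∑ N ∈ Finset.range N0, D N, by linarith, ?_⟩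
  intro N _ m b hm hmN hb _ A hA
  by_cases hN : N0 ≤ N
  · exact (hN0 N hN m b hm hmN hb A hA).trans (by linarith)
  · have h1 := hsmall N m b hm hmN hb A
    have h2 : D N ≤ ∑ N ∈ Finset.range N0, D N :=
      Finset.single_le_sum (f := D) (fun N _ => (hD N).le) (Finset.mem_range.2 (by omega))
    linarith
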